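/- Let n ≥ 1 and suppose (1/p, 1/q) lies on the half-open segment (A, B] (so that 2/q + n/p = n and (n−1)/(n+1) < 1/p ≤ 1). Then with α = 2p/(p+1) there is a constant C such that for every family {f_j} orthonormal in L²(ℝⁿ) and every {λ_j} ∈ ℓ^α one has ‖ Σ_j λ_j |e^{itΔ}f_j|² ‖_{L^q(ℝ, L^p(ℝⁿ))} ≤ C ‖{λ_j}‖_{ℓ^α}. -/

import Mathlib

noncomputable section

open MeasureTheory ENNReal Real Set

namespace OS

/-- `ℝⁿ` as a Euclidean space. -/
abbrev Rn (n : ℕ) := EuclideanSpace ℝ (Fin n)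

/-- The real dot product `x·ξ`, viewed as a complex number. -/
def dotC {n : ℕ} (x ξ : Rn n) : ℂ := ((∑ i, x i * ξ i : ℝ) : ℂ)

/-- The Fourier transform `f̂(ξ) = ∫ f(x) e^{-i x·ξ} dx`. -/
def FT {n : ℕ} (f : Rn n → ℂ) (ξ : Rn n) : ℂ :=
  ∫ x : Rn n, Complex.exp (-(Complex.I * dotC x ξ)) * f x

/-- The propagator `e^{itΔ}` composed with a Fourier multiplier `m`:
`x ↦ (2π)^{-n} ∫ e^{i(x·ξ - t|ξ|²)} m(ξ) f̂(ξ) dξ`. -/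
def prop {n : ℕ} (m : Rn n → ℂ) (f : Rn n → ℂ) (t : ℝ) (x : Rn n) : ℂ :=
  ((2 * π : ℝ) ^ (-(n : ℝ)) : ℝ) •
    ∫ ξ : Rn n, Complex.exp (Complex.I * (dotC x ξ - (t : ℂ) * ((‖ξ‖ : ℝ) : ℂ) ^ 2)) *
      (m ξ * FT f ξ)

/-- The free Schrödinger propagator `e^{itΔ} f`, as a function of `(t, x)`. -/
def schrodinger {n : ℕ} (f : Rn n → ℂ) : ℝ → Rn n → ℂ := prop (fun _ => 1) f

/-- The Fourier multiplier `|ξ|^{-s} ψ(2^{-k}|ξ|)` of `(-Δ)^{-s/2} P_k`. -/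
def LPmult {n : ℕ} (s : ℝ) (ψ : ℝ → ℝ) (k : ℤ) (ξ : Rn n) : ℂ :=
  ((‖ξ‖ ^ (-s) * ψ ((2 : ℝ) ^ (-k) * ‖ξ‖) : ℝ) : ℂ)

/-- The Littlewood–Paley projection `P_k h`. -/
def LP {n : ℕ} (ψ : ℝ → ℝ) (k : ℤ) (h : Rn n → ℂ) (x : Rn n) : ℂ :=
  ((2 * π : ℝ) ^ (-(n : ℝ)) : ℝ) •
    ∫ ξ : Rn n, Complex.exp (Complex.I * dotC x ξ) *
      (((ψ ((2 : ℝ) ^ (-k) * ‖ξ‖) : ℝ) : ℂ) * FT h ξ)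

/-- The standing hypotheses on the Littlewood–Paley bump function `ψ`:
smooth, `[0,1]`-valued, supported in `[1/2,2]`, with `∑_{k∈ℤ} ψ(2^{-k} r) = 1` for `r ≠ 0`. -/
structure IsLPF (ψ : ℝ → ℝ) : Prop where
  smooth : ContDiff ℝ (⊤ : ℕ∞) ψ
  mem_Icc : ∀ r, ψ r ∈ Icc (0 : ℝ) 1
  supp : Function.support ψ ⊆ Icc (1 / 2 : ℝ) 2
  sum_one : ∀ r : ℝ, r ≠ 0 → ∑' k : ℤ, ψ ((2 : ℝ) ^ (-k) * r) = 1

/-- Orthonormality in `L²(ℝⁿ)`. -/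
def OrthonormalL2 {n : ℕ} (f : ℕ → Rn n → ℂ) : Prop :=
  ∀ j k, (∫ x : Rn n, f j x * (starRingEnd ℂ) (f k x)) = if j = k then 1 else 0

/-- Orthonormality in the homogeneous Sobolev space `Ḣ^s(ℝⁿ)`:
`(2π)^{-n} ∫ |ξ|^{2s} f̂_j(ξ) conj(f̂_k(ξ)) dξ = δ_{jk}`. -/
def OrthonormalHs {n : ℕ} (s : ℝ) (f : ℕ → Rn n → ℂ) : Prop :=
  ∀ j k, ((2 * π : ℝ) ^ (-(n : ℝ)) : ℝ) •
    (∫ ξ : Rn n, ((‖ξ‖ ^ (2 * s) : ℝ) : ℂ) * (FT (f j) ξ * (starRingEnd ℂ) (FT (f k) ξ)))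
      = if j = k then 1 else 0

/-- The density `Σ_j λ_j |u_j(t,x)|²` of a system of space-time functions. -/
def density2 {n : ℕ} (lam : ℕ → ℝ) (u : ℕ → ℝ → Rn n → ℂ) (t : ℝ) (x : Rn n) : ℝ :=
  ∑' j, lam j * ‖u j t x‖ ^ 2

/-- The density `Σ_j λ_j |e^{itΔ}f_j(x)|²`. -/
def density {n : ℕ} (lam : ℕ → ℝ) (f : ℕ → Rn n → ℂ) : ℝ → Rn n → ℝ :=
  density2 lam fun j => schrodinger (f j)

/-- The `L^q` norm (w.r.t. `μ`) of an `ℝ≥0∞`-valued function. -/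
def eLp {α : Type*} [MeasurableSpace α] (μ : Measure α) (q : ℝ≥0∞) (F : α → ℝ≥0∞) : ℝ≥0∞ :=
  if q = ∞ then essSup F μ
  else (∫⁻ t, F t ^ q.toReal ∂μ) ^ (1 / q.toReal)

/-- The Lorentz `L^{p,r}` (quasi)norm of an `ℝ≥0∞`-valued function, via the
distribution function.  For `r = ∞` this is the weak-`L^p` quasinorm
`sup_{s>0} s μ(G > s)^{1/p} = sup_{t>0} t^{1/p} G^*(t)`. -/
def lor {α : Type*} [MeasurableSpace α] (μ : Measure α) (p r : ℝ≥0∞) (G : α → ℝ≥0∞) : ℝ≥0∞ :=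
  if p = ∞ then essSup G μ
  else if r = ∞ then
    ⨆ (s : ℝ) (_ : 0 < s), ENNReal.ofReal s * μ {x | ENNReal.ofReal s < G x} ^ (1 / p.toReal)
  else
    (∫⁻ s in Ioi (0 : ℝ),
      (ENNReal.ofReal s * μ {x | ENNReal.ofReal s < G x} ^ (1 / p.toReal)) ^ r.toReal *
        (ENNReal.ofReal s)⁻¹) ^ (1 / r.toReal)

/-- The mixed norm `‖u‖_{L^q(ℝ, L^p(ℝⁿ))}`. -/
def mixedLp {n : ℕ} {E : Type*} [NormedAddCommGroup E] (q p : ℝ≥0∞)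
    (u : ℝ → Rn n → E) : ℝ≥0∞ :=
  eLp volume q fun t => eLpNorm (u t) p volume

/-- The mixed norm `‖u‖_{L^{q,∞}(ℝ, L^p(ℝⁿ))}` (weak in time). -/
def mixedWeakLp {n : ℕ} {E : Type*} [NormedAddCommGroup E] (q p : ℝ≥0∞)
    (u : ℝ → Rn n → E) : ℝ≥0∞ :=
  lor volume q ∞ fun t => eLpNorm (u t) p volume

/-- The weak `L^{p,∞}(ℝⁿ)` quasinorm. -/
def wLp {n : ℕ} {E : Type*} [NormedAddCommGroup E] (p : ℝ≥0∞) (g : Rn n → E) : ℝ≥0∞ :=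
  lor volume p ∞ fun x => (‖g x‖₊ : ℝ≥0∞)

/-- The mixed Lorentz norm `‖u‖_{L^{q,r}(ℝ, L^{p,r̃}(ℝⁿ))}`. -/
def mixedLorentz {n : ℕ} {E : Type*} [NormedAddCommGroup E] (q r p rt : ℝ≥0∞)
    (u : ℝ → Rn n → E) : ℝ≥0∞ :=
  lor volume q r fun t => lor volume p rt fun x => (‖u t x‖₊ : ℝ≥0∞)

/-- The `ℓ^a` norm of a sequence (with `ℓ^∞` the supremum norm). -/
def seqNormE (a : ℝ≥0∞) (lam : ℕ → ℝ) : ℝ≥0∞ :=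
  if a = ∞ then ⨆ j, ENNReal.ofReal |lam j|
  else (∑' j, ENNReal.ofReal |lam j| ^ a.toReal) ^ (1 / a.toReal)

/-- The decreasing rearrangement of a sequence: `seqRearr lam j` is the
`(j+1)`-th largest value of `|lam i|`. -/
def seqRearr (lam : ℕ → ℝ) (j : ℕ) : ℝ≥0∞ :=
  sInf {s : ℝ≥0∞ | Measure.count {i : ℕ | s < ENNReal.ofReal |lam i|} ≤ (j : ℝ≥0∞)}

/-- The Lorentz sequence norm `‖lam‖_{ℓ^{q,r}} = (Σ_j (j^{1/q} λ*_j)^r / j)^{1/r}`,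
parametrized by `qinv = 1/q` and a finite second exponent `r`. -/
def seqLor (qinv r : ℝ) (lam : ℕ → ℝ) : ℝ≥0∞ :=
  (∑' j : ℕ, (((j : ℝ≥0∞) + 1) ^ qinv * seqRearr lam j) ^ r * ((j : ℝ≥0∞) + 1)⁻¹) ^ (1 / r)

/-- The interior of the triangle `OAB`, in the coordinates `(a, b) = (1/p, 1/q)`. -/
def IntOAB (n : ℕ) (a b : ℝ) : Prop :=
  a ∈ Ioo (0 : ℝ) 1 ∧ b ∈ Ioo (0 : ℝ) 1 ∧ b < (n : ℝ) / (n - 1) * a ∧ 2 * b + n * a < n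

/-- The interior of the quadrilateral `OCDA`, in the coordinates `(a, b) = (1/p, 1/q)`. -/
def IntOCDA (n : ℕ) (a b : ℝ) : Prop :=
  a ∈ Ioo (0 : ℝ) 1 ∧ b ∈ Ioo (0 : ℝ) 1 ∧ (n : ℝ) / (n - 1) * a < b ∧ 2 * b + n * a < n

def ptO : ℝ × ℝ := (0, 0)
def ptA (n : ℕ) : ℝ × ℝ := (((n : ℝ) - 1) / (n + 1), (n : ℝ) / (n + 1))
def ptB : ℝ × ℝ := (1, 0)
def ptC : ℝ × ℝ := (0, 1)
def ptD (n : ℕ) : ℝ × ℝ := (((n : ℝ) - 2) / n, 1)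

/-- The closed triangle `OAB`. -/
def OAB (n : ℕ) : Set (ℝ × ℝ) := convexHull ℝ {ptO, ptA n, ptB}

/-- The closed quadrilateral `OCDA`. -/
def OCDA (n : ℕ) : Set (ℝ × ℝ) := convexHull ℝ {ptO, ptC, ptD n, ptA n}

/-- The half-open segment `[A, D)`. -/
def segAD (n : ℕ) : Set (ℝ × ℝ) := {x | ∃ t ∈ Ico (0 : ℝ) 1, x = (1 - t) • ptA n + t • ptD n}

/-- The Lebesgue exponent with reciprocal `a` (so `expOf 0 = ∞`). -/
def expOf (a : ℝ) : ℝ≥0∞ := (ENNReal.ofReal a)⁻¹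

/-- The weighted velocity average `∫ f(x - tv, v) |v|^{-2s} dv` of the solution of
the kinetic transport equation with datum `f`. -/
def velAvg {n : ℕ} (s : ℝ) (f : Rn n × Rn n → ℂ) (t : ℝ) (x : Rn n) : ℂ :=
  ∫ v : Rn n, ((‖v‖ ^ (-(2 * s)) : ℝ) : ℂ) * f (x - t • v, v)

end OS

open OS

section OrthonormalStrichartz

open scoped ComplexConjugate NNReal

variable {n : ℕ}

lemma lintegral_comp_enorm_le (ψ : ℝ≥0∞ → ℝ≥0∞) :
    ∫⁻ u : ℝ, ψ ‖u‖ₑ ≤ 2 * ∫⁻ u in Ioi (0 : ℝ), ψ (ENNReal.ofReal u) := by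
  have hpos : ∫⁻ u in Ioi (0 : ℝ), ψ ‖u‖ₑ = ∫⁻ u in Ioi (0 : ℝ), ψ (ENNReal.ofReal u) := by
    refine setLIntegral_congr_fun measurableSet_Ioi fun u hu => ?_
    simp only [Real.enorm_of_nonneg (le_of_lt hu)]
  have hneg : ∫⁻ u in Iio (0 : ℝ), ψ ‖u‖ₑ = ∫⁻ u in Ioi (0 : ℝ), ψ ‖u‖ₑ := by
    have := (Measure.measurePreserving_neg (volume : Measure ℝ)).setLIntegral_comp_preimage_emb
      (MeasurableEquiv.neg ℝ).measurableEmbedding (fun u => ψ ‖u‖ₑ) (Ioi 0)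
    simpa using this
  calc ∫⁻ u : ℝ, ψ ‖u‖ₑ
      ≤ (∫⁻ u in Iic (0 : ℝ), ψ ‖u‖ₑ) + ∫⁻ u in Ioi (0 : ℝ), ψ ‖u‖ₑ := by
        rw [← setLIntegral_univ, ← Iic_union_Ioi (a := (0 : ℝ))]
        exact lintegral_union_le _ _ _
    _ = 2 * ∫⁻ u in Ioi (0 : ℝ), ψ (ENNReal.ofReal u) := by
        rw [setLIntegral_congr Iio_ae_eq_Iic.symm, hneg, hpos, two_mul]

lemma lintegral_Ioo_rpow {e R : ℝ} (he : 0 < e) (hR : 0 ≤ R) :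
    ∫⁻ s in Ioo (0 : ℝ) R, ENNReal.ofReal (s ^ (e - 1)) = ENNReal.ofReal (R ^ e / e) := by
  have hIntegrable : IntervalIntegrable (fun s : ℝ => s ^ (e - 1)) volume 0 R :=
    intervalIntegral.intervalIntegrable_rpow' (by linarith)
  rw [← ofReal_integral_eq_lintegral_ofReal]
  · rw [← integral_Ioc_eq_integral_Ioo, ← intervalIntegral.integral_of_le hR,
      integral_rpow (Or.inl (by linarith))]
    simp [Real.zero_rpow he.ne']
  · exact ((intervalIntegrable_iff_integrableOn_Ioc_of_le hR).1 hIntegrable).mono_set Ioo_subset_Ioc_self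
  · filter_upwards [ae_restrict_mem measurableSet_Ioo] with s hs
    exact Real.rpow_nonneg hs.1.le _

lemma lintegral_near {δ R : ℝ} (hδ : δ < 1) (hR : 0 ≤ R) (t : ℝ) :
    ∫⁻ t' : ℝ, {u : ℝ≥0∞ | u < ENNReal.ofReal R}.indicator (fun u => u ^ (-δ)) ‖t - t'‖ₑ
      ≤ ENNReal.ofReal (2 / (1 - δ)) * ENNReal.ofReal (R ^ (1 - δ)) := by
  rw [lintegral_sub_left_eq_self (μ := volume)
    (fun u : ℝ => {u : ℝ≥0∞ | u < ENNReal.ofReal R}.indicator (fun u => u ^ (-δ)) ‖u‖ₑ) t]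
  refine (lintegral_comp_enorm_le _).trans ?_
  have : ∫⁻ u in Ioi (0 : ℝ), {u : ℝ≥0∞ | u < ENNReal.ofReal R}.indicator (fun u => u ^ (-δ))
      (ENNReal.ofReal u) ≤ ∫⁻ s in Ioo (0 : ℝ) R, ENNReal.ofReal (s ^ ((1 - δ) - 1)) := by
    rw [← lintegral_indicator measurableSet_Ioi, ← lintegral_indicator measurableSet_Ioo]
    refine lintegral_mono fun u => ?_
    by_cases hu : 0 < u
    · by_cases hR : u < R
      · simp only [indicator, mem_Ioi, hu, mem_Ioo, hR, and_self, if_true, mem_ofPred_eq]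
        split_ifs
        · rw [ENNReal.ofReal_rpow_of_pos hu]
          ring_nf; rfl
        · simp
      · have : ¬ ENNReal.ofReal u < ENNReal.ofReal R := by
          rw [ENNReal.ofReal_lt_ofReal_iff_of_nonneg hu.le]; exact hR
        simp [indicator, this]
    · simp [indicator, hu]
  refine (mul_le_mul_right this 2).trans ?_
  rw [lintegral_Ioo_rpow (by linarith) hR, ← ENNReal.ofReal_mul (by
    apply div_nonneg <;> linarith), ← ENNReal.ofReal_ofNat 2, ← ENNReal.ofReal_mul (by norm_num)]
  apply le_of_eq; congr 1; ring

lemma lintegral_far {R : ℝ} (hR : 0 < R) (t : ℝ) :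
    ∫⁻ t' : ℝ, {u : ℝ≥0∞ | ENNReal.ofReal R ≤ u}.indicator (fun u => u ^ (-2 : ℝ)) ‖t - t'‖ₑ
      ≤ ENNReal.ofReal (2 / R) := by
  rw [lintegral_sub_left_eq_self (μ := volume)
    (fun u : ℝ => {u : ℝ≥0∞ | ENNReal.ofReal R ≤ u}.indicator (fun u => u ^ (-2 : ℝ)) ‖u‖ₑ) t]
  refine (lintegral_comp_enorm_le _).trans ?_
  have : ∫⁻ u in Ioi (0 : ℝ), {u : ℝ≥0∞ | ENNReal.ofReal R ≤ u}.indicator (fun u => u ^ (-2 : ℝ))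
      (ENNReal.ofReal u) ≤ ∫⁻ s in Ici R, ENNReal.ofReal (s ^ (-2 : ℝ)) := by
    rw [← lintegral_indicator measurableSet_Ioi, ← lintegral_indicator measurableSet_Ici]
    refine lintegral_mono fun u => ?_
    by_cases hu : 0 < u
    · simp only [indicator, mem_Ioi, hu, mem_Ici, if_true, mem_ofPred_eq,
        ENNReal.ofReal_le_ofReal_iff hu.le]
      split_ifs
      · rw [ENNReal.ofReal_rpow_of_pos hu]
      · simp
    · simp [indicator, hu]
  refine (mul_le_mul_right this 2).trans ?_
  rw [setLIntegral_congr Ioi_ae_eq_Ici.symm, ← ofReal_integral_eq_lintegral_ofReal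
    (integrableOn_Ioi_rpow_of_lt (by norm_num) hR), integral_Ioi_rpow_of_lt (by norm_num) hR,
    ← ENNReal.ofReal_ofNat 2, ← ENNReal.ofReal_mul (by norm_num)]
  · apply le_of_eq; congr 1
    norm_num [Real.rpow_neg_one]
    ring
  · filter_upwards [ae_restrict_mem measurableSet_Ioi] with s hs
    exact Real.rpow_nonneg (hR.trans hs).le _

lemma rpow_mul_rpow_le_add {x y : ℝ≥0∞} {a b : ℝ} (ha : 0 ≤ a) (hb : 0 ≤ b) (hab : a + b = 1) :
    x ^ a * y ^ b ≤ x + y := by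
  calc x ^ a * y ^ b ≤ (max x y) ^ a * (max x y) ^ b := by
        gcongr
        · exact le_max_left _ _
        · exact le_max_right _ _
    _ = max x y := by rw [← ENNReal.rpow_add_of_nonneg _ _ ha hb, hab, ENNReal.rpow_one]
    _ ≤ x + y := max_le le_self_add le_add_self

/-- The contribution to the Hardy–Littlewood–Sobolev form of the points where the second factor
is dominated by the first. -/
lemma hls_inner {δ : ℝ} (h0 : 0 < δ) (h1 : δ < 1) {f : ℝ → ℝ≥0∞} (hf : Measurable f)
    (hI : ∫⁻ t, f t ^ (2 / (2 - δ)) ≤ 2) (t : ℝ) (ht : f t ≠ ∞) :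
    ∫⁻ t', {y | y ≤ f t}.indicator (fun y => f t * y) (f t') * ‖t - t'‖ₑ ^ (-δ)
      ≤ (ENNReal.ofReal (2 / (1 - δ)) + 4) * f t ^ (2 / (2 - δ)) := by
  set r := 2 / (2 - δ) with hr
  have hδ2 : 0 < 2 - δ := by linarith
  have hr0 : 0 < r := by positivity
  by_cases hz : f t = 0
  · simp only [hz, zero_mul]
    simp [indicator]
  set A := (f t).toReal with hA
  have hApos : 0 < A := ENNReal.toReal_pos hz ht
  have hfA : f t = ENNReal.ofReal A := (ENNReal.ofReal_toReal ht).symm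
  set R := A ^ (-r) with hR
  have hRpos : 0 < R := Real.rpow_pos_of_pos hApos _
  have key : ∀ t', {y | y ≤ f t}.indicator (fun y => f t * y) (f t') * ‖t - t'‖ₑ ^ (-δ) ≤
      f t * f t * {u : ℝ≥0∞ | u < ENNReal.ofReal R}.indicator (fun u => u ^ (-δ)) ‖t - t'‖ₑ
      + f t * f t ^ (r - 1) * (f t' ^ r + ENNReal.ofReal R *
        {u : ℝ≥0∞ | ENNReal.ofReal R ≤ u}.indicator (fun u => u ^ (-2 : ℝ)) ‖t - t'‖ₑ) := by
    intro t'
    by_cases hu : ‖t - t'‖ₑ < ENNReal.ofReal R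
    · refine le_add_right ?_
      simp only [indicator, mem_ofPred_eq, hu, if_true]
      gcongr
      split_ifs with h
      · gcongr
      · simp
    · refine le_add_left ?_
      simp only [indicator, mem_ofPred_eq, not_lt.1 hu, if_true]
      have hu' := not_lt.1 hu
      have e1 : f t' * ‖t - t'‖ₑ ^ (-δ) ≤
          f t ^ (r - 1) * (f t' ^ r + ENNReal.ofReal R * ‖t - t'‖ₑ ^ (-2 : ℝ)) := by
        have := rpow_mul_rpow_le_add (x := f t' ^ r) (y := ENNReal.ofReal R * ‖t - t'‖ₑ ^ (-2 : ℝ))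
          (a := 1 - δ / 2) (b := δ / 2) (by linarith) (by linarith) (by ring)
        refine le_trans (le_of_eq ?_) (mul_le_mul_right this _)
        rw [← ENNReal.rpow_mul, ENNReal.mul_rpow_of_nonneg _ _ (by linarith), ← ENNReal.rpow_mul,
          ENNReal.ofReal_rpow_of_pos hRpos, hfA, ENNReal.ofReal_rpow_of_pos hApos, hR,
          ← Real.rpow_mul hApos.le]
        have e2 : r * (1 - δ / 2) = 1 := by rw [hr]; field_simp
        have e3 : (-2 : ℝ) * (δ / 2) = -δ := by ring
        have e4 : r - 1 + -r * (δ / 2) = 0 := by linarith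
        rw [e2, e3, ENNReal.rpow_one]
        calc f t' * ‖t - t'‖ₑ ^ (-δ)
            = (ENNReal.ofReal (A ^ (r - 1)) * ENNReal.ofReal (A ^ (-r * (δ / 2)))) *
                (f t' * ‖t - t'‖ₑ ^ (-δ)) := by
              rw [← ENNReal.ofReal_mul (by positivity), ← Real.rpow_add hApos, e4]; simp
          _ = _ := by ring
      split_ifs
      · rw [mul_assoc, mul_assoc]; gcongr
      · simp
  refine (lintegral_mono key).trans ?_
  have hm1 : Measurable fun t' : ℝ =>
      {u : ℝ≥0∞ | u < ENNReal.ofReal R}.indicator (fun u => u ^ (-δ)) ‖t - t'‖ₑ := by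
    refine (Measurable.indicator (by fun_prop) measurableSet_Iio).comp (by fun_prop)
  have hm2 : Measurable fun t' : ℝ =>
      {u : ℝ≥0∞ | ENNReal.ofReal R ≤ u}.indicator (fun u => u ^ (-2 : ℝ)) ‖t - t'‖ₑ := by
    refine (Measurable.indicator (by fun_prop) measurableSet_Ici).comp (by fun_prop)
  rw [lintegral_add_left (hm1.const_mul _), lintegral_const_mul _ hm1, lintegral_const_mul _
    (by fun_prop), lintegral_add_left (hf.pow_const _),
    lintegral_const_mul _ hm2, add_mul]
  have e5 : f t * f t ^ (r - 1) = f t ^ r := by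
    rw [hfA, ENNReal.ofReal_rpow_of_pos hApos, ENNReal.ofReal_rpow_of_pos hApos,
      ← ENNReal.ofReal_mul hApos.le, ← Real.rpow_one_add' hApos.le (by linarith)]
    ring_nf
  have e6 : f t * f t * ENNReal.ofReal (R ^ (1 - δ)) = f t ^ r := by
    rw [hfA, ENNReal.ofReal_rpow_of_pos hApos, ← ENNReal.ofReal_mul hApos.le,
      ← ENNReal.ofReal_mul (by positivity), hR, ← Real.rpow_mul hApos.le]
    congr 1
    have : A * A = A ^ (2 : ℝ) := by rw [Real.rpow_two]; ring
    rw [this, ← Real.rpow_add hApos]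
    congr 1
    rw [hr]; field_simp; ring
  gcongr ?_ + ?_
  · calc _ ≤ f t * f t * (ENNReal.ofReal (2 / (1 - δ)) * ENNReal.ofReal (R ^ (1 - δ))) := by
          gcongr; exact lintegral_near h1 hRpos.le t
      _ = ENNReal.ofReal (2 / (1 - δ)) * (f t * f t * ENNReal.ofReal (R ^ (1 - δ))) := by ring
      _ = _ := by rw [e6]
  · rw [e5, mul_comm]
    gcongr
    calc _ ≤ 2 + ENNReal.ofReal R * ENNReal.ofReal (2 / R) := by
          gcongr; exact lintegral_far hRpos t
      _ = 4 := by
        rw [← ENNReal.ofReal_mul hRpos.le, mul_div_cancel₀ _ hRpos.ne']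
        norm_num

/-- The diagonal Hardy–Littlewood–Sobolev inequality on the line. -/
lemma hardy_littlewood_sobolev {δ : ℝ} (h0 : 0 < δ) (h1 : δ < 1) :
    ∃ C : ℝ≥0∞, C ≠ ∞ ∧ ∀ f : ℝ → ℝ≥0∞, Measurable f → ∫⁻ t, f t ^ (2 / (2 - δ)) ≤ 2 →
      ∫⁻ t, ∫⁻ t', f t * f t' * ‖t - t'‖ₑ ^ (-δ) ≤ C := by
  set B : ℝ≥0∞ := ENNReal.ofReal (2 / (1 - δ)) + 4 with hB
  have hBtop : B ≠ ∞ := by simp [hB]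
  refine ⟨2 * (B * 2), by finiteness, fun f hf hI => ?_⟩
  have hδ2 : 0 < 2 - δ := by linarith
  have hfin : ∀ᵐ t, f t ≠ ∞ := by
    have := ae_lt_top (hf.pow_const (2 / (2 - δ))) (hI.trans_lt (by simp)).ne
    filter_upwards [this] with t ht h
    rw [h, ENNReal.top_rpow_of_pos (by positivity)] at ht
    exact lt_irrefl _ ht
  set J : ℝ → ℝ → ℝ≥0∞ := fun t t' =>
    {y | y ≤ f t}.indicator (fun y => f t * y) (f t') * ‖t - t'‖ₑ ^ (-δ) with hJ
  have hJm : Measurable (Function.uncurry J) := by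
    have : Function.uncurry J = fun z : ℝ × ℝ =>
        ({z : ℝ × ℝ | f z.2 ≤ f z.1}.indicator (fun z => f z.1 * f z.2) z) *
          ‖z.1 - z.2‖ₑ ^ (-δ) := by
      ext z; simp [hJ, Function.uncurry, indicator]
    rw [this]
    refine Measurable.mul (Measurable.indicator (by fun_prop) ?_) (by fun_prop)
    exact measurableSet_le (by fun_prop) (by fun_prop)
  have hJle : ∫⁻ t, ∫⁻ t', J t t' ≤ B * 2 := by
    calc ∫⁻ t, ∫⁻ t', J t t' ≤ ∫⁻ t, B * f t ^ (2 / (2 - δ)) := by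
          refine lintegral_mono_ae ?_
          filter_upwards [hfin] with t ht
          exact hls_inner h0 h1 hf hI t ht
      _ = B * ∫⁻ t, f t ^ (2 / (2 - δ)) := lintegral_const_mul _ (hf.pow_const _)
      _ ≤ B * 2 := by gcongr
  have hle : ∀ t t', f t * f t' * ‖t - t'‖ₑ ^ (-δ) ≤ J t t' + J t' t := by
    intro t t'
    rcases le_total (f t') (f t) with h | h
    · refine le_add_right ?_
      simp [hJ, indicator, h]
    · refine le_add_left ?_
      simp only [hJ, indicator, mem_ofPred_eq, h, if_true]
      rw [mul_comm (f t), ← enorm_neg (t - t'), neg_sub]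
  calc ∫⁻ t, ∫⁻ t', f t * f t' * ‖t - t'‖ₑ ^ (-δ)
      ≤ ∫⁻ t, ∫⁻ t', (J t t' + J t' t) := lintegral_mono fun t => lintegral_mono fun t' => hle t t'
    _ = ∫⁻ t, ((∫⁻ t', J t t') + ∫⁻ t', J t' t) := by
        refine lintegral_congr fun t => lintegral_add_left ?_ _
        exact hJm.comp measurable_prodMk_left
    _ = (∫⁻ t, ∫⁻ t', J t t') + ∫⁻ t, ∫⁻ t', J t' t :=
        lintegral_add_left hJm.lintegral_prod_right' _
    _ = (∫⁻ t, ∫⁻ t', J t t') + ∫⁻ t, ∫⁻ t', J t t' := by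
        rw [lintegral_lintegral_swap (f := fun t t' => J t' t)
          (hJm.comp measurable_swap).aemeasurable]
    _ ≤ 2 * (B * 2) := by rw [two_mul]; gcongr

lemma sum_two_zpow_le (s : Finset ℤ) : ∀ m : ℤ, (∀ j ∈ s, j < m) →
    ∑ j ∈ s, (2 : ℝ≥0∞) ^ j ≤ 2 ^ m := by
  induction s using Finset.induction_on_max with
  | empty => simp
  | insert a s ha ih =>
    intro m hm
    rw [Finset.sum_insert (fun h => lt_irrefl _ (ha a h))]
    calc (2 : ℝ≥0∞) ^ a + ∑ j ∈ s, (2 : ℝ≥0∞) ^ j ≤ 2 ^ a + 2 ^ a := by gcongr; exact ih a ha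
      _ = 2 ^ (a + 1) := by
        rw [ENNReal.zpow_add (by norm_num) (by norm_num), zpow_one, mul_two]
      _ ≤ 2 ^ m := ENNReal.zpow_le_of_le (by norm_num) (hm a (Finset.mem_insert_self _ _))

lemma tsum_two_zpow_le (X : ℝ≥0∞) :
    ∑' m : ℤ, (if (2 : ℝ≥0∞) ^ m ≤ X then (2 : ℝ≥0∞) ^ m else 0) ≤ 2 * X := by
  rw [ENNReal.tsum_eq_iSup_sum]
  refine iSup_le fun s => ?_
  rw [← Finset.sum_filter]
  set u := s.filter fun m : ℤ => (2 : ℝ≥0∞) ^ m ≤ X with hu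
  rcases u.eq_empty_or_nonempty with h | h
  · simp [h]
  · refine (sum_two_zpow_le u (u.max' h + 1) fun j hj => ?_).trans ?_
    · exact Int.lt_add_one_of_le (u.le_max' j hj)
    · rw [ENNReal.zpow_add (by norm_num) (by norm_num), zpow_one, mul_comm]
      gcongr
      exact (Finset.mem_filter.1 (u.max'_mem h)).2

lemma tsum_mul_le_sqrt {ι : Type*} (f g : ι → ℝ≥0∞) :
    ∑' i, f i * g i ≤ (∑' i, f i ^ 2) ^ (1 / 2 : ℝ) * (∑' i, g i ^ 2) ^ (1 / 2 : ℝ) := by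
  rw [ENNReal.tsum_eq_iSup_sum]
  refine iSup_le fun s => (ENNReal.inner_le_Lp_mul_Lq s f g
    Real.HolderConjugate.two_two).trans ?_
  simp only [ENNReal.rpow_two]
  gcongr <;> exact ENNReal.sum_le_tsum _

/-- The form with matrix `2 ^ (i + j)`, restricted to the entries at most `X`, is bounded by
`2 * X` on `ℓ²`. -/
lemma tsum_two_zpow_form_le (X : ℝ≥0∞) (a b : ℤ → ℝ≥0∞) :
    ∑' z : ℤ × ℤ, (if (2 : ℝ≥0∞) ^ (z.1 + z.2) ≤ X then (2 : ℝ≥0∞) ^ (z.1 + z.2) else 0) *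
      (a z.1 * b z.2) ≤
      2 * X * ((∑' i, a i ^ 2) ^ (1 / 2 : ℝ) * (∑' j, b j ^ 2) ^ (1 / 2 : ℝ)) := by
  set m : ℤ → ℝ≥0∞ := fun k => if (2 : ℝ≥0∞) ^ k ≤ X then (2 : ℝ≥0∞) ^ k else 0 with hm
  have hmX : ∑' k, m k ≤ 2 * X := tsum_two_zpow_le X
  have row : ∀ i, ∑' j, m (i + j) ≤ 2 * X := fun i =>
    ((Equiv.addLeft i).tsum_eq m).le.trans hmX
  have col : ∀ j, ∑' i, m (i + j) ≤ 2 * X := fun j =>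
    ((Equiv.addRight j).tsum_eq m).le.trans hmX
  have half : ∀ x : ℝ≥0∞, x ^ (1 / 2 : ℝ) * x ^ (1 / 2 : ℝ) = x := fun x => by
    rw [← ENNReal.rpow_add_of_nonneg _ _ (by norm_num) (by norm_num)]; norm_num
  have half' : ∀ x : ℝ≥0∞, (x ^ (1 / 2 : ℝ)) ^ 2 = x := fun x => by rw [sq, half]
  calc ∑' z : ℤ × ℤ, m (z.1 + z.2) * (a z.1 * b z.2)
      = ∑' z : ℤ × ℤ, (m (z.1 + z.2) ^ (1 / 2 : ℝ) * a z.1) *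
          (m (z.1 + z.2) ^ (1 / 2 : ℝ) * b z.2) := by
        refine tsum_congr fun z => ?_
        conv_lhs => rw [← half (m (z.1 + z.2))]
        ring
    _ ≤ (∑' z : ℤ × ℤ, (m (z.1 + z.2) ^ (1 / 2 : ℝ) * a z.1) ^ 2) ^ (1 / 2 : ℝ) *
          (∑' z : ℤ × ℤ, (m (z.1 + z.2) ^ (1 / 2 : ℝ) * b z.2) ^ 2) ^ (1 / 2 : ℝ) :=
        tsum_mul_le_sqrt _ _
    _ ≤ (2 * X * ∑' i, a i ^ 2) ^ (1 / 2 : ℝ) * (2 * X * ∑' j, b j ^ 2) ^ (1 / 2 : ℝ) := by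
        gcongr
        · rw [ENNReal.tsum_prod', ← ENNReal.tsum_mul_left]
          refine ENNReal.tsum_le_tsum fun i => ?_
          simp only [mul_pow, half']
          rw [ENNReal.tsum_mul_right]
          gcongr
          exact row i
        · rw [ENNReal.tsum_prod', ENNReal.tsum_comm, ← ENNReal.tsum_mul_left]
          refine ENNReal.tsum_le_tsum fun j => ?_
          simp only [mul_pow, half']
          rw [ENNReal.tsum_mul_right]
          gcongr
          exact col j
    _ = _ := by
        rw [ENNReal.mul_rpow_of_nonneg _ _ (by norm_num : (0 : ℝ) ≤ 1 / 2),
          ENNReal.mul_rpow_of_nonneg (2 * X) (∑' j, b j ^ 2) (by norm_num : (0 : ℝ) ≤ 1 / 2)]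
        conv_rhs => rw [← half (2 * X)]
        ring

lemma integral_gram {X Ξ : Type*} [MeasurableSpace X] [MeasurableSpace Ξ] {μ : Measure X}
    {ν : Measure Ξ} [SFinite μ] [SFinite ν] {ρ : Ξ → ℂ} (hρ : Integrable ρ ν) {e : X → Ξ → ℂ}
    (he : Measurable (Function.uncurry e)) (hb : ∀ x ξ, ‖e x ξ‖ ≤ 1) {g g' : X → ℂ}
    (hg : Integrable g μ) (hg' : Integrable g' μ) :
    ∫ ξ, ρ ξ * (conj (∫ x, e x ξ * g x ∂μ) * ∫ y, e y ξ * g' y ∂μ) ∂ν =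
      ∫ z : X × X, conj (g z.1) * g' z.2 * (∫ ξ, ρ ξ * (conj (e z.1 ξ) * e z.2 ξ) ∂ν)
        ∂(μ.prod μ) := by
  have h1 : ∀ ξ, ρ ξ * (conj (∫ x, e x ξ * g x ∂μ) * ∫ y, e y ξ * g' y ∂μ) =
      ∫ z : X × X, ρ ξ * ((conj (e z.1 ξ) * conj (g z.1)) * (e z.2 ξ * g' z.2)) ∂(μ.prod μ) := by
    intro ξ
    rw [integral_const_mul, integral_prod_mul (fun x => conj (e x ξ) * conj (g x))
      (fun y => e y ξ * g' y), ← integral_conj]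
    simp only [map_mul]
  simp_rw [h1]
  rw [integral_integral_swap]
  · refine integral_congr_ae (Filter.Eventually.of_forall fun z => ?_)
    simp only
    rw [← integral_const_mul]
    refine integral_congr_ae (Filter.Eventually.of_forall fun ξ => ?_)
    simp only
    ring
  · have hdom : Integrable (fun q : Ξ × (X × X) => ρ q.1 * (conj (g q.2.1) * g' q.2.2))
        (ν.prod (μ.prod μ)) := by
      refine hρ.mul_prod (Integrable.mul_prod (f := fun x => conj (g x)) ?_ hg')
      exact hg.norm.congr' (Complex.continuous_conj.comp_aestronglyMeasurable
        hg.aestronglyMeasurable) (by simp)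
    have hm : AEStronglyMeasurable
        (fun q : Ξ × (X × X) => conj (e q.2.1 q.1) * e q.2.2 q.1) (ν.prod (μ.prod μ)) := by
      apply Measurable.aestronglyMeasurable
      have a1 : Measurable fun q : Ξ × (X × X) => e q.2.1 q.1 :=
        he.comp (by fun_prop : Measurable fun q : Ξ × (X × X) => (q.2.1, q.1))
      have a2 : Measurable fun q : Ξ × (X × X) => e q.2.2 q.1 :=
        he.comp (by fun_prop : Measurable fun q : Ξ × (X × X) => (q.2.2, q.1))
      exact (Complex.continuous_conj.measurable.comp a1).mul a2
    have := hdom.bdd_mul (c := 1) hm (Filter.Eventually.of_forall fun q => by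
      rw [norm_mul, RCLike.norm_conj]
      exact mul_le_one₀ (hb _ _) (norm_nonneg _) (hb _ _))
    refine this.congr (Filter.Eventually.of_forall fun q => ?_)
    simp only [Function.uncurry]
    ring

lemma dotC_eq_inner (x ξ : Rn n) : dotC x ξ = ((inner ℝ x ξ : ℝ) : ℂ) := by
  simp [dotC, PiLp.inner_apply, mul_comm]

lemma continuous_dotC : Continuous fun z : Rn n × Rn n => dotC z.1 z.2 := by
  simp only [dotC_eq_inner]; fun_prop

lemma norm_cexp_I_mul_ofReal_eq (r : ℝ) : ‖Complex.exp (Complex.I * r)‖ = 1 := by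
  rw [mul_comm, Complex.norm_exp_ofReal_mul_I]

/-- The kernel of the Gaussian-regularised propagator. -/
def gaussKernel (ε τ : ℝ) (z : Rn n) : ℂ :=
  ∫ ξ : Rn n, Complex.exp (-((ε : ℂ) - Complex.I * τ) * (‖ξ‖ : ℂ) ^ 2 + -Complex.I * (inner ℝ z ξ : ℝ))

lemma gaussKernel_eq {ε : ℝ} (hε : 0 < ε) (τ : ℝ) (z : Rn n) :
    gaussKernel ε τ z = (π / ((ε : ℂ) - Complex.I * τ)) ^ (((n : ℝ) / 2 : ℝ) : ℂ) *
      Complex.exp (-(‖z‖ : ℂ) ^ 2 / (4 * ((ε : ℂ) - Complex.I * τ))) := by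
  rw [gaussKernel, GaussianFourier.integral_cexp_neg_mul_sq_norm_add (by simp [hε])]
  simp

lemma norm_gaussKernel_le {ε : ℝ} (hε : 0 < ε) (τ : ℝ) (z : Rn n) :
    ‖gaussKernel ε τ z‖ ≤ (π / ‖(ε : ℂ) - Complex.I * τ‖) ^ ((n : ℝ) / 2) := by
  rw [gaussKernel_eq hε, norm_mul, Complex.norm_cpow_real, norm_div, Complex.norm_real,
    Real.norm_of_nonneg Real.pi_pos.le]
  refine mul_le_of_le_one_right (by positivity) ?_
  rw [Complex.norm_exp, Real.exp_le_one_iff, neg_div, Complex.neg_re, neg_nonpos]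
  have : (‖z‖ : ℂ) ^ 2 / (4 * ((ε : ℂ) - Complex.I * τ)) =
      ((‖z‖ ^ 2 / 4 : ℝ) : ℂ) * ((ε : ℂ) - Complex.I * τ)⁻¹ := by
    push_cast; rw [div_mul_eq_div_div]; ring
  rw [this, Complex.re_ofReal_mul, Complex.inv_re]
  simp only [Complex.sub_re, Complex.ofReal_re, Complex.mul_re, Complex.I_re, Complex.I_im,
    Complex.ofReal_im]
  have : 0 ≤ ε := hε.le
  have := Complex.normSq_nonneg ((ε : ℂ) - Complex.I * τ)
  simp only [zero_mul, mul_zero, sub_zero]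
  positivity

lemma enorm_gaussKernel_le {ε : ℝ} (hε : 0 < ε) (τ : ℝ) (z : Rn n) :
    ‖gaussKernel ε τ z‖ₑ ≤ ENNReal.ofReal (π ^ ((n : ℝ) / 2)) * ‖τ‖ₑ ^ (-((n : ℝ) / 2)) := by
  by_cases hτ : τ = 0
  · rcases Nat.eq_zero_or_pos n with hn | hn
    · have := norm_gaussKernel_le hε τ z
      subst hn
      have h1 : ‖gaussKernel ε τ z‖ ≤ 1 := by simpa using this
      have h2 := ENNReal.ofReal_le_ofReal h1
      rw [ofReal_norm] at h2
      simpa using h2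
    · rw [hτ, enorm_zero, ENNReal.zero_rpow_of_neg (by simpa using hn), ENNReal.mul_top]
      · exact le_top
      · simpa using by positivity
  · have hτ' : 0 < |τ| := abs_pos.2 hτ
    rw [← ofReal_norm, ← ofReal_norm τ, ENNReal.ofReal_rpow_of_pos (by simpa using hτ),
      ← ENNReal.ofReal_mul (by positivity)]
    refine ENNReal.ofReal_le_ofReal ((norm_gaussKernel_le hε τ z).trans ?_)
    rw [Real.rpow_neg (norm_nonneg _), ← div_eq_mul_inv, ← Real.div_rpow Real.pi_pos.le
      (norm_nonneg _)]
    have : ‖τ‖ ≤ ‖(ε : ℂ) - Complex.I * τ‖ := by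
      have := Complex.abs_im_le_norm ((ε : ℂ) - Complex.I * τ)
      simpa using this
    have h2 : 0 < ‖τ‖ := by simpa using hτ
    gcongr

lemma lintegral_gaussKernel_zero {ε : ℝ} (hε : 0 < ε) :
    ∫⁻ z : Rn n, ‖gaussKernel ε 0 z‖ₑ = ENNReal.ofReal ((2 * π) ^ n) := by
  have h : ∀ z : Rn n, ‖gaussKernel ε 0 z‖ₑ =
      ENNReal.ofReal ((π / ε) ^ ((n : ℝ) / 2)) *
        ENNReal.ofReal (Real.exp (-(1 / (4 * ε)) * ‖z‖ ^ 2)) := by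
    intro z
    rw [gaussKernel_eq hε, ← ofReal_norm, norm_mul, Complex.norm_cpow_real, Complex.norm_exp,
      ENNReal.ofReal_mul (by positivity)]
    congr 2
    · simp [abs_of_pos hε, abs_of_pos Real.pi_pos]
    · congr 1
      have : -(‖z‖ : ℂ) ^ 2 / (4 * ((ε : ℂ) - Complex.I * (0 : ℝ))) =
          ((-(1 / (4 * ε)) * ‖z‖ ^ 2 : ℝ) : ℂ) := by
        push_cast
        simp
        ring
      rw [this, Complex.ofReal_re]
  have h4 : 0 < 1 / (4 * ε) := by positivity
  have hI := GaussianFourier.integral_rexp_neg_mul_sq_norm (V := Rn n) h4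
  have hIntegrable : Integrable fun z : Rn n => Real.exp (-(1 / (4 * ε)) * ‖z‖ ^ 2) := by
    apply Integrable.of_integral_ne_zero
    rw [hI]; positivity
  simp_rw [h]
  rw [lintegral_const_mul _ (by fun_prop), ← ofReal_integral_eq_lintegral_ofReal hIntegrable
    (Filter.Eventually.of_forall fun z => (Real.exp_pos _).le), hI, finrank_euclideanSpace_fin,
    ← ENNReal.ofReal_mul (by positivity), ← Real.mul_rpow (by positivity) (by positivity)]
  congr 1
  have : π / ε * (π / (1 / (4 * ε))) = (2 * π) ^ (2 : ℝ) := by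
    rw [Real.rpow_two]; field_simp; ring
  rw [this, ← Real.rpow_mul (by positivity)]
  simp [mul_div_cancel₀]

lemma gaussKernel_sub (ε t t' : ℝ) (x x' : Rn n) :
    gaussKernel ε (t' - t) (x' - x) = ∫ ξ : Rn n, (Real.exp (-ε * ‖ξ‖ ^ 2) : ℂ) *
      (conj (Complex.exp (Complex.I * ((t : ℂ) * (‖ξ‖ : ℂ) ^ 2 - dotC x ξ))) *
        Complex.exp (Complex.I * ((t' : ℂ) * (‖ξ‖ : ℂ) ^ 2 - dotC x' ξ))) := by
  refine integral_congr_ae (Filter.Eventually.of_forall fun ξ => ?_)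
  simp only [dotC_eq_inner, ← Complex.exp_conj, Complex.ofReal_exp, ← Complex.exp_add]
  congr 1
  simp only [inner_sub_left, map_mul, map_sub, map_pow, Complex.conj_I, Complex.conj_ofReal]
  push_cast
  ring

lemma measurable_gaussKernel (ε : ℝ) :
    Measurable fun z : ℝ × Rn n => gaussKernel ε z.1 z.2 := by
  have : StronglyMeasurable fun z : (ℝ × Rn n) × Rn n =>
    Complex.exp (-((ε : ℂ) - Complex.I * z.1.1) * (‖z.2‖ : ℂ) ^ 2 +
      -Complex.I * (inner ℝ z.1.2 z.2 : ℝ)) := by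
    apply Continuous.stronglyMeasurable
    fun_prop
  exact this.integral_prod_right'.measurable

lemma integrable_gauss {ε : ℝ} (hε : 0 < ε) :
    Integrable fun ξ : Rn n => Real.exp (-ε * ‖ξ‖ ^ 2) := by
  apply Integrable.of_integral_ne_zero
  rw [GaussianFourier.integral_rexp_neg_mul_sq_norm (V := Rn n) hε]; positivity


attribute [irreducible] gaussKernel

lemma enorm_conj (F : ℂ) : ‖conj F‖ₑ = ‖F‖ₑ := by
  rw [← ofReal_norm, RCLike.norm_conj, ofReal_norm]

lemma ENNReal.mul_le_sq_add_sq (a b : ℝ≥0∞) : a * b ≤ a ^ 2 + b ^ 2 := by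
  rcases le_total a b with h | h
  · calc a * b ≤ b * b := by gcongr
      _ ≤ _ := by rw [← sq]; exact le_add_self
  · calc a * b ≤ a * a := by gcongr
      _ ≤ _ := by rw [← sq]; exact le_self_add

lemma measurable_fourier_exp :
    Measurable (Function.uncurry fun x ξ : Rn n => Complex.exp (-(Complex.I * dotC x ξ))) := by
  have := continuous_dotC (n := n)
  exact (by fun_prop : Continuous fun z : Rn n × Rn n =>
    Complex.exp (-(Complex.I * dotC z.1 z.2))).measurable

lemma norm_fourier_exp (x ξ : Rn n) : ‖Complex.exp (-(Complex.I * dotC x ξ))‖ = 1 := by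
  have := norm_cexp_I_mul_ofReal_eq (-(inner ℝ x ξ : ℝ))
  rwa [dotC_eq_inner, ← mul_neg, ← Complex.ofReal_neg]

lemma stronglyMeasurable_FT {F : Rn n → ℂ} (hF : Integrable F) : StronglyMeasurable (FT F) := by
  have h : FT F = FT (hF.1.mk F) := by
    ext ξ
    refine integral_congr_ae ?_
    filter_upwards [hF.1.ae_eq_mk] with x hx
    rw [hx]
  rw [h]
  have h2 : StronglyMeasurable fun z : Rn n × Rn n =>
      Complex.exp (-(Complex.I * dotC z.2 z.1)) * hF.1.mk F z.2 :=
    ((measurable_fourier_exp.comp measurable_swap).mul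
      (hF.1.stronglyMeasurable_mk.measurable.comp measurable_snd)).stronglyMeasurable
  exact h2.integral_prod_right'

lemma norm_FT_le (F : Rn n → ℂ) (ξ : Rn n) : ‖FT F ξ‖ ≤ ∫ x, ‖F x‖ := by
  refine (norm_integral_le_integral_norm _).trans_eq ?_
  simp [norm_fourier_exp]

lemma integrable_cexp_gauss {ε : ℝ} (hε : 0 < ε) (τ : ℝ) :
    Integrable fun ξ : Rn n => Complex.exp (-((ε : ℂ) - Complex.I * τ) * (‖ξ‖ : ℂ) ^ 2) := by
  refine (integrable_gauss hε).mono' ?_ (Filter.Eventually.of_forall fun ξ => ?_)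
  · exact (by fun_prop : Continuous fun ξ : Rn n =>
      Complex.exp (-((ε : ℂ) - Complex.I * τ) * (‖ξ‖ : ℂ) ^ 2)).aestronglyMeasurable
  · rw [Complex.norm_exp, ← Complex.ofReal_pow, Complex.re_mul_ofReal]
    simp

lemma integral_gram_FT {ε : ℝ} (hε : 0 < ε) (τ : ℝ) {F G : Rn n → ℂ} (hF : Integrable F)
    (hG : Integrable G) :
    ∫ ξ : Rn n, Complex.exp (-((ε : ℂ) - Complex.I * τ) * (‖ξ‖ : ℂ) ^ 2) *
        (conj (FT F ξ) * FT G ξ) =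
      ∫ z : Rn n × Rn n, conj (F z.1) * G z.2 * gaussKernel ε τ (z.2 - z.1) := by
  have := integral_gram (integrable_cexp_gauss hε τ) (measurable_fourier_exp (n := n))
    (fun x ξ => (norm_fourier_exp x ξ).le) hF hG
  refine this.trans (integral_congr_ae (Filter.Eventually.of_forall fun z => ?_))
  simp only
  rw [gaussKernel]
  congr 1
  refine integral_congr_ae (Filter.Eventually.of_forall fun ξ => ?_)
  simp only [dotC_eq_inner, ← Complex.exp_conj, ← Complex.exp_add]
  congr 1
  simp only [inner_sub_left, map_mul, map_neg, Complex.conj_I, Complex.conj_ofReal]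
  push_cast
  ring

/-- A constant for the Plancherel inequality. -/
def plConst (n : ℕ) : ℝ≥0∞ := 2 * ENNReal.ofReal ((2 * π) ^ n)

lemma plConst_ne_top : plConst n ≠ ∞ := by simp only [plConst]; finiteness

lemma lintegral_gauss_FT_le {ε : ℝ} (hε : 0 < ε) {F : Rn n → ℂ} (hF : Integrable F) :
    ∫⁻ ξ : Rn n, ENNReal.ofReal (Real.exp (-ε * ‖ξ‖ ^ 2)) * ‖FT F ξ‖ₑ ^ 2 ≤
      plConst n * ∫⁻ x, ‖F x‖ₑ ^ 2 := by
  have hm := (stronglyMeasurable_FT hF).measurable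
  have hIntegrable : Integrable fun ξ : Rn n => Real.exp (-ε * ‖ξ‖ ^ 2) * ‖FT F ξ‖ ^ 2 := by
    refine (integrable_gauss hε).mul_bdd (c := (∫ x, ‖F x‖) ^ 2)
      (by fun_prop) (Filter.Eventually.of_forall fun ξ => ?_)
    rw [norm_pow, norm_norm]
    gcongr
    exact norm_FT_le F ξ
  have h1 : ∫⁻ ξ : Rn n, ENNReal.ofReal (Real.exp (-ε * ‖ξ‖ ^ 2)) * ‖FT F ξ‖ₑ ^ 2 =
      ‖∫ z : Rn n × Rn n, conj (F z.1) * F z.2 * gaussKernel ε 0 (z.2 - z.1)‖ₑ := by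
    have h2 : ∫ ξ : Rn n, Complex.exp (-((ε : ℂ) - Complex.I * (0 : ℝ)) * (‖ξ‖ : ℂ) ^ 2) *
        (conj (FT F ξ) * FT F ξ) =
        ((∫ ξ : Rn n, Real.exp (-ε * ‖ξ‖ ^ 2) * ‖FT F ξ‖ ^ 2 : ℝ) : ℂ) := by
      rw [← integral_complex_ofReal]
      refine integral_congr_ae (Filter.Eventually.of_forall fun ξ => ?_)
      simp only [RCLike.conj_mul]
      push_cast
      simp
    rw [← integral_gram_FT hε 0 hF hF, h2, ← ofReal_norm, Complex.norm_real,
      Real.norm_of_nonneg (integral_nonneg fun ξ => by positivity),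
      ofReal_integral_eq_lintegral_ofReal hIntegrable
        (Filter.Eventually.of_forall fun ξ => by positivity)]
    refine lintegral_congr fun ξ => ?_
    rw [ENNReal.ofReal_mul (Real.exp_pos _).le, ENNReal.ofReal_pow (norm_nonneg _), ofReal_norm]
  rw [h1]
  have hg : Measurable fun z : Rn n => ‖gaussKernel ε 0 z‖ₑ :=
    ((measurable_gaussKernel ε).comp (measurable_prodMk_left (x := (0 : ℝ)))).enorm
  have hg2 : Measurable fun z : Rn n × Rn n => ‖gaussKernel ε 0 (z.2 - z.1)‖ₑ :=
    hg.comp (measurable_snd.sub measurable_fst)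
  have hFm : AEMeasurable (fun x => ‖F x‖ₑ ^ 2) := hF.1.enorm.pow_const 2
  have hF1 : AEMeasurable (fun z : Rn n × Rn n => ‖F z.1‖ₑ ^ 2) (volume.prod volume) :=
    hFm.comp_quasiMeasurePreserving Measure.quasiMeasurePreserving_fst
  have hF2 : AEMeasurable (fun z : Rn n × Rn n => ‖F z.2‖ₑ ^ 2) (volume.prod volume) :=
    hFm.comp_quasiMeasurePreserving Measure.quasiMeasurePreserving_snd
  have hm1 : AEMeasurable (fun z : Rn n × Rn n =>
      ‖F z.1‖ₑ ^ 2 * ‖gaussKernel ε 0 (z.2 - z.1)‖ₑ) (volume.prod volume) :=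
    hF1.mul hg2.aemeasurable
  have hm2 : AEMeasurable (fun z : Rn n × Rn n =>
      ‖F z.2‖ₑ ^ 2 * ‖gaussKernel ε 0 (z.2 - z.1)‖ₑ) (volume.prod volume) :=
    hF2.mul hg2.aemeasurable
  have hA : ∫⁻ z : Rn n × Rn n, ‖F z.1‖ₑ ^ 2 * ‖gaussKernel ε 0 (z.2 - z.1)‖ₑ =
      ENNReal.ofReal ((2 * π) ^ n) * ∫⁻ x, ‖F x‖ₑ ^ 2 := by
    rw [Measure.volume_eq_prod, lintegral_prod _ hm1]
    have : ∀ x : Rn n, ∫⁻ y, ‖F x‖ₑ ^ 2 * ‖gaussKernel ε 0 (y - x)‖ₑ =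
        ‖F x‖ₑ ^ 2 * ENNReal.ofReal ((2 * π) ^ n) := fun x => by
      have hx : Measurable fun y => ‖gaussKernel ε 0 (y - x)‖ₑ :=
        hg.comp (measurable_id.sub_const x)
      rw [lintegral_const_mul _ hx,
        lintegral_sub_right_eq_self (fun y => ‖gaussKernel ε 0 y‖ₑ) x,
        lintegral_gaussKernel_zero hε]
    simp only [this]
    rw [lintegral_mul_const'' _ hFm, mul_comm]
  have hB : ∫⁻ z : Rn n × Rn n, ‖F z.2‖ₑ ^ 2 * ‖gaussKernel ε 0 (z.2 - z.1)‖ₑ =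
      ENNReal.ofReal ((2 * π) ^ n) * ∫⁻ x, ‖F x‖ₑ ^ 2 := by
    rw [Measure.volume_eq_prod, lintegral_prod_symm _ hm2]
    have : ∀ y : Rn n, ∫⁻ x, ‖F y‖ₑ ^ 2 * ‖gaussKernel ε 0 (y - x)‖ₑ =
        ‖F y‖ₑ ^ 2 * ENNReal.ofReal ((2 * π) ^ n) := fun y => by
      have hy : Measurable fun x => ‖gaussKernel ε 0 (y - x)‖ₑ :=
        hg.comp (measurable_id.const_sub y)
      rw [lintegral_const_mul _ hy,
        lintegral_sub_left_eq_self (fun y => ‖gaussKernel ε 0 y‖ₑ) y,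
        lintegral_gaussKernel_zero hε]
    simp only [this]
    rw [lintegral_mul_const'' _ hFm, mul_comm]
  calc ‖∫ z : Rn n × Rn n, conj (F z.1) * F z.2 * gaussKernel ε 0 (z.2 - z.1)‖ₑ
      ≤ ∫⁻ z : Rn n × Rn n, ‖conj (F z.1) * F z.2 * gaussKernel ε 0 (z.2 - z.1)‖ₑ :=
        enorm_integral_le_lintegral_enorm _
    _ ≤ ∫⁻ z : Rn n × Rn n, (‖F z.1‖ₑ ^ 2 * ‖gaussKernel ε 0 (z.2 - z.1)‖ₑ +
          ‖F z.2‖ₑ ^ 2 * ‖gaussKernel ε 0 (z.2 - z.1)‖ₑ) := by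
        refine lintegral_mono fun z => ?_
        rw [enorm_mul, enorm_mul, enorm_conj, ← add_mul]
        gcongr
        exact ENNReal.mul_le_sq_add_sq _ _
    _ = plConst n * ∫⁻ x, ‖F x‖ₑ ^ 2 := by
        rw [Measure.volume_eq_prod] at hA hB ⊢
        rw [lintegral_add_left' hm1, hA, hB, plConst]
        ring

lemma lintegral_le_of_gauss_le {u : Rn n → ℝ≥0∞} (hu : Measurable u) {B : ℝ≥0∞}
    (h : ∀ ε : ℝ, 0 < ε → ∫⁻ ξ, ENNReal.ofReal (Real.exp (-ε * ‖ξ‖ ^ 2)) * u ξ ≤ B) :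
    ∫⁻ ξ, u ξ ≤ B := by
  have hlim : ∀ ξ : Rn n, Filter.Tendsto (fun m : ℕ =>
      ENNReal.ofReal (Real.exp (-(1 / ((m : ℝ) + 1)) * ‖ξ‖ ^ 2)) * u ξ) Filter.atTop
      (nhds (u ξ)) := by
    intro ξ
    have h1 : Filter.Tendsto (fun m : ℕ => Real.exp (-(1 / ((m : ℝ) + 1)) * ‖ξ‖ ^ 2))
        Filter.atTop (nhds (Real.exp (-0 * ‖ξ‖ ^ 2))) :=
      (Real.continuous_exp.tendsto _).comp
        ((tendsto_one_div_add_atTop_nhds_zero_nat.neg).mul_const _)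
    have h2 := ENNReal.Tendsto.mul_const (b := u ξ) (ENNReal.tendsto_ofReal h1)
      (Or.inl (by simp))
    simpa using h2
  calc ∫⁻ ξ, u ξ = ∫⁻ ξ, Filter.liminf (fun m : ℕ =>
        ENNReal.ofReal (Real.exp (-(1 / ((m : ℝ) + 1)) * ‖ξ‖ ^ 2)) * u ξ) Filter.atTop :=
        lintegral_congr fun ξ => (hlim ξ).liminf_eq.symm
    _ ≤ Filter.liminf (fun m : ℕ => ∫⁻ ξ,
        ENNReal.ofReal (Real.exp (-(1 / ((m : ℝ) + 1)) * ‖ξ‖ ^ 2)) * u ξ) Filter.atTop :=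
        lintegral_liminf_le fun m => by fun_prop
    _ ≤ B := Filter.liminf_le_of_le (by isBoundedDefault) fun b hb => by
        obtain ⟨m, hm⟩ := hb.exists
        exact hm.trans (h _ (by positivity))

/-- A Plancherel-type inequality. -/
lemma lintegral_FT_sq_le {F : Rn n → ℂ} (hF : Integrable F) :
    ∫⁻ ξ, ‖FT F ξ‖ₑ ^ 2 ≤ plConst n * ∫⁻ x, ‖F x‖ₑ ^ 2 :=
  lintegral_le_of_gauss_le ((stronglyMeasurable_FT hF).measurable.enorm.pow_const 2)
    fun _ hε => lintegral_gauss_FT_le hε hF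

lemma lintegral_mul_le_sqrt {X : Type*} [MeasurableSpace X] (μ : Measure X) {f g : X → ℝ≥0∞}
    (hf : AEMeasurable f μ) (hg : AEMeasurable g μ) :
    ∫⁻ x, f x * g x ∂μ ≤
      (∫⁻ x, f x ^ 2 ∂μ) ^ (1 / 2 : ℝ) * (∫⁻ x, g x ^ 2 ∂μ) ^ (1 / 2 : ℝ) := by
  have := ENNReal.lintegral_mul_le_Lp_mul_Lq μ Real.HolderConjugate.two_two hf hg
  simpa only [ENNReal.rpow_two, Pi.mul_apply] using this

lemma enorm_integral_gaussKernel_le {ε : ℝ} (hε : 0 < ε) (τ : ℝ) {F G : Rn n → ℂ}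
    (hF : Integrable F) (hG : Integrable G) :
    ‖∫ z : Rn n × Rn n, conj (F z.1) * G z.2 * gaussKernel ε τ (z.2 - z.1)‖ₑ ≤
      plConst n * ((∫⁻ x, ‖F x‖ₑ ^ 2) ^ (1 / 2 : ℝ) * (∫⁻ x, ‖G x‖ₑ ^ 2) ^ (1 / 2 : ℝ)) := by
  rw [← integral_gram_FT hε τ hF hG]
  have half : ∀ x : ℝ≥0∞, x ^ (1 / 2 : ℝ) * x ^ (1 / 2 : ℝ) = x := fun x => by
    rw [← ENNReal.rpow_add_of_nonneg _ _ (by norm_num) (by norm_num)]; norm_num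
  calc _ ≤ ∫⁻ ξ, ‖FT F ξ‖ₑ * ‖FT G ξ‖ₑ := by
        refine (enorm_integral_le_lintegral_enorm _).trans (lintegral_mono fun ξ => ?_)
        rw [enorm_mul, enorm_mul, enorm_conj]
        refine mul_le_of_le_one_left (by positivity) ?_
        rw [← ofReal_norm, ENNReal.ofReal_le_one, Complex.norm_exp, Real.exp_le_one_iff,
          ← Complex.ofReal_pow, Complex.re_mul_ofReal]
        simp only [neg_sub, Complex.sub_re, Complex.mul_re, Complex.I_re, Complex.ofReal_re,
          zero_mul, Complex.I_im, Complex.ofReal_im, mul_zero, sub_self, zero_sub]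
        have := sq_nonneg ‖ξ‖
        nlinarith
    _ ≤ (plConst n * ∫⁻ x, ‖F x‖ₑ ^ 2) ^ (1 / 2 : ℝ) *
          (plConst n * ∫⁻ x, ‖G x‖ₑ ^ 2) ^ (1 / 2 : ℝ) := by
        refine (lintegral_mul_le_sqrt _ (stronglyMeasurable_FT hF).measurable.enorm.aemeasurable
          (stronglyMeasurable_FT hG).measurable.enorm.aemeasurable).trans ?_
        gcongr
        · exact lintegral_FT_sq_le hF
        · exact lintegral_FT_sq_le hG
    _ = _ := by
        rw [ENNReal.mul_rpow_of_nonneg _ _ (by norm_num), ENNReal.mul_rpow_of_nonneg _ _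
          (by norm_num)]
        conv_rhs => rw [← half (plConst n)]
        ring

lemma integrable_kernel_form {ε : ℝ} (hε : 0 < ε) (τ : ℝ) {F G : Rn n → ℂ}
    (hF : Integrable F) (hG : Integrable G) :
    Integrable fun z : Rn n × Rn n => conj (F z.1) * G z.2 * gaussKernel ε τ (z.2 - z.1) := by
  have h1 : Integrable (fun x => conj (F x)) :=
    hF.norm.congr' (Complex.continuous_conj.comp_aestronglyMeasurable
        hF.aestronglyMeasurable) (by simp)
  have h2 : Integrable (fun z : Rn n × Rn n => conj (F z.1) * G z.2) (volume.prod volume) :=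
    Integrable.mul_prod (f := fun x => conj (F x)) h1 hG
  have h3 : Measurable fun z : Rn n × Rn n => gaussKernel ε τ (z.2 - z.1) := by
    have : Measurable fun z : Rn n × Rn n => ((τ, z.2 - z.1) : ℝ × Rn n) := by fun_prop
    exact (measurable_gaussKernel ε).comp this
  rw [Measure.volume_eq_prod]
  exact h2.mul_bdd (c := (π / ‖(ε : ℂ) - Complex.I * τ‖) ^ ((n : ℝ) / 2))
    h3.aestronglyMeasurable (Filter.Eventually.of_forall fun z => norm_gaussKernel_le hε τ _)

/-- The kernel form restricted to a union of products of level sets. -/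
lemma enorm_setIntegral_levels_le {ε : ℝ} (hε : 0 < ε) (τ : ℝ) {F G : Rn n → ℂ}
    (hF : Integrable F) (hG : Integrable G) {l l' : Rn n → ℤ} (hl : Measurable l)
    (hl' : Measurable l') {φ ψ : Rn n → ℝ≥0∞} (hφ : Measurable φ) (hψ : Measurable ψ)
    {v v' : ℝ≥0∞} (X : ℝ≥0∞) (hFφ : ∀ x, ‖F x‖ₑ ≤ v * 2 ^ (l x + 1) * φ x)
    (hGψ : ∀ x, ‖G x‖ₑ ≤ v' * 2 ^ (l' x + 1) * ψ x) :
    ‖∫ z in {z : Rn n × Rn n | (2 : ℝ≥0∞) ^ (l z.1 + l' z.2) ≤ X},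
        conj (F z.1) * G z.2 * gaussKernel ε τ (z.2 - z.1)‖ₑ ≤
      8 * plConst n * (v * v' * X *
        ((∫⁻ x, φ x ^ 2) ^ (1 / 2 : ℝ) * (∫⁻ x, ψ x ^ 2) ^ (1 / 2 : ℝ))) := by
  set T : ℤ × ℤ → Set (Rn n × Rn n) := fun p =>
    {z | l z.1 = p.1 ∧ l' z.2 = p.2 ∧ (2 : ℝ≥0∞) ^ (p.1 + p.2) ≤ X} with hT
  have hU : {z : Rn n × Rn n | (2 : ℝ≥0∞) ^ (l z.1 + l' z.2) ≤ X} = ⋃ p, T p := by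
    ext z
    simp only [hT, mem_iUnion, mem_ofPred_eq]
    refine ⟨fun h => ⟨(l z.1, l' z.2), rfl, rfl, h⟩, ?_⟩
    rintro ⟨p, h1, h2, h3⟩
    rwa [h1, h2]
  have hml : ∀ i, MeasurableSet {x | l x = i} := fun i => hl (measurableSet_singleton i)
  have hml' : ∀ i, MeasurableSet {x | l' x = i} := fun i => hl' (measurableSet_singleton i)
  have hTeq : ∀ p, (2 : ℝ≥0∞) ^ (p.1 + p.2) ≤ X → T p = {x | l x = p.1} ×ˢ {y | l' y = p.2} := by
    intro p hp
    ext z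
    simp [hT, hp]
  have hTempty : ∀ p, ¬ (2 : ℝ≥0∞) ^ (p.1 + p.2) ≤ X → T p = ∅ := by
    intro p hp
    ext z
    simp [hT, hp]
  have hTm : ∀ p, MeasurableSet (T p) := by
    intro p
    by_cases hp : (2 : ℝ≥0∞) ^ (p.1 + p.2) ≤ X
    · rw [hTeq p hp]; exact (hml _).prod (hml' _)
    · rw [hTempty p hp]; exact .empty
  have hTd : Pairwise (Function.onFun Disjoint T) := by
    intro p q hpq
    refine Set.disjoint_left.2 fun z hz hz' => hpq ?_
    exact Prod.ext (hz.1.symm.trans hz'.1) (hz.2.1.symm.trans hz'.2.1)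
  have hsum := hasSum_integral_iUnion hTm hTd
    (integrable_kernel_form hε τ hF hG).integrableOn
  rw [hU, ← hsum.tsum_eq]
  set a : ℤ → ℝ≥0∞ := fun i => (∫⁻ x in {x | l x = i}, φ x ^ 2) ^ (1 / 2 : ℝ) with ha
  set b : ℤ → ℝ≥0∞ := fun i => (∫⁻ x in {x | l' x = i}, ψ x ^ 2) ^ (1 / 2 : ℝ) with hb
  have sq : ∀ x : ℝ≥0∞, (x ^ (1 / 2 : ℝ)) ^ 2 = x := fun x => by
    rw [← ENNReal.rpow_natCast, ← ENNReal.rpow_mul]; norm_num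
  have sq' : ∀ x : ℝ≥0∞, (x ^ 2) ^ (1 / 2 : ℝ) = x := fun x => by
    rw [← ENNReal.rpow_natCast, ← ENNReal.rpow_mul]; norm_num
  have univ : ∀ m : Rn n → ℤ, (⋃ i, {x | m x = i}) = Set.univ := fun m => by
    ext x; simp
  have hdis : ∀ m : Rn n → ℤ, Pairwise (Function.onFun Disjoint fun i => {x | m x = i}) :=
    fun m i j hij => Set.disjoint_left.2 fun x hx hx' => hij (hx.symm.trans hx')
  have ha2 : ∑' i, a i ^ 2 = ∫⁻ x, φ x ^ 2 := by
    simp only [ha, sq]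
    rw [← lintegral_iUnion hml (hdis l), univ, Measure.restrict_univ]
  have hb2 : ∑' i, b i ^ 2 = ∫⁻ x, ψ x ^ 2 := by
    simp only [hb, sq]
    rw [← lintegral_iUnion hml' (hdis l'), univ, Measure.restrict_univ]
  have level : ∀ {F : Rn n → ℂ} {l : Rn n → ℤ} {φ : Rn n → ℝ≥0∞} {v : ℝ≥0∞} (_ : Measurable φ)
      (_ : ∀ x, ‖F x‖ₑ ≤ v * 2 ^ (l x + 1) * φ x) (i : ℤ) (_ : MeasurableSet {x | l x = i}),
      (∫⁻ x, ‖{x | l x = i}.indicator F x‖ₑ ^ 2) ^ (1 / 2 : ℝ) ≤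
        v * 2 ^ (i + 1) * (∫⁻ x in {x | l x = i}, φ x ^ 2) ^ (1 / 2 : ℝ) := by
    intro F l φ v hφ h i hm
    conv_rhs => rw [← sq' (v * 2 ^ (i + 1)), ← ENNReal.mul_rpow_of_nonneg _ _ (by norm_num),
      ← lintegral_const_mul _ (hφ.pow_const 2), ← lintegral_indicator hm]
    gcongr with x
    by_cases hx : l x = i
    · have hx' : x ∈ {x | l x = i} := hx
      rw [indicator_of_mem hx', indicator_of_mem hx', ← mul_pow]
      gcongr
      simpa [hx] using h x
    · have hx' : x ∉ {x | l x = i} := hx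
      rw [indicator_of_notMem hx']
      simp
  have bound : ∀ p : ℤ × ℤ, ‖∫ z in T p, conj (F z.1) * G z.2 * gaussKernel ε τ (z.2 - z.1)‖ₑ ≤
      4 * plConst n * (v * v') * ((if (2 : ℝ≥0∞) ^ (p.1 + p.2) ≤ X then
        (2 : ℝ≥0∞) ^ (p.1 + p.2) else 0) * (a p.1 * b p.2)) := by
    intro p
    by_cases hp : (2 : ℝ≥0∞) ^ (p.1 + p.2) ≤ X
    · rw [if_pos hp]
      have e : ∫ z in T p, conj (F z.1) * G z.2 * gaussKernel ε τ (z.2 - z.1) =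
          ∫ z : Rn n × Rn n, conj ({x | l x = p.1}.indicator F z.1) *
            {x | l' x = p.2}.indicator G z.2 * gaussKernel ε τ (z.2 - z.1) := by
        rw [← integral_indicator (hTm p)]
        refine integral_congr_ae (Filter.Eventually.of_forall fun z => ?_)
        simp only [hTeq p hp, indicator_apply, mem_prod, mem_ofPred_eq]
        by_cases h1 : l z.1 = p.1 <;> by_cases h2 : l' z.2 = p.2 <;> simp [h1, h2]
      rw [e]
      refine (enorm_integral_gaussKernel_le hε τ (hF.indicator (hml _))
        (hG.indicator (hml' _))).trans ?_
      calc _ ≤ plConst n * ((v * 2 ^ (p.1 + 1) * a p.1) * (v' * 2 ^ (p.2 + 1) * b p.2)) := by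
            gcongr
            · exact level hφ hFφ p.1 (hml _)
            · exact level hψ hGψ p.2 (hml' _)
        _ = _ := by
            rw [ENNReal.zpow_add (by norm_num) (by norm_num),
              ENNReal.zpow_add (by norm_num) (by norm_num),
              ENNReal.zpow_add (by norm_num) (by norm_num), zpow_one]
            ring
    · simp [hTempty p hp]
  calc _ ≤ ∑' p, ‖∫ z in T p, conj (F z.1) * G z.2 * gaussKernel ε τ (z.2 - z.1)‖ₑ :=
        enorm_tsum_le_tsum_enorm
    _ ≤ _ := ENNReal.tsum_le_tsum bound
    _ ≤ 4 * plConst n * (v * v') * (2 * X * ((∑' i, a i ^ 2) ^ (1 / 2 : ℝ) *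
          (∑' j, b j ^ 2) ^ (1 / 2 : ℝ))) := by
        rw [ENNReal.tsum_mul_left]
        gcongr
        exact tsum_two_zpow_form_le X a b
    _ = _ := by rw [ha2, hb2]; ring

/-- The rearrangement `((a, b), (c, d)) ↦ ((a, c), (b, d))`. -/
def prodComm4 (α β γ δ : Type*) [MeasurableSpace α] [MeasurableSpace β] [MeasurableSpace γ]
    [MeasurableSpace δ] : (α × β) × (γ × δ) ≃ᵐ (α × γ) × (β × δ) where
  toEquiv := Equiv.prodProdProdComm α β γ δ
  measurable_toFun := by
    change Measurable fun p : (α × β) × (γ × δ) => ((p.1.1, p.2.1), (p.1.2, p.2.2))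
    fun_prop
  measurable_invFun := by
    change Measurable fun p : (α × γ) × (β × δ) => ((p.1.1, p.2.1), (p.1.2, p.2.2))
    fun_prop

lemma measurePreserving_prodAssoc' {α β γ : Type*} [MeasurableSpace α] [MeasurableSpace β]
    [MeasurableSpace γ] (μ : Measure α) (ν : Measure β) (κ : Measure γ) [SFinite μ] [SFinite ν]
    [SFinite κ] : MeasurePreserving (MeasurableEquiv.prodAssoc (α := α) (β := β) (γ := γ))
      ((μ.prod ν).prod κ) (μ.prod (ν.prod κ)) :=
  ⟨MeasurableEquiv.measurable _, Measure.prodAssoc_prod⟩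

lemma measurePreserving_prodComm4 {α β γ δ : Type*} [MeasurableSpace α] [MeasurableSpace β]
    [MeasurableSpace γ] [MeasurableSpace δ] (μ : Measure α) (ν : Measure β) (κ : Measure γ)
    (τ : Measure δ) [SFinite μ] [SFinite ν] [SFinite κ] [SFinite τ] :
    MeasurePreserving (prodComm4 α β γ δ) ((μ.prod ν).prod (κ.prod τ))
      ((μ.prod κ).prod (ν.prod τ)) := by
  have h1 := measurePreserving_prodAssoc' μ ν (κ.prod τ)
  have h2 := (MeasurePreserving.id μ).prod ((measurePreserving_prodAssoc' ν κ τ).symm _)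
  have h3 := (MeasurePreserving.id μ).prod
    ((Measure.measurePreserving_swap (μ := ν) (ν := κ)).prod (MeasurePreserving.id τ))
  have h4 := (MeasurePreserving.id μ).prod (measurePreserving_prodAssoc' κ ν τ)
  have h5 := (measurePreserving_prodAssoc' μ κ (ν.prod τ)).symm _
  exact h5.comp (h4.comp (h3.comp (h2.comp h1)))

lemma lintegral_prodComm4_le (H : (ℝ × Rn n) × (ℝ × Rn n) → ℝ≥0∞) :
    ∫⁻ p, H p ≤ ∫⁻ t : ℝ, ∫⁻ t' : ℝ, ∫⁻ x : Rn n, ∫⁻ x' : Rn n, H ((t, x), (t', x')) := by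
  have h := (measurePreserving_prodComm4 (volume : Measure ℝ) (volume : Measure ℝ)
    (volume : Measure (Rn n)) (volume : Measure (Rn n))).lintegral_comp_emb
    (MeasurableEquiv.measurableEmbedding _) H
  calc ∫⁻ p, H p = ∫⁻ q : (ℝ × ℝ) × (Rn n × Rn n), H ((q.1.1, q.2.1), (q.1.2, q.2.2)) := h.symm
    _ ≤ ∫⁻ t : ℝ × ℝ, ∫⁻ x : Rn n × Rn n, H ((t.1, x.1), (t.2, x.2)) := lintegral_prod_le _
    _ ≤ ∫⁻ t : ℝ × ℝ, ∫⁻ x : Rn n, ∫⁻ x' : Rn n, H ((t.1, x), (t.2, x')) :=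
        lintegral_mono fun t => lintegral_prod_le _
    _ ≤ _ := lintegral_prod_le _

lemma enorm_integral_prodComm4_le {H : (ℝ × Rn n) × (ℝ × Rn n) → ℂ} (hH : Integrable H) :
    ‖∫ p, H p‖ₑ ≤ ∫⁻ t : ℝ, ∫⁻ t' : ℝ, ‖∫ x : Rn n × Rn n, H ((t, x.1), (t', x.2))‖ₑ := by
  have hp := measurePreserving_prodComm4 (volume : Measure ℝ) (volume : Measure ℝ)
    (volume : Measure (Rn n)) (volume : Measure (Rn n))
  have h := hp.integral_comp (MeasurableEquiv.measurableEmbedding _) H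
  have hi : Integrable (fun q : (ℝ × ℝ) × (Rn n × Rn n) => H ((q.1.1, q.2.1), (q.1.2, q.2.2)))
      ((volume.prod volume).prod (volume.prod volume)) :=
    (hp.integrable_comp_emb (MeasurableEquiv.measurableEmbedding _)).2 hH
  calc ‖∫ p, H p‖ₑ = ‖∫ q : (ℝ × ℝ) × (Rn n × Rn n), H ((q.1.1, q.2.1), (q.1.2, q.2.2))‖ₑ := by
        rw [show ∫ p, H p = _ from h.symm]; rfl
    _ = ‖∫ t : ℝ × ℝ, ∫ x : Rn n × Rn n, H ((t.1, x.1), (t.2, x.2))‖ₑ := by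
        congr 1; exact integral_prod _ hi
    _ ≤ ∫⁻ t : ℝ × ℝ, ‖∫ x : Rn n × Rn n, H ((t.1, x.1), (t.2, x.2))‖ₑ :=
        enorm_integral_le_lintegral_enorm _
    _ ≤ _ := lintegral_prod_le _

lemma lintegral_levels_le {e : ℝ} (he : 0 < e) {c m : ℝ≥0∞} (hc : c ≠ 0) (hm : m ≠ ∞) :
    ∫⁻ s in Ioi (0 : ℝ), (if ENNReal.ofReal s * c < m then ENNReal.ofReal (s ^ (e - 1)) else 0) ≤
      ENNReal.ofReal (1 / e) * (m * c⁻¹) ^ e := by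
  by_cases hct : c = ∞
  · refine le_of_eq_of_le ?_ zero_le
    rw [← lintegral_zero (μ := volume.restrict (Ioi (0 : ℝ)))]
    refine setLIntegral_congr_fun measurableSet_Ioi fun s hs => ?_
    have : ENNReal.ofReal s ≠ 0 := by simpa using hs
    simp [hct, ENNReal.mul_top this]
  set R : ℝ := (m * c⁻¹).toReal with hR
  have hRm : m * c⁻¹ ≠ ∞ := ENNReal.mul_ne_top hm (ENNReal.inv_ne_top.2 hc)
  have hle : ∀ s ∈ Ioi (0 : ℝ), (if ENNReal.ofReal s * c < m then
      ENNReal.ofReal (s ^ (e - 1)) else 0) ≤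
      (Ioo 0 R).indicator (fun s => ENNReal.ofReal (s ^ (e - 1))) s := by
    intro s hs
    split_ifs with h
    · have h2 : ENNReal.ofReal s < m * c⁻¹ := by
        rw [← div_eq_mul_inv, ENNReal.lt_div_iff_mul_lt (Or.inl hc) (Or.inl hct)]
        exact h
      have : s ∈ Ioo 0 R := ⟨hs, (ENNReal.ofReal_lt_iff_lt_toReal (le_of_lt hs) hRm).1 h2⟩
      rw [indicator_of_mem this]
    · exact zero_le
  calc _ ≤ ∫⁻ s in Ioi (0 : ℝ), (Ioo 0 R).indicator (fun s => ENNReal.ofReal (s ^ (e - 1))) s :=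
        setLIntegral_mono' measurableSet_Ioi hle
    _ ≤ ∫⁻ s, (Ioo 0 R).indicator (fun s => ENNReal.ofReal (s ^ (e - 1))) s :=
        setLIntegral_le_lintegral _ _
    _ = ENNReal.ofReal (R ^ e / e) := by
        rw [lintegral_indicator measurableSet_Ioo, lintegral_Ioo_rpow he ENNReal.toReal_nonneg]
    _ = _ := by
        rw [div_eq_inv_mul, ENNReal.ofReal_mul (by positivity), one_div,
          ← ENNReal.ofReal_rpow_of_nonneg ENNReal.toReal_nonneg he.le,
          ENNReal.ofReal_toReal hRm]

/-- Bessel's inequality in `L²`, in terms of integrals. -/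
lemma sum_enorm_integral_sq_le {X ι : Type*} [MeasurableSpace X] {μ : Measure X} [Fintype ι]
    [DecidableEq ι] {v : ι → X → ℂ} (hv : ∀ i, MemLp (v i) 2 μ)
    (ho : ∀ i j, ∫ x, conj (v i x) * v j x ∂μ = if i = j then 1 else 0)
    {K : X → ℂ} (hK : AEStronglyMeasurable K μ) :
    ∑ i, ‖∫ x, K x * conj (v i x) ∂μ‖ₑ ^ 2 ≤ ∫⁻ x, ‖K x‖ₑ ^ 2 ∂μ := by
  by_cases hfin : ∫⁻ x, ‖K x‖ₑ ^ 2 ∂μ = ∞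
  · rw [hfin]; exact le_top
  have hKL : MemLp K 2 μ := by
    refine ⟨hK, ?_⟩
    rw [eLpNorm_lt_top_iff_lintegral_rpow_enorm_lt_top (by norm_num) (by norm_num)]
    simpa using lt_top_iff_ne_top.2 hfin
  have hon : Orthonormal ℂ fun i => (hv i).toLp (v i) := by
    rw [orthonormal_iff_ite]
    intro i j
    rw [L2.inner_def, ← ho i j]
    refine integral_congr_ae ?_
    filter_upwards [(hv i).coeFn_toLp, (hv j).coeFn_toLp] with x hx hy
    rw [hx, hy, RCLike.inner_apply, mul_comm]
  have h := hon.sum_inner_products_le (s := Finset.univ) (hKL.toLp K)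
  have hnorm : ENNReal.ofReal (‖hKL.toLp K‖ ^ 2) = ∫⁻ x, ‖K x‖ₑ ^ 2 ∂μ := by
    rw [Lp.norm_toLp, ENNReal.ofReal_pow ENNReal.toReal_nonneg,
      ENNReal.ofReal_toReal hKL.eLpNorm_lt_top.ne,
      eLpNorm_eq_lintegral_rpow_enorm_toReal (by norm_num) (by norm_num)]
    simp only [ENNReal.toReal_ofNat, ENNReal.rpow_two]
    rw [← ENNReal.rpow_natCast, ← ENNReal.rpow_mul]
    norm_num
  rw [← hnorm]
  refine le_trans (le_of_eq ?_) (ENNReal.ofReal_le_ofReal h)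
  rw [ENNReal.ofReal_sum_of_nonneg (fun _ _ => by positivity)]
  refine Finset.sum_congr rfl fun i _ => ?_
  rw [ENNReal.ofReal_pow (norm_nonneg _), ofReal_norm, L2.inner_def]
  congr 2
  refine integral_congr_ae ?_
  filter_upwards [(hv i).coeFn_toLp, hKL.coeFn_toLp] with x hx hy
  rw [hx, hy, RCLike.inner_apply]

/-- The dyadic level of a nonnegative number. -/
def dyadicLevel (y : ℝ≥0) : ℤ := ⌊Real.logb 2 y⌋

lemma measurable_dyadicLevel : Measurable dyadicLevel :=
  Int.measurable_floor.comp ((Real.measurable_log.comp measurable_subtype_coe).div_const _)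

lemma le_two_zpow_dyadicLevel (y : ℝ≥0) : (y : ℝ≥0∞) ≤ 2 ^ (dyadicLevel y + 1) := by
  rcases eq_or_ne y 0 with rfl | hy
  · simp
  have hy' : (0 : ℝ) < y := by exact_mod_cast pos_iff_ne_zero.2 hy
  have h : (y : ℝ) ≤ 2 ^ (dyadicLevel y + 1) := by
    rw [← Real.rpow_intCast, ← Real.logb_le_iff_le_rpow (by norm_num) hy']
    push_cast
    exact (Int.lt_floor_add_one _).le
  have h2 : y ≤ (2 : ℝ≥0) ^ (dyadicLevel y + 1) := by
    rw [← NNReal.coe_le_coe]; push_cast; exact h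
  calc (y : ℝ≥0∞) ≤ ((2 : ℝ≥0) ^ (dyadicLevel y + 1) : ℝ≥0) := by exact_mod_cast h2
    _ = _ := by rw [ENNReal.coe_zpow (by norm_num)]; norm_num

lemma two_zpow_dyadicLevel_le {y : ℝ≥0} (hy : y ≠ 0) : (2 : ℝ≥0∞) ^ dyadicLevel y ≤ y := by
  have hy' : (0 : ℝ) < y := by exact_mod_cast pos_iff_ne_zero.2 hy
  have h : (2 : ℝ) ^ dyadicLevel y ≤ y := by
    rw [← Real.rpow_intCast, ← Real.le_logb_iff_rpow_le (by norm_num) hy']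
    exact Int.floor_le _
  have h2 : (2 : ℝ≥0) ^ dyadicLevel y ≤ y := by
    rw [← NNReal.coe_le_coe]; push_cast; exact h
  calc (2 : ℝ≥0∞) ^ dyadicLevel y = ((2 : ℝ≥0) ^ dyadicLevel y : ℝ≥0) := by
        rw [ENNReal.coe_zpow (by norm_num)]; norm_num
    _ ≤ _ := by exact_mod_cast h2

/-- Space-time. -/
abbrev SpaceTime (n : ℕ) := ℝ × Rn n

/-- The space-time kernel form density. -/
def kernelForm (ε : ℝ) (g : SpaceTime n → ℂ) (p : SpaceTime n × SpaceTime n) : ℂ :=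
  conj (g p.1) * g p.2 * gaussKernel ε (p.2.1 - p.1.1) (p.2.2 - p.1.2)

lemma measurable_gaussKernel_spaceTime (ε : ℝ) :
    Measurable fun p : SpaceTime n × SpaceTime n => gaussKernel ε (p.2.1 - p.1.1) (p.2.2 - p.1.2) := by
  have : Measurable fun p : SpaceTime n × SpaceTime n => ((p.2.1 - p.1.1, p.2.2 - p.1.2) : ℝ × Rn n) := by
    fun_prop
  exact (measurable_gaussKernel ε).comp this

lemma integrable_kernelForm {ε : ℝ} (hε : 0 < ε) {g : SpaceTime n → ℂ} (hg : Integrable g) :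
    Integrable (kernelForm ε g) := by
  have h1 : Integrable (fun x => conj (g x)) :=
    hg.norm.congr' (Complex.continuous_conj.comp_aestronglyMeasurable
        hg.aestronglyMeasurable) (by simp)
  have h2 : Integrable (fun z : SpaceTime n × SpaceTime n => conj (g z.1) * g z.2) (volume.prod volume) :=
    Integrable.mul_prod (f := fun x => conj (g x)) h1 hg
  rw [Measure.volume_eq_prod]
  refine h2.mul_bdd (c := (π / ε) ^ ((n : ℝ) / 2))
    (measurable_gaussKernel_spaceTime ε).aestronglyMeasurable
    (Filter.Eventually.of_forall fun z => (norm_gaussKernel_le hε _ _).trans ?_)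
  have : ε ≤ ‖(ε : ℂ) - Complex.I * (z.2.1 - z.1.1 : ℝ)‖ := by
    have := Complex.re_le_norm ((ε : ℂ) - Complex.I * (z.2.1 - z.1.1 : ℝ))
    simpa using this
  gcongr

/-- The weighted cut-off in time. -/
def cutoff (η : ℝ≥0∞) (σ γ : ℝ) (w : ℝ → ℝ≥0) (t t' : ℝ) : ℝ≥0∞ :=
  η * ((w t : ℝ≥0∞) ^ (σ - 1) * (w t' : ℝ≥0∞) ^ (σ - 1)) * ‖t - t'‖ₑ ^ (-γ)

lemma measurable_cutoff (η : ℝ≥0∞) (σ γ : ℝ) {w : ℝ → ℝ≥0} (hw : Measurable w) :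
    Measurable fun q : ℝ × ℝ => cutoff η σ γ w q.1 q.2 := by
  unfold cutoff
  fun_prop

lemma mul_cutoff_le (η : ℝ≥0∞) (σ γ : ℝ) (w : ℝ → ℝ≥0) (t t' : ℝ) :
    (w t : ℝ≥0∞) * w t' * cutoff η σ γ w t t' ≤
      η * ((w t : ℝ≥0∞) ^ σ * (w t' : ℝ≥0∞) ^ σ * ‖t - t'‖ₑ ^ (-γ)) := by
  have h : ∀ y : ℝ≥0, (y : ℝ≥0∞) * (y : ℝ≥0∞) ^ (σ - 1) ≤ (y : ℝ≥0∞) ^ σ := by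
    intro y
    rcases eq_or_ne y 0 with rfl | hy
    · simp
    · have hy' : (y : ℝ≥0∞) ≠ 0 := by simpa using hy
      conv_lhs => rw [← ENNReal.rpow_one (y : ℝ≥0∞), ← ENNReal.rpow_mul, one_mul,
        ← ENNReal.rpow_add _ _ hy' ENNReal.coe_ne_top]
      simp
  calc (w t : ℝ≥0∞) * w t' * cutoff η σ γ w t t' =
        η * (((w t : ℝ≥0∞) * (w t : ℝ≥0∞) ^ (σ - 1)) *
          ((w t' : ℝ≥0∞) * (w t' : ℝ≥0∞) ^ (σ - 1)) * ‖t - t'‖ₑ ^ (-γ)) := by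
        rw [cutoff]; ring
    _ ≤ _ := by gcongr <;> exact h _

/-- The region where the kernel form is treated by orthogonality at fixed times. -/
def nearSet (c : ℝ → ℝ → ℝ≥0∞) (φ : SpaceTime n → ℝ≥0) (s : ℝ≥0∞) : Set (SpaceTime n × SpaceTime n) :=
  {p | (2 : ℝ≥0∞) ^ (dyadicLevel (φ p.1) + dyadicLevel (φ p.2)) ≤ s * c p.1.1 p.2.1}

lemma measurable_two_zpow_levels {φ : SpaceTime n → ℝ≥0} (hφ : Measurable φ) :
    Measurable fun p : SpaceTime n × SpaceTime n =>
      (2 : ℝ≥0∞) ^ (dyadicLevel (φ p.1) + dyadicLevel (φ p.2)) := by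
  have h : Measurable fun k : ℤ => (2 : ℝ≥0∞) ^ k := measurable_from_top
  have h2 : Measurable fun p : SpaceTime n × SpaceTime n => dyadicLevel (φ p.1) + dyadicLevel (φ p.2) :=
    (measurable_dyadicLevel.comp (hφ.comp measurable_fst)).add
      (measurable_dyadicLevel.comp (hφ.comp measurable_snd))
  exact h.comp h2

lemma measurableSet_nearSet {c : ℝ → ℝ → ℝ≥0∞} (hc : Measurable fun q : ℝ × ℝ => c q.1 q.2)
    {φ : SpaceTime n → ℝ≥0} (hφ : Measurable φ) (s : ℝ≥0∞) : MeasurableSet (nearSet c φ s) := by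
  refine measurableSet_le (measurable_two_zpow_levels hφ) (Measurable.const_mul ?_ s)
  have : Measurable fun p : SpaceTime n × SpaceTime n => (p.1.1, p.2.1) := by fun_prop
  exact hc.comp this

/-- The weighted function `w(t) φ(t,x) h(t,x)`. -/
def weighted (w : ℝ → ℝ≥0) (φ : SpaceTime n → ℝ≥0) (h : SpaceTime n → ℂ) (z : SpaceTime n) : ℂ :=
  ((w z.1 * φ z : ℝ≥0) : ℂ) * h z

lemma enorm_weighted (w : ℝ → ℝ≥0) (φ : SpaceTime n → ℝ≥0) (h : SpaceTime n → ℂ) (z : SpaceTime n) :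
    ‖weighted w φ h z‖ₑ = w z.1 * φ z * ‖h z‖ₑ := by
  have h1 : ∀ y : ℝ≥0, ‖((y : ℝ) : ℂ)‖ₑ = y := fun y => by
    rw [← ofReal_norm, Complex.norm_real, Real.norm_of_nonneg (NNReal.coe_nonneg y), ENNReal.ofReal_coe_nnreal]
  rw [weighted, enorm_mul]
  have := h1 (w z.1 * φ z)
  rw [ENNReal.coe_mul] at this
  rw [← this]

lemma enorm_setIntegral_nearSet_le {γ κ : ℝ} (hγ : 0 < γ) (hγ1 : γ < 1) (hκ : 0 < κ)
    {C : ℝ≥0∞} (hC : ∀ f : ℝ → ℝ≥0∞, Measurable f → ∫⁻ t, f t ^ (2 / (2 - γ)) ≤ 2 →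
      ∫⁻ t, ∫⁻ t', f t * f t' * ‖t - t'‖ₑ ^ (-γ) ≤ C)
    {η : ℝ≥0∞} (hη : η ≠ ∞) {ε : ℝ} (hε : 0 < ε) {w : ℝ → ℝ≥0} (hw : Measurable w)
    (hw1 : ∫⁻ t, (w t : ℝ≥0∞) ^ κ ≤ 1)
    {φ : SpaceTime n → ℝ≥0} (hφ : Measurable φ) {h : SpaceTime n → ℂ} (hh : Measurable h)
    (hh1 : ∫⁻ z, ‖h z‖ₑ ^ 2 ≤ 1) (hg : Integrable (weighted w φ h)) {s : ℝ≥0∞} (hs : s ≠ ∞) :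
    ‖∫ p in nearSet (cutoff η (κ / 2 * (1 - γ)) γ w) φ s, kernelForm ε (weighted w φ h) p‖ₑ ≤
      8 * plConst n * s * η * C := by
  set σ := κ / 2 * (1 - γ) with hσ
  set Ω := nearSet (cutoff η σ γ w) φ s with hΩ
  have hΩm : MeasurableSet Ω := measurableSet_nearSet (measurable_cutoff η σ γ hw) hφ s
  set N : ℝ → ℝ≥0∞ := fun t => ∫⁻ x, ‖h (t, x)‖ₑ ^ 2 with hN
  have hNm : Measurable N := (hh.enorm.pow_const 2).lintegral_prod_right'
  have hN1 : ∫⁻ t, N t ≤ 1 := by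
    rw [hN, ← lintegral_prod (fun z : ℝ × Rn n => ‖h z‖ₑ ^ 2) (hh.enorm.pow_const 2).aemeasurable]
    exact hh1
  set f : ℝ → ℝ≥0∞ := fun t => (w t : ℝ≥0∞) ^ σ * N t ^ (1 / 2 : ℝ) with hf
  have hfm : Measurable f := by fun_prop
  have h2γ : 0 < 2 - γ := by linarith
  have hf2 : ∫⁻ t, f t ^ (2 / (2 - γ)) ≤ 2 := by
    calc ∫⁻ t, f t ^ (2 / (2 - γ)) ≤ ∫⁻ t, ((w t : ℝ≥0∞) ^ κ + N t) := by
          refine lintegral_mono fun t => ?_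
          have e : f t ^ (2 / (2 - γ)) =
              ((w t : ℝ≥0∞) ^ κ) ^ ((1 - γ) / (2 - γ)) * N t ^ (1 / (2 - γ)) := by
            rw [hf]
            simp only
            rw [ENNReal.mul_rpow_of_nonneg _ _ (by positivity), ← ENNReal.rpow_mul,
              ← ENNReal.rpow_mul, ← ENNReal.rpow_mul]
            congr 2
            · rw [hσ]; field_simp
            · field_simp
          rw [e]
          refine rpow_mul_rpow_le_add (div_nonneg (by linarith) h2γ.le) (by positivity) ?_
          field_simp
          ring
      _ = (∫⁻ t, (w t : ℝ≥0∞) ^ κ) + ∫⁻ t, N t := lintegral_add_right _ hNm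
      _ ≤ 1 + 1 := by gcongr
      _ = 2 := by norm_num
  have hHLS := hC f hfm hf2
  have hI : Integrable (Ω.indicator (kernelForm ε (weighted w φ h))) :=
    (integrable_kernelForm hε hg).indicator hΩm
  rw [← integral_indicator hΩm]
  have hsec : ∀ᵐ t : ℝ, Integrable fun x => weighted w φ h (t, x) := by
    rw [Measure.volume_eq_prod] at hg
    exact hg.prod_right_ae
  have key : ∀ t t' : ℝ, Integrable (fun x => weighted w φ h (t, x)) →
      Integrable (fun x => weighted w φ h (t', x)) →
      ‖∫ x : Rn n × Rn n, Ω.indicator (kernelForm ε (weighted w φ h)) ((t, x.1), (t', x.2))‖ₑ ≤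
        8 * plConst n * s * η * (f t * f t' * ‖t - t'‖ₑ ^ (-γ)) := by
    intro t t' ht ht'
    have hlev : ∀ t : ℝ, Measurable fun x : Rn n => dyadicLevel (φ (t, x)) := fun t =>
      measurable_dyadicLevel.comp (hφ.comp measurable_prodMk_left)
    have hhm : ∀ t : ℝ, Measurable fun x : Rn n => ‖h (t, x)‖ₑ := fun t =>
      (hh.comp measurable_prodMk_left).enorm
    have hb : ∀ (t : ℝ) (x : Rn n), ‖weighted w φ h (t, x)‖ₑ ≤
        (w t : ℝ≥0∞) * 2 ^ (dyadicLevel (φ (t, x)) + 1) * ‖h (t, x)‖ₑ := fun t x => by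
      rw [enorm_weighted]
      gcongr
      exact le_two_zpow_dyadicLevel _
    have := enorm_setIntegral_levels_le hε (t' - t) ht ht' (hlev t) (hlev t') (hhm t) (hhm t')
      (s * cutoff η σ γ w t t') (hb t) (hb t')
    calc _ = ‖∫ z in {z : Rn n × Rn n | (2 : ℝ≥0∞) ^
              (dyadicLevel (φ (t, z.1)) + dyadicLevel (φ (t', z.2))) ≤ s * cutoff η σ γ w t t'},
            conj (weighted w φ h (t, z.1)) * weighted w φ h (t', z.2) *
              gaussKernel ε (t' - t) (z.2 - z.1)‖ₑ := by
          rw [← integral_indicator]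
          · rfl
          · have hm : Measurable fun z : Rn n × Rn n => (((t, z.1), (t', z.2)) : SpaceTime n × SpaceTime n) := by
              fun_prop
            exact hm hΩm
      _ ≤ _ := this
      _ = 8 * plConst n * s * ((w t : ℝ≥0∞) * w t' * cutoff η σ γ w t t') *
            (N t ^ (1 / 2 : ℝ) * N t' ^ (1 / 2 : ℝ)) := by
          simp only [hN]; ring
      _ ≤ 8 * plConst n * s * (η * ((w t : ℝ≥0∞) ^ σ * (w t' : ℝ≥0∞) ^ σ * ‖t - t'‖ₑ ^ (-γ))) *
            (N t ^ (1 / 2 : ℝ) * N t' ^ (1 / 2 : ℝ)) := by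
          exact mul_le_mul_left (mul_le_mul_right (mul_cutoff_le η σ γ w t t') _) _
      _ = _ := by simp only [hf]; ring
  have hconst : 8 * plConst n * s * η ≠ ∞ := by
    have := plConst_ne_top (n := n)
    finiteness
  calc _ ≤ ∫⁻ t : ℝ, ∫⁻ t' : ℝ, ‖∫ x : Rn n × Rn n,
        Ω.indicator (kernelForm ε (weighted w φ h)) ((t, x.1), (t', x.2))‖ₑ :=
        enorm_integral_prodComm4_le hI
    _ ≤ ∫⁻ t : ℝ, ∫⁻ t' : ℝ, 8 * plConst n * s * η * (f t * f t' * ‖t - t'‖ₑ ^ (-γ)) := by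
        refine lintegral_mono_ae ?_
        filter_upwards [hsec] with t ht
        refine lintegral_mono_ae ?_
        filter_upwards [hsec] with t' ht'
        exact key t t' ht ht'
    _ = 8 * plConst n * s * η * ∫⁻ t : ℝ, ∫⁻ t' : ℝ, f t * f t' * ‖t - t'‖ₑ ^ (-γ) := by
        simp_rw [lintegral_const_mul' _ _ hconst]
    _ ≤ _ := by gcongr

lemma enorm_coe_nnreal (y : ℝ≥0) : ‖((y : ℝ) : ℂ)‖ₑ = y := by
  rw [← ofReal_norm, Complex.norm_real, Real.norm_of_nonneg (NNReal.coe_nonneg y),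
    ENNReal.ofReal_coe_nnreal]

/-- The kernel multiplied by the weights. -/
def weightedKernel (ε : ℝ) (w : ℝ → ℝ≥0) (φ : SpaceTime n → ℝ≥0)
    (p : SpaceTime n × SpaceTime n) : ℂ :=
  (((w p.1.1 * φ p.1 : ℝ≥0) : ℝ) : ℂ) * (((w p.2.1 * φ p.2 : ℝ≥0) : ℝ) : ℂ) *
    gaussKernel ε (p.2.1 - p.1.1) (p.2.2 - p.1.2)

lemma measurable_weightedKernel (ε : ℝ) {w : ℝ → ℝ≥0} (hw : Measurable w)
    {φ : SpaceTime n → ℝ≥0} (hφ : Measurable φ) : Measurable (weightedKernel ε w φ) := by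
  have := measurable_gaussKernel_spaceTime (n := n) ε
  have hc : Measurable fun y : ℝ≥0 => ((y : ℝ) : ℂ) := by fun_prop
  have h1 : Measurable fun p : SpaceTime n × SpaceTime n => w p.1.1 * φ p.1 := by fun_prop
  have h2 : Measurable fun p : SpaceTime n × SpaceTime n => w p.2.1 * φ p.2 := by fun_prop
  exact ((hc.comp h1).mul (hc.comp h2)).mul this

lemma enorm_weightedKernel_sq_le {ε : ℝ} (hε : 0 < ε) (w : ℝ → ℝ≥0) (φ : SpaceTime n → ℝ≥0)
    (p : SpaceTime n × SpaceTime n) :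
    ‖weightedKernel ε w φ p‖ₑ ^ 2 ≤ ENNReal.ofReal (π ^ ((n : ℝ) / 2)) ^ 2 *
      ((w p.1.1 * w p.2.1 : ℝ≥0∞) ^ 2 * (φ p.1 * φ p.2 : ℝ≥0∞) ^ 2 *
        ‖p.1.1 - p.2.1‖ₑ ^ (-(n : ℝ))) := by
  have h := enorm_gaussKernel_le hε (p.2.1 - p.1.1) (p.2.2 - p.1.2)
  rw [weightedKernel, enorm_mul, enorm_mul, enorm_coe_nnreal, enorm_coe_nnreal]
  have e : (‖p.2.1 - p.1.1‖ₑ ^ (-((n : ℝ) / 2))) ^ 2 = ‖p.1.1 - p.2.1‖ₑ ^ (-(n : ℝ)) := by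
    rw [← ENNReal.rpow_natCast, ← ENNReal.rpow_mul, enorm_sub_rev]
    congr 1; push_cast; ring
  rw [← e]
  calc _ ≤ (((w p.1.1 * φ p.1 : ℝ≥0) : ℝ≥0∞) * ((w p.2.1 * φ p.2 : ℝ≥0) : ℝ≥0∞) *
        (ENNReal.ofReal (π ^ ((n : ℝ) / 2)) * ‖p.2.1 - p.1.1‖ₑ ^ (-((n : ℝ) / 2)))) ^ 2 := by
        gcongr
    _ = _ := by push_cast; ring

lemma kernelForm_weighted (ε : ℝ) (w : ℝ → ℝ≥0) (φ : SpaceTime n → ℝ≥0) (h : SpaceTime n → ℂ)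
    (p : SpaceTime n × SpaceTime n) :
    kernelForm ε (weighted w φ h) p =
      weightedKernel ε w φ p * conj (h p.1 * conj (h p.2)) := by
  have h1 : ∀ y : ℝ≥0, conj ((y : ℝ) : ℂ) = ((y : ℝ) : ℂ) := fun y => Complex.conj_ofReal _
  have h2 := h1 (w p.1.1 * φ p.1)
  simp only [kernelForm, weighted, weightedKernel, map_mul, Complex.conj_conj]
  rw [h2]
  ring

lemma sum_enorm_setIntegral_kernelForm_sq_le {ι : Type} [Fintype ι] [DecidableEq ι]
    (ε : ℝ) {w : ℝ → ℝ≥0} (hw : Measurable w)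
    {φ : SpaceTime n → ℝ≥0} (hφ : Measurable φ) {h : ι → SpaceTime n → ℂ}
    (hh : ∀ k, Measurable (h k)) (hh1 : ∀ k, ∫⁻ z, ‖h k z‖ₑ ^ 2 ≤ 1)
    (ho : ∀ j k, ∫ z, conj (h j z) * h k z = if j = k then 1 else 0)
    {Ω : Set (SpaceTime n × SpaceTime n)} (hΩ : MeasurableSet Ω) :
    ∑ k, ‖∫ p in Ω, kernelForm ε (weighted w φ (h k)) p‖ₑ ^ 2 ≤
      ∫⁻ p in Ω, ‖weightedKernel ε w φ p‖ₑ ^ 2 := by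
  have hK := (measurable_weightedKernel ε hw hφ).indicator hΩ
  set v : ι → SpaceTime n × SpaceTime n → ℂ := fun k p => h k p.1 * conj (h k p.2) with hv
  have hconj : Measurable (conj : ℂ → ℂ) := Complex.continuous_conj.measurable
  have hvm : ∀ k, MemLp (v k) 2 (volume : Measure (SpaceTime n × SpaceTime n)) := by
    intro k
    have hm : Measurable (v k) :=
      ((hh k).comp measurable_fst).mul (hconj.comp ((hh k).comp measurable_snd))
    refine ⟨hm.aestronglyMeasurable, ?_⟩
    rw [eLpNorm_lt_top_iff_lintegral_rpow_enorm_lt_top (by norm_num) (by norm_num)]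
    have hm2 : Measurable fun z => ‖h k z‖ₑ ^ 2 := (hh k).enorm.pow_const 2
    calc ∫⁻ p, ‖v k p‖ₑ ^ (2 : ℝ≥0∞).toReal
        = ∫⁻ p : SpaceTime n × SpaceTime n, ‖h k p.1‖ₑ ^ 2 * ‖h k p.2‖ₑ ^ 2 := by
          refine lintegral_congr fun p => ?_
          simp [hv, enorm_mul, mul_pow]
      _ = (∫⁻ z, ‖h k z‖ₑ ^ 2) * ∫⁻ z, ‖h k z‖ₑ ^ 2 := by
          rw [Measure.volume_eq_prod]
          exact lintegral_prod_mul hm2.aemeasurable hm2.aemeasurable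
      _ ≤ 1 * 1 := by gcongr <;> exact hh1 k
      _ < ∞ := by norm_num
  have hvo : ∀ i j, ∫ p, conj (v i p) * v j p = if i = j then 1 else 0 := by
    intro i j
    calc ∫ p, conj (v i p) * v j p = ∫ p : SpaceTime n × SpaceTime n,
          (conj (h i p.1) * h j p.1) * (conj (h j p.2) * h i p.2) := by
          refine integral_congr_ae (Filter.Eventually.of_forall fun p => ?_)
          simp only [hv, map_mul, Complex.conj_conj]
          ring
      _ = (∫ z, conj (h i z) * h j z) * ∫ z, conj (h j z) * h i z := by
          rw [Measure.volume_eq_prod]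
          exact integral_prod_mul (fun z => conj (h i z) * h j z) fun z => conj (h j z) * h i z
      _ = _ := by rw [ho, ho]; by_cases hij : i = j <;> simp [hij]
  have := sum_enorm_integral_sq_le hvm hvo hK.aestronglyMeasurable
  calc _ = ∑ k, ‖∫ p, Ω.indicator (weightedKernel ε w φ) p * conj (v k p)‖ₑ ^ 2 := by
        refine Finset.sum_congr rfl fun k _ => ?_
        rw [← integral_indicator hΩ]
        congr 3
        ext p
        by_cases hp : p ∈ Ω
        · simp only [indicator_of_mem hp, kernelForm_weighted, hv]
        · simp [indicator_of_notMem hp]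
    _ ≤ _ := this
    _ = _ := by
        rw [← lintegral_indicator hΩ]
        refine lintegral_congr fun p => ?_
        by_cases hp : p ∈ Ω <;> simp [hp]

lemma sum_rpow_le_lintegral {ι : Type} [Fintype ι] {β : ℝ} (hβ : 2 < β) (R : ι → ℝ≥0∞) (hR : ∀ k, R k ≠ ∞)
    (D : ℝ → ℝ≥0∞) (F : ι → ℝ → ℝ≥0∞) (hD : ∀ s, 0 < s → ∑ k, F k s ^ 2 ≤ D s)
    (hF : ∀ k s, 0 < s → R k ≤ ENNReal.ofReal s / 2 + F k s) :
    ∑ k, R k ^ β ≤ ENNReal.ofReal β * 4 *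
      ∫⁻ s in Ioi (0 : ℝ), ENNReal.ofReal (s ^ (β - 2 - 1)) * D s := by
  have h1 : ∀ k, R k ^ β = ENNReal.ofReal β * ∫⁻ s in Ioi (0 : ℝ),
      (Ioo 0 (R k).toReal).indicator (fun s => ENNReal.ofReal (s ^ (β - 1))) s := by
    intro k
    rw [setLIntegral_indicator measurableSet_Ioo,
      inter_eq_left.2 (fun x hx => hx.1), lintegral_Ioo_rpow (by linarith) toReal_nonneg,
      ← ENNReal.ofReal_mul (by linarith), mul_div_cancel₀ _ (by linarith : β ≠ 0),
      ← ENNReal.ofReal_rpow_of_nonneg toReal_nonneg (by linarith), ENNReal.ofReal_toReal (hR k)]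
  simp_rw [h1, ← Finset.mul_sum]
  rw [← lintegral_finsetSum, mul_assoc]
  swap
  · intro k _
    refine Measurable.indicator ?_ measurableSet_Ioo
    fun_prop
  refine mul_le_mul_right ?_ _
  rw [← lintegral_const_mul' _ _ (by norm_num)]
  refine setLIntegral_mono' measurableSet_Ioi fun s hs => ?_
  have hs : 0 < s := hs
  have h2 : ∀ k, (Ioo 0 (R k).toReal).indicator (fun s => ENNReal.ofReal (s ^ (β - 1))) s ≤
      4 * (ENNReal.ofReal (s ^ (β - 2 - 1)) * F k s ^ 2) := by
    intro k
    by_cases hk : s ∈ Ioo 0 (R k).toReal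
    · rw [indicator_of_mem hk]
      have h3 : ENNReal.ofReal s ≤ R k := ENNReal.ofReal_le_of_le_toReal hk.2.le
      have h4 : ENNReal.ofReal s / 2 ≤ F k s := by
        have := h3.trans (hF k s hs)
        rw [← ENNReal.add_halves (ENNReal.ofReal s)] at this
        rw [ENNReal.add_halves] at this
        nth_rw 1 [← ENNReal.add_halves (ENNReal.ofReal s)] at this
        exact (ENNReal.add_le_add_iff_left (by finiteness)).1 this
      have h5 : ENNReal.ofReal (s ^ (β - 1)) =
          4 * (ENNReal.ofReal (s ^ (β - 2 - 1)) * (ENNReal.ofReal s / 2) ^ 2) := by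
        have e4 : (4 : ℝ≥0∞) = ENNReal.ofReal 4 := by norm_num
        have e2 : (2 : ℝ≥0∞) = ENNReal.ofReal 2 := by norm_num
        rw [e2, ← ENNReal.ofReal_div_of_pos (by norm_num), ← ENNReal.ofReal_pow (by positivity),
          ← ENNReal.ofReal_mul (by positivity), e4, ← ENNReal.ofReal_mul (by norm_num)]
        congr 1
        have : s ^ (β - 1) = s ^ (β - 2 - 1) * s ^ 2 := by
          rw [← Real.rpow_natCast, ← Real.rpow_add hs]; congr 1; push_cast; ring
        rw [this]; ring
      rw [h5]
      gcongr
    · rw [indicator_of_notMem hk]; exact zero_le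
  calc _ ≤ ∑ k, 4 * (ENNReal.ofReal (s ^ (β - 2 - 1)) * F k s ^ 2) :=
        Finset.sum_le_sum fun k _ => h2 k
    _ = 4 * (ENNReal.ofReal (s ^ (β - 2 - 1)) * ∑ k, F k s ^ 2) := by
        rw [Finset.mul_sum, Finset.mul_sum]
    _ ≤ _ := by gcongr; exact hD s hs

lemma lintegral_far_le {ε : ℝ} (hε : 0 < ε) {w : ℝ → ℝ≥0} {φ : SpaceTime n → ℝ≥0}
    {β σ γ : ℝ} (hβ : 2 < β) (hγ : 0 < γ) {η : ℝ≥0∞} (hη0 : η ≠ 0)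
    (hη : η ≠ ∞) (p : SpaceTime n × SpaceTime n) :
    ∫⁻ s in Ioi (0 : ℝ), ENNReal.ofReal (s ^ (β - 2 - 1)) *
        (nearSet (cutoff η σ γ w) φ (ENNReal.ofReal s))ᶜ.indicator
          (fun p => ‖weightedKernel ε w φ p‖ₑ ^ 2) p ≤
      ENNReal.ofReal (1 / (β - 2)) * ENNReal.ofReal (π ^ ((n : ℝ) / 2)) ^ 2 * η⁻¹ ^ (β - 2) *
        ((φ p.1 : ℝ≥0∞) ^ β * (φ p.2 : ℝ≥0∞) ^ β *
          ((w p.1.1 : ℝ≥0∞) ^ (β - σ * (β - 2)) * (w p.2.1 : ℝ≥0∞) ^ (β - σ * (β - 2)) *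
            ‖p.1.1 - p.2.1‖ₑ ^ (-(n - γ * (β - 2))))) := by
  have he : 0 < β - 2 := by linarith
  by_cases h0 : w p.1.1 = 0 ∨ w p.2.1 = 0 ∨ φ p.1 = 0 ∨ φ p.2 = 0
  · have hK : weightedKernel ε w φ p = 0 := by
      rcases h0 with h | h | h | h <;> simp [weightedKernel, h]
    refine le_of_eq_of_le ?_ zero_le
    rw [← lintegral_zero (μ := volume.restrict (Ioi (0 : ℝ)))]
    refine lintegral_congr fun s => ?_
    have : (nearSet (cutoff η σ γ w) φ (ENNReal.ofReal s))ᶜ.indicator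
          (fun p => ‖weightedKernel ε w φ p‖ₑ ^ 2) p = 0 := by
      rw [indicator_apply_eq_zero]
      intro _
      simp [hK]
    rw [this, mul_zero]
  push Not at h0
  obtain ⟨hw1, hw2, hφ1, hφ2⟩ := h0
  set K := ‖weightedKernel ε w φ p‖ₑ with hKdef
  set m : ℝ≥0∞ := 2 ^ (dyadicLevel (φ p.1) + dyadicLevel (φ p.2)) with hm
  set c := cutoff η σ γ w p.1.1 p.2.1 with hc
  have hmle : m ≤ φ p.1 * φ p.2 := by
    rw [hm, ENNReal.zpow_add (by norm_num) (by norm_num)]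
    exact mul_le_mul' (two_zpow_dyadicLevel_le hφ1) (two_zpow_dyadicLevel_le hφ2)
  have hmt : m ≠ ∞ := ne_top_of_le_ne_top (by finiteness) hmle
  have hw1' : (w p.1.1 : ℝ≥0∞) ≠ 0 := by simpa using hw1
  have hw2' : (w p.2.1 : ℝ≥0∞) ≠ 0 := by simpa using hw2
  have hc0 : c ≠ 0 := by
    rw [hc, cutoff]
    refine mul_ne_zero (mul_ne_zero hη0 (mul_ne_zero ?_ ?_)) ?_
    · simp [ENNReal.rpow_eq_zero_iff, hw1]
    · simp [ENNReal.rpow_eq_zero_iff, hw2]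
    · simp [ENNReal.rpow_eq_zero_iff, hγ.not_gt]
  have hKt : K ^ 2 ≠ ∞ := by rw [hKdef]; finiteness
  calc _ = ∫⁻ s in Ioi (0 : ℝ), K ^ 2 *
        (if ENNReal.ofReal s * c < m then ENNReal.ofReal (s ^ (β - 2 - 1)) else 0) := by
        refine lintegral_congr fun s => ?_
        by_cases hs : ENNReal.ofReal s * c < m
        · have hp : p ∈ (nearSet (cutoff η σ γ w) φ (ENNReal.ofReal s))ᶜ := by
            rw [mem_compl_iff]; exact not_le.2 hs
          rw [indicator_of_mem hp, if_pos hs, mul_comm]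
        · have hp : p ∉ (nearSet (cutoff η σ γ w) φ (ENNReal.ofReal s))ᶜ := by
            rw [notMem_compl_iff]; exact not_lt.1 hs
          rw [indicator_of_notMem hp, if_neg hs, mul_zero, mul_zero]
    _ = K ^ 2 * ∫⁻ s in Ioi (0 : ℝ),
        (if ENNReal.ofReal s * c < m then ENNReal.ofReal (s ^ (β - 2 - 1)) else 0) :=
        lintegral_const_mul' _ _ hKt
    _ ≤ K ^ 2 * (ENNReal.ofReal (1 / (β - 2)) * (m * c⁻¹) ^ (β - 2)) := by
        gcongr
        exact lintegral_levels_le he hc0 hmt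
    _ ≤ (ENNReal.ofReal (π ^ ((n : ℝ) / 2)) ^ 2 *
      ((w p.1.1 * w p.2.1 : ℝ≥0∞) ^ 2 * (φ p.1 * φ p.2 : ℝ≥0∞) ^ 2 *
        ‖p.1.1 - p.2.1‖ₑ ^ (-(n : ℝ)))) *
        (ENNReal.ofReal (1 / (β - 2)) * ((φ p.1 * φ p.2) * c⁻¹) ^ (β - 2)) := by
        gcongr
        exact enorm_weightedKernel_sq_le hε w φ p
    _ = ENNReal.ofReal (1 / (β - 2)) * ENNReal.ofReal (π ^ ((n : ℝ) / 2)) ^ 2 * η⁻¹ ^ (β - 2) *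
        (((φ p.1 : ℝ≥0∞) ^ 2 * (φ p.1 : ℝ≥0∞) ^ (β - 2)) *
          ((φ p.2 : ℝ≥0∞) ^ 2 * (φ p.2 : ℝ≥0∞) ^ (β - 2)) *
          (((w p.1.1 : ℝ≥0∞) ^ 2 * (w p.1.1 : ℝ≥0∞) ^ (-((σ - 1) * (β - 2)))) *
            ((w p.2.1 : ℝ≥0∞) ^ 2 * (w p.2.1 : ℝ≥0∞) ^ (-((σ - 1) * (β - 2)))) *
            (‖p.1.1 - p.2.1‖ₑ ^ (-(n : ℝ)) * ‖p.1.1 - p.2.1‖ₑ ^ (γ * (β - 2))))) := by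
        have hci : c⁻¹ = η⁻¹ * ((w p.1.1 : ℝ≥0∞) ^ (-(σ - 1)) * (w p.2.1 : ℝ≥0∞) ^ (-(σ - 1))) *
            ‖p.1.1 - p.2.1‖ₑ ^ γ := by
          have hwp : ∀ (y : ℝ≥0) (r : ℝ), y ≠ 0 → (y : ℝ≥0∞) ^ r ≠ ∞ := by
            intro y r hy
            simp [ENNReal.rpow_eq_top_iff, hy]
          have hwp0 : ∀ (y : ℝ≥0) (r : ℝ), y ≠ 0 → (y : ℝ≥0∞) ^ r ≠ 0 := by
            intro y r hy
            simp [ENNReal.rpow_eq_zero_iff, hy]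
          have hA : η * ((w p.1.1 : ℝ≥0∞) ^ (σ - 1) * (w p.2.1 : ℝ≥0∞) ^ (σ - 1)) ≠ ∞ :=
            ENNReal.mul_ne_top hη (ENNReal.mul_ne_top (hwp _ _ hw1) (hwp _ _ hw2))
          have hA0 : η * ((w p.1.1 : ℝ≥0∞) ^ (σ - 1) * (w p.2.1 : ℝ≥0∞) ^ (σ - 1)) ≠ 0 :=
            mul_ne_zero hη0 (mul_ne_zero (hwp0 _ _ hw1) (hwp0 _ _ hw2))
          rw [hc, cutoff, ENNReal.mul_inv (Or.inl hA0) (Or.inl hA),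
            ENNReal.mul_inv (Or.inl hη0) (Or.inl hη),
            ENNReal.mul_inv (Or.inl (hwp0 _ _ hw1)) (Or.inl (hwp _ _ hw1)),
            ← ENNReal.rpow_neg, ← ENNReal.rpow_neg, ← ENNReal.rpow_neg, neg_neg]
        rw [hci]
        simp only [ENNReal.mul_rpow_of_nonneg _ _ he.le, ← ENNReal.rpow_mul, neg_mul]
        ring
    _ ≤ _ := by
        have hp : ∀ (y : ℝ≥0∞) (r : ℝ), y ≠ 0 → y ≠ ∞ → y ^ 2 * y ^ r = y ^ (2 + r) := by
          intro y r h1 h2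
          rw [ENNReal.rpow_add _ _ h1 h2]; norm_cast
        have hφ1' : (φ p.1 : ℝ≥0∞) ≠ 0 := by simpa using hφ1
        have hφ2' : (φ p.2 : ℝ≥0∞) ≠ 0 := by simpa using hφ2
        rw [hp _ _ hφ1' coe_ne_top, hp _ _ hφ2' coe_ne_top, hp _ _ hw1' coe_ne_top,
          hp _ _ hw2' coe_ne_top]
        have e1 : 2 + (β - 2) = β := by ring
        have e2 : 2 + -((σ - 1) * (β - 2)) = β - σ * (β - 2) := by ring
        rw [e1, e2]
        gcongr
        rcases eq_or_ne ‖p.1.1 - p.2.1‖ₑ 0 with h | h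
        · rw [h, ENNReal.zero_rpow_of_pos (by positivity : 0 < γ * (β - 2)), mul_zero]
          exact zero_le
        · rw [← ENNReal.rpow_add _ _ h (by finiteness)]
          apply le_of_eq
          congr 1; ring

theorem sum_kernelForm_rpow_le (n : ℕ) (hn : 1 ≤ n) {β : ℝ} (hβ : (n : ℝ) + 1 < β) :
    ∃ C : ℝ≥0∞, C ≠ ∞ ∧ ∀ (ε : ℝ), 0 < ε → ∀ (w : ℝ → ℝ≥0), Measurable w →
      ∫⁻ t, (w t : ℝ≥0∞) ^ (2 * β / (β - n)) ≤ 1 →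
      ∀ φ : SpaceTime n → ℝ≥0, Measurable φ → (∀ t, ∫⁻ x, (φ (t, x) : ℝ≥0∞) ^ β ≤ 1) →
      ∀ (ι : Type) [Fintype ι] [DecidableEq ι] (h : ι → SpaceTime n → ℂ), (∀ k, Measurable (h k)) →
      (∀ k, ∫⁻ z, ‖h k z‖ₑ ^ 2 ≤ 1) →
      (∀ j k, ∫ z, conj (h j z) * h k z = if j = k then 1 else 0) →
      (∀ k, Integrable (weighted w φ (h k))) →
      ∑ k, ‖∫ p, kernelForm ε (weighted w φ (h k)) p‖ₑ ^ β ≤ C := by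
  have hn1 : (1 : ℝ) ≤ n := by exact_mod_cast hn
  have hβ2 : 2 < β := by linarith
  have he : 0 < β - 2 := by linarith
  have hβn : 0 < β - n := by linarith
  obtain ⟨γ, hγl, hγr⟩ : ∃ γ, (n - 1 : ℝ) / (β - 2) < γ ∧ γ < min 1 (n / (β - 2)) := by
    refine exists_between (lt_min ?_ ?_)
    · rw [div_lt_one he]; linarith
    · gcongr; linarith
  have hγ : 0 < γ := lt_of_le_of_lt (div_nonneg (by linarith) he.le) hγl
  have hγ1 : γ < 1 := hγr.trans_le (min_le_left _ _)
  have hδ1 : n - γ * (β - 2) < 1 := by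
    rw [div_lt_iff₀ he] at hγl; linarith
  have hδ0 : 0 < n - γ * (β - 2) := by
    have := hγr.trans_le (min_le_right _ _)
    rw [lt_div_iff₀ he] at this; linarith
  set δ := n - γ * (β - 2) with hδ
  obtain ⟨C1, hC1, H1⟩ := hardy_littlewood_sobolev hγ hγ1
  obtain ⟨C2, hC2, H2⟩ := hardy_littlewood_sobolev hδ0 hδ1
  have hpl := plConst_ne_top (n := n)
  set κ := 2 * β / (β - n) with hκ
  have hκ0 : 0 < κ := by positivity
  set σ := κ / 2 * (1 - γ) with hσ
  set η : ℝ≥0∞ := (16 * plConst n * C1 + 1)⁻¹ with hη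
  have hη0 : η ≠ 0 := ENNReal.inv_ne_zero.2 (by finiteness)
  have hηt : η ≠ ∞ := ENNReal.inv_ne_top.2 (by simp)
  have hηC : 8 * plConst n * η * C1 ≤ 2⁻¹ := by
    have : 16 * plConst n * C1 * η ≤ 1 := by
      rw [hη, ← div_eq_mul_inv]
      exact ENNReal.div_le_of_le_mul (by rw [one_mul]; exact le_self_add)
    calc 8 * plConst n * η * C1 = 2⁻¹ * (16 * plConst n * C1 * η) := by
          have : (16 : ℝ≥0∞) = 2 * 8 := by norm_num
          rw [this, show 2⁻¹ * (2 * 8 * plConst n * C1 * η) =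
            (2⁻¹ * 2) * (8 * plConst n * η * C1) by ring,
            ENNReal.inv_mul_cancel (by norm_num) (by norm_num), one_mul]
      _ ≤ 2⁻¹ * 1 := by gcongr
      _ = _ := mul_one _
  have hexp : (β - σ * (β - 2)) * (2 / (2 - δ)) = κ := by
    have h2δ : 2 - δ ≠ 0 := by linarith
    have e : (β - σ * (β - 2)) = β * (2 - δ) / (β - n) := by
      rw [hσ, hκ, hδ]; field_simp; ring
    rw [e, hκ]; field_simp
  have hpos : 0 < β - σ * (β - 2) := by
    have h2δ : 0 < 2 / (2 - δ) := by apply div_pos <;> linarith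
    exact pos_of_mul_pos_left (hexp ▸ hκ0) h2δ.le
  set C0 : ℝ≥0∞ := ENNReal.ofReal (1 / (β - 2)) * ENNReal.ofReal (π ^ ((n : ℝ) / 2)) ^ 2 *
    η⁻¹ ^ (β - 2) with hC0
  have hC0t : C0 ≠ ∞ := by
    have : η⁻¹ ^ (β - 2) ≠ ∞ :=
      ENNReal.rpow_ne_top_of_nonneg he.le (ENNReal.inv_ne_top.2 hη0)
    finiteness
  refine ⟨ENNReal.ofReal β * 4 * (C0 * C2), by finiteness, ?_⟩
  intro ε hε w hw hw1 φ hφ hφ1 ι _ _ h hh hh1 ho hIntegrable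
  set Ω : ℝ → Set (SpaceTime n × SpaceTime n) :=
    fun s => nearSet (cutoff η σ γ w) φ (ENNReal.ofReal s) with hΩ
  have hΩm : ∀ s, MeasurableSet (Ω s) := fun s =>
    measurableSet_nearSet (measurable_cutoff η σ γ hw) hφ _
  have h1 := sum_rpow_le_lintegral hβ2 (fun k => ‖∫ p, kernelForm ε (weighted w φ (h k)) p‖ₑ)
    (fun k => enorm_ne_top) (fun s => ∫⁻ p in (Ω s)ᶜ, ‖weightedKernel ε w φ p‖ₑ ^ 2)
    (fun k s => ‖∫ p in (Ω s)ᶜ, kernelForm ε (weighted w φ (h k)) p‖ₑ)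
    (fun s _ => sum_enorm_setIntegral_kernelForm_sq_le ε hw hφ hh hh1 ho (hΩm s).compl)
    (by
      intro k s hs
      have hI := integrable_kernelForm hε (hIntegrable k)
      rw [← integral_add_compl (hΩm s) hI]
      refine (enorm_add_le _ _).trans ?_
      gcongr
      refine (enorm_setIntegral_nearSet_le hγ hγ1 hκ0 H1 hηt hε hw hw1 hφ (hh k) (hh1 k)
        (hIntegrable k) ENNReal.ofReal_ne_top).trans ?_
      calc 8 * plConst n * ENNReal.ofReal s * η * C1
          = ENNReal.ofReal s * (8 * plConst n * η * C1) := by ring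
        _ ≤ ENNReal.ofReal s * 2⁻¹ := by gcongr
        _ = _ := (div_eq_mul_inv _ _).symm)
  refine h1.trans ?_
  gcongr
  have hKm : Measurable fun p => ‖weightedKernel ε w φ p‖ₑ ^ 2 :=
    (measurable_weightedKernel ε hw hφ).enorm.pow_const 2
  have hjm : MeasurableSet {q : ℝ × (SpaceTime n × SpaceTime n) | q.2 ∈ (Ω q.1)ᶜ} := by
    have hΩ' : MeasurableSet {q : ℝ × (SpaceTime n × SpaceTime n) | q.2 ∈ Ω q.1} := by
      refine measurableSet_le ((measurable_two_zpow_levels hφ).comp measurable_snd)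
        (Measurable.mul ?_ ?_)
      · fun_prop
      · have : Measurable fun q : ℝ × (SpaceTime n × SpaceTime n) => (q.2.1.1, q.2.2.1) := by
          fun_prop
        exact (measurable_cutoff η σ γ hw).comp this
    exact hΩ'.compl
  have hfm : Measurable fun t => (w t : ℝ≥0∞) ^ (β - σ * (β - 2)) := by fun_prop
  calc ∫⁻ s in Ioi (0 : ℝ), ENNReal.ofReal (s ^ (β - 2 - 1)) *
        ∫⁻ p in (Ω s)ᶜ, ‖weightedKernel ε w φ p‖ₑ ^ 2
      = ∫⁻ s in Ioi (0 : ℝ), ∫⁻ p, ENNReal.ofReal (s ^ (β - 2 - 1)) *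
          (Ω s)ᶜ.indicator (fun p => ‖weightedKernel ε w φ p‖ₑ ^ 2) p := by
        refine lintegral_congr fun s => ?_
        rw [lintegral_const_mul' _ _ ENNReal.ofReal_ne_top, lintegral_indicator (hΩm s).compl]
    _ = ∫⁻ p, ∫⁻ s in Ioi (0 : ℝ), ENNReal.ofReal (s ^ (β - 2 - 1)) *
          (Ω s)ᶜ.indicator (fun p => ‖weightedKernel ε w φ p‖ₑ ^ 2) p := by
        refine lintegral_lintegral_swap (Measurable.aemeasurable ?_)
        refine Measurable.mul (by fun_prop) ?_
        exact (hKm.comp measurable_snd).indicator hjm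
    _ ≤ ∫⁻ p : SpaceTime n × SpaceTime n, C0 * ((φ p.1 : ℝ≥0∞) ^ β * (φ p.2 : ℝ≥0∞) ^ β *
          ((w p.1.1 : ℝ≥0∞) ^ (β - σ * (β - 2)) * (w p.2.1 : ℝ≥0∞) ^ (β - σ * (β - 2)) *
            ‖p.1.1 - p.2.1‖ₑ ^ (-δ))) :=
        lintegral_mono fun p => lintegral_far_le hε hβ2 hγ hη0 hηt p
    _ = C0 * ∫⁻ p : SpaceTime n × SpaceTime n, ((φ p.1 : ℝ≥0∞) ^ β * (φ p.2 : ℝ≥0∞) ^ β *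
          ((w p.1.1 : ℝ≥0∞) ^ (β - σ * (β - 2)) * (w p.2.1 : ℝ≥0∞) ^ (β - σ * (β - 2)) *
            ‖p.1.1 - p.2.1‖ₑ ^ (-δ))) := lintegral_const_mul' _ _ hC0t
    _ ≤ C0 * C2 := by
        gcongr
        refine (lintegral_prodComm4_le _).trans (le_trans ?_ (H2 _ hfm ?_))
        · refine lintegral_mono fun t => lintegral_mono fun t' => ?_
          dsimp only
          have hm : ∀ t, Measurable fun x : Rn n => (φ (t, x) : ℝ≥0∞) ^ β := fun t => by
            have : Measurable fun x : Rn n => φ (t, x) := hφ.comp measurable_prodMk_left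
            fun_prop
          set W := (w t : ℝ≥0∞) ^ (β - σ * (β - 2)) * (w t' : ℝ≥0∞) ^ (β - σ * (β - 2)) *
            ‖t - t'‖ₑ ^ (-δ)
          have hi : ∀ x, ∫⁻ x', (φ (t, x) : ℝ≥0∞) ^ β * (φ (t', x') : ℝ≥0∞) ^ β * W ≤
              (φ (t, x) : ℝ≥0∞) ^ β * W := by
            intro x
            calc _ = ∫⁻ x', ((φ (t, x) : ℝ≥0∞) ^ β * W) * (φ (t', x') : ℝ≥0∞) ^ β := by
                  refine lintegral_congr fun x' => by ring
              _ = ((φ (t, x) : ℝ≥0∞) ^ β * W) * ∫⁻ x', (φ (t', x') : ℝ≥0∞) ^ β :=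
                  lintegral_const_mul _ (hm t')
              _ ≤ ((φ (t, x) : ℝ≥0∞) ^ β * W) * 1 := by gcongr; exact hφ1 t'
              _ = _ := mul_one _
          calc _ ≤ ∫⁻ x, (φ (t, x) : ℝ≥0∞) ^ β * W := lintegral_mono hi
            _ = (∫⁻ x, (φ (t, x) : ℝ≥0∞) ^ β) * W := lintegral_mul_const _ (hm t)
            _ ≤ 1 * W := by gcongr; exact hφ1 t
            _ = W := one_mul _
        · calc _ = ∫⁻ t, (w t : ℝ≥0∞) ^ κ := by
                refine lintegral_congr fun t => ?_
                rw [← ENNReal.rpow_mul, hexp]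
            _ ≤ 1 := hw1
            _ ≤ 2 := by norm_num

/-- Linear combinations of a finite family of functions with coefficients from a matrix column. -/
def mix {X ι : Type*} [Fintype ι] (U : Matrix ι ι ℂ) (g : ι → X → ℂ) (l : ι) (x : X) : ℂ :=
  ∑ j, U j l * g j x

/-- The Gram matrix of a finite family of functions. -/
def gramMatrix {X ι : Type*} [MeasurableSpace X] (μ : Measure X) (g : ι → X → ℂ) :
    Matrix ι ι ℂ :=
  Matrix.of fun j k => ∫ x, conj (g j x) * g k x ∂μ

lemma integrable_conj_mul {X : Type*} [MeasurableSpace X] {μ : Measure X} {f g : X → ℂ}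
    (hf : MemLp f 2 μ) (hg : MemLp g 2 μ) : Integrable (fun x => conj (f x) * g x) μ := by
  have h1 : MemLp (fun x => conj (f x)) 2 μ :=
    hf.of_le (Complex.continuous_conj.comp_aestronglyMeasurable hf.1)
      (Filter.Eventually.of_forall fun x => by simp)
  exact h1.integrable_mul hg

lemma integral_conj_mix_mul_mix {X ι : Type*} [MeasurableSpace X] {μ : Measure X} [Fintype ι]
    (U : Matrix ι ι ℂ) {g : ι → X → ℂ} (hg : ∀ j, MemLp (g j) 2 μ) (l m : ι) :
    ∫ x, conj (mix U g l x) * mix U g m x ∂μ = (star U * gramMatrix μ g * U) l m := by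
  have h : ∀ x, conj (mix U g l x) * mix U g m x =
      ∑ k, ∑ j, conj (U j l) * U k m * (conj (g j x) * g k x) := by
    intro x
    simp only [mix, map_sum, map_mul, Finset.sum_mul, Finset.mul_sum]
    refine Finset.sum_congr rfl fun k _ => Finset.sum_congr rfl fun j _ => ?_
    ring
  have hi : ∀ j k, Integrable (fun x => conj (U j l) * U k m * (conj (g j x) * g k x)) μ :=
    fun j k => (integrable_conj_mul (hg j) (hg k)).const_mul _
  simp_rw [h]
  rw [integral_finsetSum _ fun k _ => integrable_finsetSum _ fun j _ => hi j k]
  simp_rw [integral_finsetSum _ fun j _ => hi j _, integral_const_mul]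
  simp only [Matrix.mul_apply, Finset.sum_mul, Matrix.star_apply, gramMatrix, Matrix.of_apply]
  refine Finset.sum_congr rfl fun k _ => Finset.sum_congr rfl fun j _ => ?_
  simp only [RCLike.star_def]
  ring

lemma memLp_mix {X ι : Type*} [MeasurableSpace X] {μ : Measure X} [Fintype ι]
    (U : Matrix ι ι ℂ) {g : ι → X → ℂ} {p : ℝ≥0∞} (hg : ∀ j, MemLp (g j) p μ) (l : ι) :
    MemLp (mix U g l) p μ := by
  have : mix U g l = fun x => ∑ j, U j l * g j x := rfl
  rw [this]
  exact memLp_finsetSum _ fun j _ => (hg j).const_mul _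

lemma exists_unitary_mix {X ι : Type*} [MeasurableSpace X] {μ : Measure X} [Fintype ι]
    [DecidableEq ι] {g : ι → X → ℂ} (hg : ∀ j, MemLp (g j) 2 μ) :
    ∃ U ∈ Matrix.unitaryGroup ι ℂ, ∃ d : ι → ℝ,
      (∀ l m, ∫ x, conj (mix U g l x) * mix U g m x ∂μ = if l = m then (d l : ℂ) else 0) ∧
      ∀ j, ∫ x, conj (g j x) * g j x ∂μ = ((∑ l, ‖U j l‖ ^ 2 * d l : ℝ) : ℂ) := by
  have hA : (gramMatrix μ g).IsHermitian := by
    ext j k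
    simp only [gramMatrix, Matrix.conjTranspose_apply, Matrix.of_apply, RCLike.star_def]
    rw [← integral_conj]
    refine integral_congr_ae (Filter.Eventually.of_forall fun x => ?_)
    simp only [map_mul, Complex.conj_conj]
    ring
  refine ⟨hA.eigenvectorUnitary, hA.eigenvectorUnitary.2, hA.eigenvalues, ?_, ?_⟩
  · intro l m
    rw [integral_conj_mix_mul_mix _ hg]
    have h := hA.conjStarAlgAut_star_eigenvectorUnitary
    rw [Unitary.conjStarAlgAut_apply] at h
    simp only [Unitary.coe_star, star_star] at h
    rw [h, Matrix.diagonal_apply]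
    rfl
  · intro j
    have h := congrFun (congrFun hA.spectral_theorem j) j
    rw [Unitary.conjStarAlgAut_apply] at h
    change gramMatrix μ g j j = _
    rw [h]
    simp only [Matrix.mul_apply, Matrix.diagonal_apply, Matrix.star_apply, mul_ite, mul_zero,
      Finset.sum_ite_eq', Finset.mem_univ, if_true, Function.comp, RCLike.star_def]
    push_cast
    refine Finset.sum_congr rfl fun l _ => ?_
    rw [← Complex.conj_mul']
    simp only [Complex.coe_algebraMap]
    ring_nf

lemma sum_norm_sq_row {ι : Type*} [Fintype ι] [DecidableEq ι] {U : Matrix ι ι ℂ}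
    (hU : U ∈ Matrix.unitaryGroup ι ℂ) (j : ι) : ∑ l, ‖U j l‖ ^ 2 = 1 := by
  have h := congrFun (congrFun (Matrix.mem_unitaryGroup_iff.1 hU) j) j
  simp only [Matrix.mul_apply, Matrix.star_apply, RCLike.star_def, Complex.mul_conj',
    Matrix.one_apply_eq] at h
  exact_mod_cast h

lemma sum_norm_sq_col {ι : Type*} [Fintype ι] [DecidableEq ι] {U : Matrix ι ι ℂ}
    (hU : U ∈ Matrix.unitaryGroup ι ℂ) (l : ι) : ∑ j, ‖U j l‖ ^ 2 = 1 := by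
  have h := congrFun (congrFun (Matrix.mem_unitaryGroup_iff'.1 hU) l) l
  simp only [Matrix.mul_apply, Matrix.star_apply, RCLike.star_def, Complex.conj_mul',
    Matrix.one_apply_eq] at h
  exact_mod_cast h

lemma gramMatrix_mix_eq {X ι : Type*} [MeasurableSpace X] {μ : Measure X} [Fintype ι]
    [DecidableEq ι] {U : Matrix ι ι ℂ} (hU : U ∈ Matrix.unitaryGroup ι ℂ) {g : ι → X → ℂ}
    (hg : ∀ j, MemLp (g j) 2 μ)
    (ho : ∀ j k, ∫ x, conj (g j x) * g k x ∂μ = if j = k then 1 else 0) (l m : ι) :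
    ∫ x, conj (mix U g l x) * mix U g m x ∂μ = if l = m then 1 else 0 := by
  have h1 : gramMatrix μ g = 1 := by
    ext j k
    simp [gramMatrix, ho, Matrix.one_apply]
  rw [integral_conj_mix_mul_mix U hg, h1, mul_one, Matrix.mem_unitaryGroup_iff'.1 hU,
    Matrix.one_apply]

/-- The space-time phase `e^{i(t|ξ|² - x·ξ)}`. -/
def phase (z : SpaceTime n) (ξ : Rn n) : ℂ :=
  Complex.exp (Complex.I * ((z.1 : ℂ) * (‖ξ‖ : ℂ) ^ 2 - dotC z.2 ξ))

lemma measurable_phase : Measurable (Function.uncurry (phase (n := n))) := by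
  have := continuous_dotC (n := n)
  have h2 : Continuous fun z : SpaceTime n × Rn n => dotC z.1.2 z.2 :=
    this.comp (f := fun z : SpaceTime n × Rn n => (z.1.2, z.2)) (by fun_prop)
  exact (by fun_prop : Continuous fun z : SpaceTime n × Rn n =>
    Complex.exp (Complex.I * ((z.1.1 : ℂ) * (‖z.2‖ : ℂ) ^ 2 - dotC z.1.2 z.2))).measurable

lemma norm_phase (z : SpaceTime n) (ξ : Rn n) : ‖phase z ξ‖ = 1 := by
  have := norm_cexp_I_mul_ofReal_eq (z.1 * ‖ξ‖ ^ 2 - inner ℝ z.2 ξ)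
  rw [phase, dotC_eq_inner]
  push_cast at this
  exact this

lemma conj_phase (z : SpaceTime n) (ξ : Rn n) :
    conj (phase z ξ) = Complex.exp (Complex.I * (dotC z.2 ξ - (z.1 : ℂ) * (‖ξ‖ : ℂ) ^ 2)) := by
  rw [phase, ← Complex.exp_conj, dotC_eq_inner]
  simp only [map_mul, map_sub, map_pow, Complex.conj_I, Complex.conj_ofReal]
  congr 1
  ring

lemma measurable_conj_phase :
    Measurable (Function.uncurry fun (z : SpaceTime n) ξ => conj (phase z ξ)) :=
  Complex.continuous_conj.measurable.comp measurable_phase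

lemma schrodinger_eq (f : Rn n → ℂ) (z : SpaceTime n) :
    schrodinger f z.1 z.2 =
      (((2 * π) ^ (-(n : ℝ)) : ℝ) : ℂ) * ∫ ξ, conj (phase z ξ) * FT f ξ := by
  simp only [schrodinger, prop, one_mul, conj_phase, Complex.real_smul]

lemma integrable_conj_phase_mul {f : Rn n → ℂ} (hf : Integrable f) (z : SpaceTime n) :
    Integrable fun ξ => conj (phase z ξ) * f ξ := by
  refine hf.bdd_mul (c := 1) ?_ (Filter.Eventually.of_forall fun ξ => ?_)
  · have : Measurable fun ξ => conj (phase z ξ) :=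
      measurable_conj_phase.of_uncurry_left
    exact this.aestronglyMeasurable
  · simp [norm_phase]

lemma enorm_schrodinger_le (f : Rn n → ℂ) (z : SpaceTime n) :
    ‖schrodinger f z.1 z.2‖ₑ ≤ ENNReal.ofReal ((2 * π) ^ (-(n : ℝ))) * ∫⁻ ξ, ‖FT f ξ‖ₑ := by
  rw [schrodinger_eq, enorm_mul]
  gcongr
  · rw [← ofReal_norm, Complex.norm_real, Real.norm_of_nonneg (by positivity)]
  · refine (enorm_integral_le_lintegral_enorm _).trans_eq (lintegral_congr fun ξ => ?_)
    have : ‖conj (phase z ξ)‖ₑ = 1 := by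
      rw [← ofReal_norm, RCLike.norm_conj, norm_phase, ENNReal.ofReal_one]
    rw [enorm_mul, this, one_mul]

/-- Data for which the propagator is given by a convergent integral. -/
structure IsGood (f : Rn n → ℂ) : Prop where
  integrable : Integrable f
  memLp : MemLp f 2
  integrable_FT : Integrable (FT f)

lemma IsGood.measurable_FT {f : Rn n → ℂ} (hf : IsGood f) : Measurable (FT f) :=
  (stronglyMeasurable_FT hf.integrable).measurable

lemma IsGood.measurable_schrodinger {f : Rn n → ℂ} (hf : IsGood f) :
    Measurable fun z : SpaceTime n => schrodinger f z.1 z.2 := by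
  simp_rw [schrodinger_eq]
  refine Measurable.const_mul ?_ _
  have : StronglyMeasurable (Function.uncurry fun (z : SpaceTime n) ξ =>
      conj (phase z ξ) * FT f ξ) :=
    (measurable_conj_phase.mul (hf.measurable_FT.comp measurable_snd)).stronglyMeasurable
  exact this.integral_prod_right.measurable

lemma FT_mix {ι : Type*} [Fintype ι] (U : Matrix ι ι ℂ) {f : ι → Rn n → ℂ}
    (hf : ∀ j, Integrable (f j)) (l : ι) : FT (mix U f l) = mix U (fun j => FT (f j)) l := by
  ext ξ
  have hi : ∀ j, Integrable fun x => Complex.exp (-(Complex.I * dotC x ξ)) * f j x := by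
    intro j
    refine (hf j).bdd_mul (c := 1) ?_ (Filter.Eventually.of_forall fun x => ?_)
    · have : Measurable fun x : Rn n => Complex.exp (-(Complex.I * dotC x ξ)) :=
        measurable_fourier_exp.of_uncurry_right
      exact this.aestronglyMeasurable
    · rw [norm_fourier_exp]
  simp only [FT, mix, Finset.mul_sum]
  simp_rw [← mul_assoc, mul_comm _ (U _ l), mul_assoc]
  rw [integral_finsetSum _ fun j _ => (hi j).const_mul _]
  simp_rw [integral_const_mul]

lemma isGood_mix {ι : Type*} [Fintype ι] (U : Matrix ι ι ℂ) {f : ι → Rn n → ℂ}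
    (hf : ∀ j, IsGood (f j)) (l : ι) : IsGood (mix U f l) where
  integrable := memLp_one_iff_integrable.1
    (memLp_mix U (fun j => memLp_one_iff_integrable.2 (hf j).integrable) l)
  memLp := memLp_mix U (fun j => (hf j).memLp) l
  integrable_FT := by
    rw [FT_mix U fun j => (hf j).integrable]
    exact memLp_one_iff_integrable.1
      (memLp_mix U (fun j => memLp_one_iff_integrable.2 (hf j).integrable_FT) l)

lemma schrodinger_mix {ι : Type*} [Fintype ι] (U : Matrix ι ι ℂ) {f : ι → Rn n → ℂ}
    (hf : ∀ j, IsGood (f j)) (l : ι) (z : SpaceTime n) :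
    schrodinger (mix U f l) z.1 z.2 =
      mix U (fun j (z : SpaceTime n) => schrodinger (f j) z.1 z.2) l z := by
  rw [schrodinger_eq, FT_mix U fun j => (hf j).integrable]
  simp only [mix, schrodinger_eq, Finset.mul_sum]
  simp_rw [← mul_assoc, mul_comm _ (U _ l), mul_assoc]
  rw [integral_finsetSum _ fun j _ =>
    (integrable_conj_phase_mul (hf j).integrable_FT z).const_mul _]
  simp_rw [integral_const_mul, Finset.mul_sum]
  refine Finset.sum_congr rfl fun j _ => ?_
  ring

/-- The adjoint of the free evolution on the Fourier side. -/
def waveFT (g : SpaceTime n → ℂ) (ξ : Rn n) : ℂ := ∫ z, phase z ξ * g z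

lemma stronglyMeasurable_waveFT {g : SpaceTime n → ℂ} (hg : Integrable g) :
    StronglyMeasurable (waveFT g) := by
  have h : waveFT g = waveFT (hg.1.mk g) := by
    ext ξ
    refine integral_congr_ae ?_
    filter_upwards [hg.1.ae_eq_mk] with x hx
    rw [hx]
  rw [h]
  have h2 : StronglyMeasurable (Function.uncurry fun (ξ : Rn n) (z : SpaceTime n) =>
      phase z ξ * hg.1.mk g z) :=
    ((measurable_phase.comp measurable_swap).mul
      (hg.1.stronglyMeasurable_mk.measurable.comp measurable_snd)).stronglyMeasurable
  exact h2.integral_prod_right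

lemma integral_gauss_waveFT {ε : ℝ} (hε : 0 < ε) {g : SpaceTime n → ℂ} (hg : Integrable g) :
    ∫ ξ : Rn n, (Real.exp (-ε * ‖ξ‖ ^ 2) : ℂ) * (conj (waveFT g ξ) * waveFT g ξ) =
      ∫ p, kernelForm ε g p := by
  have := integral_gram (integrable_gauss (n := n) hε).ofReal (measurable_phase (n := n))
    (fun x ξ => (norm_phase x ξ).le) hg hg
  refine this.trans (integral_congr_ae (Filter.Eventually.of_forall fun z => ?_))
  simp only [kernelForm]
  rw [gaussKernel_sub]
  rfl

lemma lintegral_gauss_waveFT {ε : ℝ} (hε : 0 < ε) {g : SpaceTime n → ℂ} (hg : Integrable g) :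
    ∫⁻ ξ : Rn n, ENNReal.ofReal (Real.exp (-ε * ‖ξ‖ ^ 2)) * ‖waveFT g ξ‖ₑ ^ 2 =
      ‖∫ p, kernelForm ε g p‖ₑ := by
  have hm := (stronglyMeasurable_waveFT hg).measurable
  have hb : ∀ ξ, ‖waveFT g ξ‖ ≤ ∫ z, ‖g z‖ := fun ξ => by
    refine (norm_integral_le_integral_norm _).trans_eq ?_
    simp [norm_phase]
  have hIntegrable : Integrable fun ξ : Rn n => Real.exp (-ε * ‖ξ‖ ^ 2) * ‖waveFT g ξ‖ ^ 2 := by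
    refine (integrable_gauss hε).mul_bdd (c := (∫ x, ‖g x‖) ^ 2)
      (by fun_prop) (Filter.Eventually.of_forall fun ξ => ?_)
    rw [norm_pow, norm_norm]
    gcongr
    exact hb ξ
  have h1 : ∫ p, kernelForm ε g p =
      ((∫ ξ : Rn n, Real.exp (-ε * ‖ξ‖ ^ 2) * ‖waveFT g ξ‖ ^ 2 : ℝ) : ℂ) := by
    rw [← integral_gauss_waveFT hε hg, ← integral_complex_ofReal]
    refine integral_congr_ae (Filter.Eventually.of_forall fun ξ => ?_)
    simp only [Complex.conj_mul']
    push_cast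
    rfl
  rw [h1, ← ofReal_norm, Complex.norm_real, Real.norm_of_nonneg (by positivity),
    ofReal_integral_eq_lintegral_ofReal hIntegrable (Filter.Eventually.of_forall fun ξ => by positivity)]
  refine lintegral_congr fun ξ => ?_
  rw [ENNReal.ofReal_mul (by positivity), ENNReal.ofReal_pow (by positivity), ofReal_norm]

/-- The constant in the duality between the propagator and its adjoint. -/
def dualConst (n : ℕ) : ℝ≥0∞ := ENNReal.ofReal ((2 * π) ^ (-(n : ℝ))) ^ 2 * plConst n

lemma dualConst_ne_top : dualConst n ≠ ∞ := by
  have := plConst_ne_top (n := n)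
  unfold dualConst
  finiteness

lemma enorm_integral_conj_mul_schrodinger_sq_le {f : Rn n → ℂ} (hf : IsGood f)
    {g : SpaceTime n → ℂ} (hg : Integrable g) :
    ‖∫ z, conj (g z) * schrodinger f z.1 z.2‖ₑ ^ 2 ≤
      dualConst n * (∫⁻ x, ‖f x‖ₑ ^ 2) * ∫⁻ ξ, ‖waveFT g ξ‖ₑ ^ 2 := by
  have hF := hf.integrable_FT
  have hgc : Integrable (fun z => conj (g z)) :=
    hg.norm.congr' (Complex.continuous_conj.comp_aestronglyMeasurable
        hg.aestronglyMeasurable) (by simp)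
  have hI : Integrable (Function.uncurry fun (z : SpaceTime n) ξ =>
      conj (phase z ξ) * (conj (g z) * FT f ξ)) (volume.prod volume) := by
    refine (hgc.mul_prod hF).bdd_mul (c := 1) measurable_conj_phase.aestronglyMeasurable
      (Filter.Eventually.of_forall fun p => ?_)
    simp [norm_phase]
  have e : ∫ z, conj (g z) * schrodinger f z.1 z.2 =
      (((2 * π) ^ (-(n : ℝ)) : ℝ) : ℂ) * ∫ ξ, FT f ξ * conj (waveFT g ξ) := by
    calc _ = (((2 * π) ^ (-(n : ℝ)) : ℝ) : ℂ) *
          ∫ z : SpaceTime n, ∫ ξ, conj (phase z ξ) * (conj (g z) * FT f ξ) := by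
          rw [← integral_const_mul]
          refine integral_congr_ae (Filter.Eventually.of_forall fun z => ?_)
          simp only [schrodinger_eq]
          rw [mul_left_comm, ← integral_const_mul]
          congr 2
          ext ξ
          ring
      _ = _ := by
          rw [integral_integral_swap hI]
          congr 2
          ext ξ
          rw [waveFT, ← integral_conj, ← integral_const_mul]
          congr 1
          ext z
          simp only [map_mul]
          ring
  have hCS : ‖∫ ξ, FT f ξ * conj (waveFT g ξ)‖ₑ ^ 2 ≤
      (∫⁻ ξ, ‖FT f ξ‖ₑ ^ 2) * ∫⁻ ξ, ‖waveFT g ξ‖ₑ ^ 2 := by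
    have hm := (stronglyMeasurable_waveFT hg).measurable
    have h1 : ‖∫ ξ, FT f ξ * conj (waveFT g ξ)‖ₑ ≤
        (∫⁻ ξ, ‖FT f ξ‖ₑ ^ 2) ^ (1 / 2 : ℝ) * (∫⁻ ξ, ‖waveFT g ξ‖ₑ ^ 2) ^ (1 / 2 : ℝ) := by
      refine (enorm_integral_le_lintegral_enorm _).trans ?_
      refine le_trans (le_of_eq ?_) (lintegral_mul_le_sqrt volume
        hf.measurable_FT.enorm.aemeasurable hm.enorm.aemeasurable)
      refine lintegral_congr fun ξ => ?_
      rw [enorm_mul, enorm_conj]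
    have hs : ∀ y : ℝ≥0∞, (y ^ (1 / 2 : ℝ)) ^ 2 = y := fun y => by
      rw [← ENNReal.rpow_natCast, ← ENNReal.rpow_mul]; norm_num
    calc _ ≤ ((∫⁻ ξ, ‖FT f ξ‖ₑ ^ 2) ^ (1 / 2 : ℝ) *
          (∫⁻ ξ, ‖waveFT g ξ‖ₑ ^ 2) ^ (1 / 2 : ℝ)) ^ 2 := by gcongr
      _ = _ := by rw [mul_pow, hs, hs]
  rw [e, enorm_mul, mul_pow, dualConst]
  calc _ ≤ ENNReal.ofReal ((2 * π) ^ (-(n : ℝ))) ^ 2 *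
        ((plConst n * ∫⁻ x, ‖f x‖ₑ ^ 2) * ∫⁻ ξ, ‖waveFT g ξ‖ₑ ^ 2) := by
        gcongr
        · rw [← ofReal_norm, Complex.norm_real, Real.norm_of_nonneg (by positivity)]
        · refine hCS.trans ?_
          gcongr
          exact lintegral_FT_sq_le hf.integrable
    _ = _ := by ring

lemma integral_conj_mul_self {X : Type*} [MeasurableSpace X] {μ : Measure X} (f : X → ℂ) :
    ∫ x, conj (f x) * f x ∂μ = ((∫ x, ‖f x‖ ^ 2 ∂μ : ℝ) : ℂ) := by
  rw [← integral_complex_ofReal]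
  refine integral_congr_ae (Filter.Eventually.of_forall fun x => ?_)
  simp only [Complex.conj_mul']
  push_cast
  rfl

lemma lintegral_enorm_sq_eq {X : Type*} [MeasurableSpace X] {μ : Measure X} {f : X → ℂ}
    (hf : MemLp f 2 μ) :
    ∫⁻ x, ‖f x‖ₑ ^ 2 ∂μ = ENNReal.ofReal (∫ x, ‖f x‖ ^ 2 ∂μ) := by
  rw [ofReal_integral_eq_lintegral_ofReal ((memLp_two_iff_integrable_sq_norm hf.1).1 hf)
    (Filter.Eventually.of_forall fun x => by positivity)]
  refine lintegral_congr fun x => ?_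
  rw [ENNReal.ofReal_pow (norm_nonneg _), ofReal_norm]

lemma sum_lintegral_rpow_le_of_gauss {ι : Type} [Fintype ι] {β : ℝ}
    {u : ι → Rn n → ℝ≥0∞} (hu : ∀ k, Measurable (u k)) {C : ℝ≥0∞}
    (h : ∀ ε : ℝ, 0 < ε →
      ∑ k, (∫⁻ ξ, ENNReal.ofReal (Real.exp (-ε * ‖ξ‖ ^ 2)) * u k ξ) ^ β ≤ C) :
    ∑ k, (∫⁻ ξ, u k ξ) ^ β ≤ C := by
  have hε : ∀ m : ℕ, 0 < 1 / ((m : ℝ) + 1) := fun m => by positivity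
  have hlim : ∀ k, Filter.Tendsto (fun m : ℕ =>
      ∫⁻ ξ, ENNReal.ofReal (Real.exp (-(1 / ((m : ℝ) + 1)) * ‖ξ‖ ^ 2)) * u k ξ)
      Filter.atTop (nhds (∫⁻ ξ, u k ξ)) := by
    intro k
    refine lintegral_tendsto_of_tendsto_of_monotone (fun m => ?_)
      (Filter.Eventually.of_forall fun ξ => ?_) (Filter.Eventually.of_forall fun ξ => ?_)
    · have := hu k
      fun_prop
    · intro m m' hm
      dsimp only
      gcongr
    · have h0 := tendsto_one_div_add_atTop_nhds_zero_nat (𝕜 := ℝ)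
      have h1 : Filter.Tendsto (fun m : ℕ => Real.exp (-(1 / ((m : ℝ) + 1)) * ‖ξ‖ ^ 2))
          Filter.atTop (nhds 1) := by
        have := (Real.continuous_exp.tendsto _).comp ((h0.neg).mul_const (‖ξ‖ ^ 2))
        simpa [Function.comp_def] using this
      have h2 := ENNReal.Tendsto.mul_const (b := u k ξ) (ENNReal.tendsto_ofReal h1)
        (Or.inl (by simp))
      simpa using h2
  refine le_of_tendsto' (tendsto_finsetSum _ fun k _ => (hlim k).ennrpow_const β) fun m => ?_
  exact h _ (hε m)

lemma sum_mul_sum_le {ι : Type} [Fintype ι] [DecidableEq ι] {U : Matrix ι ι ℂ}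
    (hU : U ∈ Matrix.unitaryGroup ι ℂ) {α β : ℝ} (hα : 0 < α) (hβ : 0 < β)
    (hαβ : 1 / α + 1 / β = 1) (a d : ι → ℝ≥0∞) :
    ∑ j, a j * ∑ l, ENNReal.ofReal (‖U j l‖ ^ 2) * d l ≤ ∑ j, a j ^ α + ∑ l, d l ^ β := by
  have hr : ∀ j, ∑ l, ENNReal.ofReal (‖U j l‖ ^ 2) = 1 := fun j => by
    rw [← ENNReal.ofReal_sum_of_nonneg fun l _ => by positivity, sum_norm_sq_row hU,
      ENNReal.ofReal_one]
  have hc : ∀ l, ∑ j, ENNReal.ofReal (‖U j l‖ ^ 2) = 1 := fun l => by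
    rw [← ENNReal.ofReal_sum_of_nonneg fun l _ => by positivity, sum_norm_sq_col hU,
      ENNReal.ofReal_one]
  have hy : ∀ x y : ℝ≥0∞, x * y ≤ x ^ α + y ^ β := by
    intro x y
    have := rpow_mul_rpow_le_add (x := x ^ α) (y := y ^ β) (a := 1 / α) (b := 1 / β)
      (by positivity) (by positivity) hαβ
    rwa [← ENNReal.rpow_mul, ← ENNReal.rpow_mul, mul_one_div_cancel hα.ne',
      mul_one_div_cancel hβ.ne', ENNReal.rpow_one, ENNReal.rpow_one] at this
  calc _ = ∑ j, ∑ l, ENNReal.ofReal (‖U j l‖ ^ 2) * (a j * d l) := by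
        refine Finset.sum_congr rfl fun j _ => ?_
        rw [Finset.mul_sum]
        refine Finset.sum_congr rfl fun l _ => by ring
    _ ≤ ∑ j, ∑ l, ENNReal.ofReal (‖U j l‖ ^ 2) * (a j ^ α + d l ^ β) := by
        gcongr with j _ l _
        exact hy _ _
    _ = (∑ j, (∑ l, ENNReal.ofReal (‖U j l‖ ^ 2)) * a j ^ α) +
        ∑ l, (∑ j, ENNReal.ofReal (‖U j l‖ ^ 2)) * d l ^ β := by
        simp_rw [mul_add, Finset.sum_add_distrib, Finset.sum_mul]
        congr 1
        exact Finset.sum_comm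
    _ = _ := by simp_rw [hr, hc, one_mul]

theorem sum_lintegral_weight_le (n : ℕ) (hn : 1 ≤ n) {α β : ℝ} (hβ : (n : ℝ) + 1 < β)
    (hα : 0 < α) (hαβ : 1 / α + 1 / β = 1) :
    ∃ C : ℝ≥0∞, C ≠ ∞ ∧ ∀ (w : ℝ → ℝ≥0), Measurable w →
      ∫⁻ t, (w t : ℝ≥0∞) ^ (2 * β / (β - n)) ≤ 1 →
      ∀ φ : SpaceTime n → ℝ≥0, Measurable φ → (∀ t, ∫⁻ x, (φ (t, x) : ℝ≥0∞) ^ β ≤ 1) →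
      ∫⁻ z : SpaceTime n, ((w z.1 * φ z : ℝ≥0∞)) ^ 2 ≠ ∞ →
      ∀ (ι : Type) [Fintype ι] [DecidableEq ι] (f : ι → Rn n → ℂ), (∀ j, IsGood (f j)) →
      (∀ j k, ∫ x, conj (f j x) * f k x = if j = k then 1 else 0) →
      ∀ a : ι → ℝ≥0∞, ∑ j, a j ^ α ≤ 1 →
      ∑ j, a j * ∫⁻ z : SpaceTime n,
        (w z.1 * φ z : ℝ≥0∞) ^ 2 * ‖schrodinger (f j) z.1 z.2‖ₑ ^ 2 ≤ C := by
  obtain ⟨C, hC, H⟩ := sum_kernelForm_rpow_le n hn hβ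
  have hn1 : (1 : ℝ) ≤ n := by exact_mod_cast hn
  have hβ0 : 0 < β := by linarith
  have hdc := dualConst_ne_top (n := n)
  have hdcβ : dualConst n ^ β ≠ ∞ := ENNReal.rpow_ne_top_of_nonneg hβ0.le hdc
  refine ⟨1 + dualConst n ^ β * C, by finiteness, ?_⟩
  intro w hw hw1 φ hφ hφ1 hW ι _ _ f hf ho a ha
  have hWm : Measurable fun z : SpaceTime n => (((w z.1 * φ z : ℝ≥0) : ℝ) : ℂ) := by
    have hc : Measurable fun y : ℝ≥0 => ((y : ℝ) : ℂ) := by fun_prop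
    have h1 : Measurable fun z : SpaceTime n => w z.1 * φ z := by fun_prop
    exact hc.comp h1
  have hWLp : MemLp (fun z : SpaceTime n => (((w z.1 * φ z : ℝ≥0) : ℝ) : ℂ)) 2 := by
    refine ⟨hWm.aestronglyMeasurable, ?_⟩
    rw [eLpNorm_lt_top_iff_lintegral_rpow_enorm_lt_top (by norm_num) (by norm_num)]
    refine lt_of_eq_of_lt (lintegral_congr fun z => ?_) hW.lt_top
    rw [enorm_coe_nnreal]
    simp
  have hwm : ∀ {h : SpaceTime n → ℂ}, Measurable h → Measurable (weighted w φ h) :=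
    fun hh => hWm.mul hh
  set g : ι → SpaceTime n → ℂ := fun j => weighted w φ fun z => schrodinger (f j) z.1 z.2 with hg
  have hgm : ∀ j, Measurable (g j) := fun j => hwm (hf j).measurable_schrodinger
  have hgLp : ∀ j, MemLp (g j) 2 := by
    intro j
    refine ⟨(hgm j).aestronglyMeasurable, ?_⟩
    rw [eLpNorm_lt_top_iff_lintegral_rpow_enorm_lt_top (by norm_num) (by norm_num)]
    set B := ENNReal.ofReal ((2 * π) ^ (-(n : ℝ))) * ∫⁻ ξ, ‖FT (f j) ξ‖ₑ with hB
    have hBt : B ≠ ∞ := ENNReal.mul_ne_top (by finiteness) (hf j).integrable_FT.2.ne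
    calc _ ≤ ∫⁻ z : SpaceTime n, B ^ 2 * (w z.1 * φ z : ℝ≥0∞) ^ 2 := by
          refine lintegral_mono fun z => ?_
          have := enorm_schrodinger_le (f j) z
          rw [hg]
          simp only [enorm_weighted, ENNReal.toReal_ofNat, ENNReal.rpow_ofNat]
          rw [mul_pow, mul_comm]
          gcongr
      _ = B ^ 2 * ∫⁻ z : SpaceTime n, (w z.1 * φ z : ℝ≥0∞) ^ 2 :=
          lintegral_const_mul' _ _ (by finiteness)
      _ < ∞ := by
          have := hW.lt_top
          exact ENNReal.mul_lt_top (by finiteness) this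
  obtain ⟨U, hU, d, hd1, hd2⟩ := exists_unitary_mix hgLp
  set F : ι → Rn n → ℂ := mix U f with hF
  have hFg : ∀ l, IsGood (F l) := isGood_mix U hf
  have hmix : ∀ l, mix U g l = weighted w φ fun z => schrodinger (F l) z.1 z.2 := by
    intro l
    ext z
    simp only [hg, weighted, hF, schrodinger_mix U hf l z, mix, Finset.mul_sum]
    refine Finset.sum_congr rfl fun j _ => by ring
  have hmixLp : ∀ l, MemLp (mix U g l) 2 := memLp_mix U hgLp
  have hmixm : ∀ l, Measurable (mix U g l) := fun l => by
    rw [hmix]; exact hwm (hFg l).measurable_schrodinger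
  have hd : ∀ l, d l = ∫ z, ‖mix U g l z‖ ^ 2 := by
    intro l
    have := hd1 l l
    rw [if_pos rfl, integral_conj_mul_self] at this
    exact_mod_cast this.symm
  have hd0 : ∀ l, 0 ≤ d l := fun l => by
    rw [hd]; exact integral_nonneg fun z => by positivity
  have hF1 : ∀ l, ∫⁻ x, ‖F l x‖ₑ ^ 2 = 1 := by
    intro l
    have h := gramMatrix_mix_eq hU (fun j => (hf j).memLp) ho l l
    rw [if_pos rfl, integral_conj_mul_self] at h
    rw [lintegral_enorm_sq_eq (hFg l).memLp]
    have h' : ∫ x, ‖F l x‖ ^ 2 = 1 := by exact_mod_cast h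
    rw [h', ENNReal.ofReal_one]
  let P := {l : ι // 0 < d l}
  set h : P → SpaceTime n → ℂ := fun l z => (((√(d l))⁻¹ : ℝ) : ℂ) * mix U g l z with hh
  have hhm : ∀ l, Measurable (h l) := fun l => (hmixm l).const_mul _
  have hhLp : ∀ l, MemLp (h l) 2 := fun l => (hmixLp l).const_mul _
  have hho : ∀ j k, ∫ z, conj (h j z) * h k z = if j = k then 1 else 0 := by
    intro j k
    calc _ = ∫ z, ((((√(d j))⁻¹ : ℝ) : ℂ) * (((√(d k))⁻¹ : ℝ) : ℂ)) *
          (conj (mix U g j z) * mix U g k z) := by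
          refine integral_congr_ae (Filter.Eventually.of_forall fun z => ?_)
          simp only [hh, map_mul, Complex.conj_ofReal]
          ring
      _ = _ := by
          rw [integral_const_mul, hd1]
          by_cases hjk : j = k
          · subst hjk
            simp only [if_true]
            norm_cast
            rw [← mul_inv, Real.mul_self_sqrt (hd0 _), inv_mul_cancel₀ j.2.ne']
          · have : (j : ι) ≠ k := fun e => hjk (Subtype.ext e)
            simp [hjk, this]
  have hh1 : ∀ l, ∫⁻ z, ‖h l z‖ₑ ^ 2 ≤ 1 := by
    intro l
    have e := hho l l
    rw [if_pos rfl, integral_conj_mul_self] at e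
    rw [lintegral_enorm_sq_eq (hhLp l)]
    have h' : ∫ x, ‖h l x‖ ^ 2 = 1 := by exact_mod_cast e
    rw [h', ENNReal.ofReal_one]
  have hGi : ∀ l, Integrable (weighted w φ (h l)) := fun l => hWLp.integrable_mul (hhLp l)
  set T : P → ℝ≥0∞ := fun l => ∫⁻ ξ, ‖waveFT (weighted w φ (h l)) ξ‖ₑ ^ 2 with hT
  have hTC : ∑ l, T l ^ β ≤ C := by
    refine sum_lintegral_rpow_le_of_gauss
      (fun l => (stronglyMeasurable_waveFT (hGi l)).measurable.enorm.pow_const 2) fun ε hε => ?_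
    simp_rw [fun l => lintegral_gauss_waveFT hε (hGi l)]
    exact H ε hε w hw hw1 φ hφ hφ1 P h hhm hh1 hho hGi
  have hdT : ∀ l : P, ENNReal.ofReal (d l) ≤ dualConst n * T l := by
    intro l
    have h1 := enorm_integral_conj_mul_schrodinger_sq_le (hFg l) (hGi l)
    have h2 : ∫ z, conj (weighted w φ (h l) z) * schrodinger (F l) z.1 z.2 = ((√(d l) : ℝ) : ℂ) := by
      calc _ = ∫ z, (((√(d l))⁻¹ : ℝ) : ℂ) * (conj (mix U g l z) * mix U g l z) := by
            refine integral_congr_ae (Filter.Eventually.of_forall fun z => ?_)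
            have hz : mix U g l z =
              (((w z.1 * φ z : ℝ≥0) : ℝ) : ℂ) * schrodinger (F l) z.1 z.2 := by rw [hmix]; rfl
            simp only [weighted, hh, map_mul, Complex.conj_ofReal]
            calc _ = (((√(d l))⁻¹ : ℝ) : ℂ) * (conj (mix U g l z) *
                  ((((w z.1 * φ z : ℝ≥0) : ℝ) : ℂ) * schrodinger (F l) z.1 z.2)) := by ring
              _ = _ := by rw [← hz]
        _ = _ := by
            rw [integral_const_mul, hd1, if_pos rfl]
            norm_cast
            rw [inv_mul_eq_div, Real.div_sqrt]
    rw [h2, hF1, mul_one] at h1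
    refine le_trans (le_of_eq ?_) h1
    rw [← ofReal_norm, Complex.norm_real, Real.norm_of_nonneg (Real.sqrt_nonneg _),
      ← ENNReal.ofReal_pow (Real.sqrt_nonneg _), Real.sq_sqrt (hd0 _)]
  have hdβ : ∑ l, ENNReal.ofReal (d l) ^ β ≤ dualConst n ^ β * C := by
    calc ∑ l, ENNReal.ofReal (d l) ^ β = ∑ l : P, ENNReal.ofReal (d l) ^ β := by
          rw [← Finset.sum_subtype (Finset.univ.filter fun l => 0 < d l) (by simp)
            fun l => ENNReal.ofReal (d l) ^ β]
          refine (Finset.sum_filter_of_ne fun l _ hl => ?_).symm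
          by_contra hneg
          exact hl (by rw [ENNReal.ofReal_of_nonpos (not_lt.1 hneg), ENNReal.zero_rpow_of_pos hβ0])
      _ ≤ ∑ l : P, dualConst n ^ β * T l ^ β := by
          gcongr with l _
          rw [← ENNReal.mul_rpow_of_nonneg _ _ hβ0.le]
          gcongr
          exact hdT l
      _ = dualConst n ^ β * ∑ l, T l ^ β := (Finset.mul_sum _ _ _).symm
      _ ≤ _ := by gcongr
  have hgj : ∀ j, ∫⁻ z : SpaceTime n, (w z.1 * φ z : ℝ≥0∞) ^ 2 *
      ‖schrodinger (f j) z.1 z.2‖ₑ ^ 2 =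
      ∑ l, ENNReal.ofReal (‖U j l‖ ^ 2) * ENNReal.ofReal (d l) := by
    intro j
    have e := hd2 j
    rw [integral_conj_mul_self] at e
    have e' : ∫ z, ‖g j z‖ ^ 2 = ∑ l, ‖U j l‖ ^ 2 * d l := by exact_mod_cast e
    calc _ = ∫⁻ z, ‖g j z‖ₑ ^ 2 := by
          refine lintegral_congr fun z => ?_
          rw [hg]
          simp only [enorm_weighted]
          ring
      _ = _ := by
          rw [lintegral_enorm_sq_eq (hgLp j), e',
            ENNReal.ofReal_sum_of_nonneg fun l _ => mul_nonneg (by positivity) (hd0 l)]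
          refine Finset.sum_congr rfl fun l _ => ?_
          rw [ENNReal.ofReal_mul (by positivity)]
  simp_rw [hgj]
  refine (sum_mul_sum_le hU hα hβ0 hαβ a _).trans ?_
  gcongr

/-- The mixed norm is recovered by testing against products of a time weight and a
space-time weight. -/
lemma lintegral_lintegral_rpow_le_of_weights {p q β γ : ℝ} (hp : 1 < p) (hq : 1 < q)
    (hβ : β = 2 * p / (p - 1)) (hγ : γ = 2 * q / (q - 1)) {C M : ℝ≥0∞} (hM : M ≠ ∞)
    {ρ : SpaceTime n → ℝ≥0∞} (hρ : Measurable ρ) (hρM : ∀ z, ρ z ≤ M)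
    {S : Set ℝ} (hS : MeasurableSet S) (hSf : volume S ≠ ∞)
    {B : Set (Rn n)} (hB : MeasurableSet B) (hBf : volume B ≠ ∞)
    (hsupp : ∀ t x, ρ (t, x) ≠ 0 → t ∈ S ∧ x ∈ B)
    (H : ∀ w : ℝ → ℝ≥0, Measurable w → ∫⁻ t, (w t : ℝ≥0∞) ^ γ ≤ 1 →
      ∀ φ : SpaceTime n → ℝ≥0, Measurable φ → (∀ t, ∫⁻ x, (φ (t, x) : ℝ≥0∞) ^ β ≤ 1) →
      ∫⁻ z : SpaceTime n, (w z.1 * φ z : ℝ≥0∞) ^ 2 ≠ ∞ →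
      ∫⁻ z : SpaceTime n, (w z.1 * φ z : ℝ≥0∞) ^ 2 * ρ z ≤ C) :
    ∫⁻ t, (∫⁻ x, ρ (t, x) ^ p) ^ (q / p) ≤ C ^ q := by
  have hp0 : 0 < p := by linarith
  have hq0 : 0 < q := by linarith
  have hp1 : 0 < p - 1 := by linarith
  have hq1 : 0 < q - 1 := by linarith
  have hβ2 : 2 ≤ β := by rw [hβ, le_div_iff₀ hp1]; linarith
  have hγ2 : 2 ≤ γ := by rw [hγ, le_div_iff₀ hq1]; linarith
  set N : ℝ → ℝ≥0∞ := fun t => ∫⁻ x, ρ (t, x) ^ p with hN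
  have hNm : Measurable N := (hρ.pow_const p).lintegral_prod_right'
  have hMp : M ^ p ≠ ∞ := by finiteness
  have hNle : ∀ t, N t ≤ M ^ p * volume B := fun t => by
    calc N t ≤ ∫⁻ x, B.indicator (fun _ => M ^ p) x := by
          refine lintegral_mono fun x => ?_
          by_cases hx : ρ (t, x) = 0
          · simp [hx, hp0]
          · rw [indicator_of_mem (hsupp t x hx).2]
            exact ENNReal.rpow_le_rpow (hρM _) hp0.le
      _ = _ := lintegral_indicator_const hB _
  have hNt : ∀ t, N t ≠ ∞ := fun t => ne_top_of_le_ne_top (by finiteness) (hNle t)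
  have hNS : ∀ t, t ∉ S → N t = 0 := fun t ht => by
    have : ∀ x, ρ (t, x) = 0 := fun x => by
      by_contra h
      exact ht (hsupp t x h).1
    simp [hN, this, hp0]
  set I : ℝ≥0∞ := ∫⁻ t, N t ^ (q / p) with hI
  have hqp : 0 < q / p := by positivity
  have hIt : I ≠ ∞ := by
    refine ne_top_of_le_ne_top (b := (M ^ p * volume B) ^ (q / p) * volume S) (by finiteness) ?_
    calc I ≤ ∫⁻ t, S.indicator (fun _ => (M ^ p * volume B) ^ (q / p)) t := by
          refine lintegral_mono fun t => ?_
          by_cases ht : t ∈ S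
          · rw [indicator_of_mem ht]
            exact ENNReal.rpow_le_rpow (hNle t) hqp.le
          · simp [hNS t ht, hqp]
      _ = _ := lintegral_indicator_const hS _
  rcases eq_or_ne I 0 with hI0 | hI0
  · simp [hI0]
  set W : ℝ → ℝ≥0∞ := fun t => (N t ^ ((q - 1) / p) * I ^ (-((q - 1) / q))) ^ (1 / 2 : ℝ) with hW
  set Φ : SpaceTime n → ℝ≥0∞ := fun z => (ρ z ^ (p - 1) * N z.1 ^ (-((p - 1) / p))) ^ (1 / 2 : ℝ)
    with hΦ
  have hWm : Measurable W := ((hNm.pow_const _).mul_const _).pow_const _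
  have hΦm : Measurable Φ :=
    ((hρ.pow_const _).mul ((hNm.comp measurable_fst).pow_const _)).pow_const _
  have hWt : ∀ t, W t ≠ ∞ := fun t =>
    ENNReal.rpow_ne_top_of_nonneg (by norm_num) (ENNReal.mul_ne_top
      (ENNReal.rpow_ne_top_of_nonneg (by positivity) (hNt t))
      (ENNReal.rpow_ne_top_of_ne_zero hI0 hIt))
  have hΦt : ∀ z, N z.1 ≠ 0 → Φ z ≠ ∞ := fun z hz =>
    ENNReal.rpow_ne_top_of_nonneg (by norm_num) (ENNReal.mul_ne_top
      (ENNReal.rpow_ne_top_of_nonneg hp1.le (ne_top_of_le_ne_top hM (hρM z)))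
      (ENNReal.rpow_ne_top_of_ne_zero hz (hNt _)))
  have hΦ0 : ∀ z, N z.1 = 0 → (Φ z).toNNReal = 0 := fun z hz => by
    rcases eq_or_ne (ρ z) 0 with h | h
    · simp [hΦ, h, hp1]
    · have : Φ z = ∞ := by
        simp only [hΦ, hz]
        rw [ENNReal.zero_rpow_of_neg (by simp; positivity), ENNReal.mul_top
          (by simp [h]; intro; linarith), ENNReal.top_rpow_of_pos (by norm_num)]
      simp [this]
  have hφle : ∀ z, ((Φ z).toNNReal : ℝ≥0∞) ≤ Φ z := fun z => ENNReal.coe_toNNReal_le_self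
  have hwW : ∀ t, ((W t).toNNReal : ℝ≥0∞) = W t := fun t => ENNReal.coe_toNNReal (hWt t)
  have hWγ : ∀ t, W t ^ γ = N t ^ (q / p) * I⁻¹ := fun t => by
    have hc : 1 / 2 * γ = q / (q - 1) := by rw [hγ]; field_simp
    have e1 : (q - 1) / p * (q / (q - 1)) = q / p := by field_simp
    have e2 : -((q - 1) / q) * (q / (q - 1)) = -1 := by field_simp
    simp only [hW]
    rw [← ENNReal.rpow_mul, hc, ENNReal.mul_rpow_of_nonneg _ _ (by positivity),
      ← ENNReal.rpow_mul, ← ENNReal.rpow_mul, e1, e2, ENNReal.rpow_neg_one]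
  have hΦβ : ∀ z, Φ z ^ β = ρ z ^ p * (N z.1)⁻¹ := fun z => by
    have hc : 1 / 2 * β = p / (p - 1) := by rw [hβ]; field_simp
    have e1 : (p - 1) * (p / (p - 1)) = p := by field_simp
    have e2 : -((p - 1) / p) * (p / (p - 1)) = -1 := by field_simp
    simp only [hΦ]
    rw [← ENNReal.rpow_mul, hc, ENNReal.mul_rpow_of_nonneg _ _ (by positivity),
      ← ENNReal.rpow_mul, ← ENNReal.rpow_mul, e1, e2, ENNReal.rpow_neg_one]
  have sq_half : ∀ y : ℝ≥0∞, (y ^ (1 / 2 : ℝ)) ^ 2 = y := fun y => by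
    rw [← ENNReal.rpow_natCast, ← ENNReal.rpow_mul]
    norm_num
  have sq_le : ∀ {s : ℝ} (_ : 2 ≤ s) (y : ℝ≥0∞), y ^ 2 ≤ 1 + y ^ s := fun {s} hs y => by
    rcases le_total y 1 with h | h
    · exact le_add_right (pow_le_one' h 2)
    · refine le_add_left ?_
      rw [← ENNReal.rpow_natCast]
      exact ENNReal.rpow_le_rpow_of_exponent_le h (by exact_mod_cast hs)
  have hwint : ∫⁻ t, ((W t).toNNReal : ℝ≥0∞) ^ γ ≤ 1 := by
    simp_rw [hwW, hWγ]
    rw [lintegral_mul_const _ (hNm.pow_const _)]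
    exact (ENNReal.mul_inv_cancel hI0 hIt).le
  have hφint : ∀ t, ∫⁻ x, ((Φ (t, x)).toNNReal : ℝ≥0∞) ^ β ≤ 1 := fun t => by
    calc _ ≤ ∫⁻ x, ρ (t, x) ^ p * (N t)⁻¹ := by
          refine lintegral_mono fun x => ?_
          have := hΦβ (t, x)
          rw [← this]
          exact ENNReal.rpow_le_rpow (hφle _) (by linarith)
      _ = N t * (N t)⁻¹ := lintegral_mul_const _ ((hρ.pow_const p).comp measurable_prodMk_left)
      _ ≤ 1 := ENNReal.mul_inv_le_one _
  have hmain := H (fun t => (W t).toNNReal) hWm.ennreal_toNNReal hwint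
    (fun z => (Φ z).toNNReal) hΦm.ennreal_toNNReal hφint ?_
  · have key : ∫⁻ z : SpaceTime n, (((W z.1).toNNReal : ℝ≥0∞) * (Φ z).toNNReal) ^ 2 * ρ z =
        I ^ (1 / q) := by
      rw [Measure.volume_eq_prod, lintegral_prod _ (by fun_prop)]
      have hin : ∀ t, ∫⁻ x, (((W t).toNNReal : ℝ≥0∞) * (Φ (t, x)).toNNReal) ^ 2 * ρ (t, x) =
          N t ^ (q / p) * I ^ (-((q - 1) / q)) := fun t => by
        rcases eq_or_ne (N t) 0 with h0 | h0
        · simp [hΦ0 (t, _) h0, h0, hqp]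
        · have e1 : (q - 1) / p + -((p - 1) / p) + 1 = q / p := by field_simp; ring
          calc _ = ∫⁻ x, (N t ^ ((q - 1) / p) * I ^ (-((q - 1) / q)) * N t ^ (-((p - 1) / p))) *
                ρ (t, x) ^ p := by
                refine lintegral_congr fun x => ?_
                rw [hwW, ENNReal.coe_toNNReal (hΦt (t, x) h0), mul_pow]
                simp only [hW, hΦ]
                rw [sq_half, sq_half]
                have : ρ (t, x) ^ p = ρ (t, x) ^ (p - 1) * ρ (t, x) := by
                  conv_rhs => rw [← ENNReal.rpow_one (ρ (t, x)), ← ENNReal.rpow_mul,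
                    ← ENNReal.rpow_add_of_nonneg _ _ (by linarith) (by norm_num)]
                  simp
                rw [this]
                ring
            _ = (N t ^ ((q - 1) / p) * I ^ (-((q - 1) / q)) * N t ^ (-((p - 1) / p))) * N t :=
                lintegral_const_mul _ ((hρ.pow_const p).comp measurable_prodMk_left)
            _ = (N t ^ ((q - 1) / p) * N t ^ (-((p - 1) / p)) * N t ^ (1 : ℝ)) *
                I ^ (-((q - 1) / q)) := by rw [ENNReal.rpow_one]; ring
            _ = _ := by
                rw [← ENNReal.rpow_add _ _ h0 (hNt t), ← ENNReal.rpow_add _ _ h0 (hNt t), e1]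
      simp only [hin]
      rw [lintegral_mul_const _ (hNm.pow_const _)]
      have e3 : 1 + -((q - 1) / q) = 1 / q := by field_simp; ring
      rw [← e3, ENNReal.rpow_add _ _ hI0 hIt, ENNReal.rpow_one]
    rw [key] at hmain
    calc I = (I ^ (1 / q)) ^ q := by
          rw [← ENNReal.rpow_mul, one_div_mul_cancel hq0.ne', ENNReal.rpow_one]
      _ ≤ C ^ q := ENNReal.rpow_le_rpow hmain hq0.le
  · have hφB : ∀ t, ∫⁻ x, ((Φ (t, x)).toNNReal : ℝ≥0∞) ^ 2 ≤ volume B + 1 := fun t => by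
      calc _ ≤ ∫⁻ x, (B.indicator (fun _ => 1) x + ((Φ (t, x)).toNNReal : ℝ≥0∞) ^ β) := by
            refine lintegral_mono fun x => ?_
            by_cases hx : x ∈ B
            · rw [indicator_of_mem hx]
              exact sq_le hβ2 _
            · have : ρ (t, x) = 0 := by
                by_contra h
                exact hx (hsupp t x h).2
              simp [hΦ, this, hp1]
        _ = volume B + ∫⁻ x, ((Φ (t, x)).toNNReal : ℝ≥0∞) ^ β := by
            rw [lintegral_add_left (measurable_const.indicator hB), lintegral_indicator_const hB,
              one_mul]
        _ ≤ _ := by gcongr; exact hφint t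
    have hwS : ∫⁻ t, ((W t).toNNReal : ℝ≥0∞) ^ 2 ≤ volume S + 1 := by
      calc _ ≤ ∫⁻ t, (S.indicator (fun _ => 1) t + ((W t).toNNReal : ℝ≥0∞) ^ γ) := by
            refine lintegral_mono fun t => ?_
            by_cases ht : t ∈ S
            · rw [indicator_of_mem ht]
              exact sq_le hγ2 _
            · have : 0 < (q - 1) / p := by positivity
              simp [hW, hNS t ht, this]
        _ = volume S + ∫⁻ t, ((W t).toNNReal : ℝ≥0∞) ^ γ := by
            rw [lintegral_add_left (measurable_const.indicator hS), lintegral_indicator_const hS,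
              one_mul]
        _ ≤ _ := by gcongr
    refine ne_top_of_le_ne_top (b := (volume S + 1) * (volume B + 1)) (by finiteness) ?_
    rw [Measure.volume_eq_prod, lintegral_prod _ (by fun_prop)]
    calc _ ≤ ∫⁻ t, ((W t).toNNReal : ℝ≥0∞) ^ 2 * (volume B + 1) := by
          refine lintegral_mono fun t => ?_
          simp only [mul_pow]
          rw [lintegral_const_mul _ (by
            have : Measurable fun z => ((Φ z).toNNReal : ℝ≥0∞) ^ 2 := by fun_prop
            exact this.comp measurable_prodMk_left)]
          gcongr
          exact hφB t
      _ = (∫⁻ t, ((W t).toNNReal : ℝ≥0∞) ^ 2) * (volume B + 1) :=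
          lintegral_mul_const _ (by fun_prop)
      _ ≤ _ := by gcongr

/-- Monotone convergence for mixed norms. -/
lemma lintegral_lintegral_iSup_rpow_le {p q : ℝ} (hp : 0 < p) (hq : 0 < q) {D : ℝ≥0∞}
    {F : ℕ → SpaceTime n → ℝ≥0∞} (hF : ∀ k, Measurable (F k)) (hmono : Monotone F)
    (h : ∀ k, ∫⁻ t, (∫⁻ x, F k (t, x) ^ p) ^ q ≤ D) :
    ∫⁻ t, (∫⁻ x, (⨆ k, F k (t, x)) ^ p) ^ q ≤ D := by
  have rpow_iSup : ∀ {s : ℝ} (_ : 0 < s) (G : ℕ → ℝ≥0∞), (⨆ k, G k) ^ s = ⨆ k, G k ^ s :=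
    fun hs G => (ENNReal.orderIsoRpow _ hs).map_iSup G
  have hinner : ∀ t, ∫⁻ x, (⨆ k, F k (t, x)) ^ p = ⨆ k, ∫⁻ x, F k (t, x) ^ p := fun t => by
    simp_rw [rpow_iSup hp]
    exact lintegral_iSup (fun k => ((hF k).pow_const p).comp measurable_prodMk_left)
      fun i j hij x => ENNReal.rpow_le_rpow (hmono hij _) hp.le
  simp_rw [hinner, rpow_iSup hq]
  rw [lintegral_iSup (fun k => ((hF k).pow_const p).lintegral_prod_right'.pow_const q)
    fun i j hij t => ENNReal.rpow_le_rpow (lintegral_mono fun x =>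
      ENNReal.rpow_le_rpow (hmono hij _) hp.le) hq.le]
  exact iSup_le h

/-- Mixed-norm estimate for finite orthonormal systems. -/
lemma mixed_sum_le (n : ℕ) (hn : 1 ≤ n) {α β p q : ℝ} (hp : 1 < p) (hq : 1 < q)
    (hβ : (n : ℝ) + 1 < β) (hα : 0 < α) (hαβ : 1 / α + 1 / β = 1)
    (hpβ : β = 2 * p / (p - 1)) (hqβ : 2 * β / (β - n) = 2 * q / (q - 1)) :
    ∃ C : ℝ≥0∞, C ≠ ∞ ∧ ∀ (ι : Type) [Fintype ι] [DecidableEq ι] (f : ι → Rn n → ℂ),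
      (∀ j, IsGood (f j)) → (∀ j k, ∫ x, conj (f j x) * f k x = if j = k then 1 else 0) →
      ∀ a : ι → ℝ≥0∞, ∑ j, a j ^ α ≤ 1 →
      ∫⁻ t, (∫⁻ x, (∑ j, a j * ‖schrodinger (f j) t x‖ₑ ^ 2) ^ p) ^ (q / p) ≤ C := by
  obtain ⟨C, hC, H⟩ := sum_lintegral_weight_le n hn hβ hα hαβ
  refine ⟨C ^ q, ENNReal.rpow_ne_top_of_nonneg (by linarith) hC,
    fun ι _ _ f hf hortho a ha => ?_⟩
  have hum : ∀ j, Measurable fun z : SpaceTime n => schrodinger (f j) z.1 z.2 :=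
    fun j => (hf j).measurable_schrodinger
  set ρ : SpaceTime n → ℝ≥0∞ := fun z => ∑ j, a j * ‖schrodinger (f j) z.1 z.2‖ₑ ^ 2 with hρ
  have hρm : Measurable ρ :=
    Finset.measurable_sum _ fun j _ => ((hum j).enorm.pow_const 2).const_mul _
  have ha1 : ∀ j, a j ≤ 1 := fun j => by
    have h1 : a j ^ α ≤ 1 :=
      (Finset.single_le_sum (f := fun j => a j ^ α) (fun _ _ => zero_le) (Finset.mem_univ j)).trans
        ha
    by_contra hlt
    exact absurd h1 (not_le.2 (ENNReal.one_lt_rpow (not_le.1 hlt) hα))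
  set M : ℝ≥0∞ := ∑ j, (ENNReal.ofReal ((2 * π) ^ (-(n : ℝ))) * ∫⁻ ξ, ‖FT (f j) ξ‖ₑ) ^ 2 with hM
  have hMt : M ≠ ∞ := ENNReal.sum_ne_top.2 fun j _ => ENNReal.pow_ne_top
    (ENNReal.mul_ne_top ENNReal.ofReal_ne_top (hf j).integrable_FT.2.ne)
  have hρM : ∀ z, ρ z ≤ M := fun z => by
    refine Finset.sum_le_sum fun j _ => ?_
    calc _ ≤ 1 * ‖schrodinger (f j) z.1 z.2‖ₑ ^ 2 := by gcongr; exact ha1 j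
      _ ≤ _ := by
        rw [one_mul]
        gcongr
        exact enorm_schrodinger_le _ z
  set K : ℕ → Set (SpaceTime n) := fun k =>
    Metric.closedBall (0 : ℝ) k ×ˢ Metric.closedBall (0 : Rn n) k with hK
  have hKm : ∀ k, MeasurableSet (K k) := fun k =>
    Metric.isClosed_closedBall.measurableSet.prod Metric.isClosed_closedBall.measurableSet
  have hKmono : Monotone K := fun i j hij => prod_mono
    (Metric.closedBall_subset_closedBall (by exact_mod_cast hij))
    (Metric.closedBall_subset_closedBall (by exact_mod_cast hij))
  have hsup : ∀ z, ρ z = ⨆ k, (K k).indicator ρ z := fun z => by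
    refine le_antisymm ?_ (iSup_le fun k => indicator_le_self _ _ _)
    obtain ⟨k, hk⟩ := exists_nat_ge (max ‖z.1‖ ‖z.2‖)
    refine le_iSup_of_le k ?_
    rw [indicator_of_mem]
    exact ⟨mem_closedBall_zero_iff.2 ((le_max_left _ _).trans hk),
      mem_closedBall_zero_iff.2 ((le_max_right _ _).trans hk)⟩
  have h1 := lintegral_lintegral_iSup_rpow_le (p := p) (q := q / p) (by positivity) (by positivity)
    (D := C ^ q) (F := fun k => (K k).indicator ρ) (fun k => hρm.indicator (hKm k))
    (fun i j hij => indicator_le_indicator_of_subset (hKmono hij) fun _ => zero_le) fun k => ?_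
  · simp_rw [← hsup] at h1
    exact h1
  · refine lintegral_lintegral_rpow_le_of_weights hp hq hpβ rfl hMt (hρm.indicator (hKm k))
      (fun z => (indicator_le_self _ _ _).trans (hρM z))
      (S := Metric.closedBall 0 k) (B := Metric.closedBall 0 k)
      Metric.isClosed_closedBall.measurableSet measure_closedBall_lt_top.ne
      Metric.isClosed_closedBall.measurableSet measure_closedBall_lt_top.ne
      (fun t x h => mem_prod.1 (mem_of_indicator_ne_zero (s := K k) (f := ρ) h)) fun w hw hw1 φ hφ hφ1 hwφ => ?_
    rw [← hqβ] at hw1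
    calc _ ≤ ∫⁻ z : SpaceTime n, (w z.1 * φ z : ℝ≥0∞) ^ 2 * ρ z := by
          gcongr with z
          exact indicator_le_self _ _ _
      _ = ∑ j, a j * ∫⁻ z : SpaceTime n, (w z.1 * φ z : ℝ≥0∞) ^ 2 *
          ‖schrodinger (f j) z.1 z.2‖ₑ ^ 2 := by
          simp only [hρ, Finset.mul_sum]
          have hm : ∀ j, Measurable fun z : SpaceTime n => (w z.1 * φ z : ℝ≥0∞) ^ 2 *
              ‖schrodinger (f j) z.1 z.2‖ₑ ^ 2 := fun j =>
            (by fun_prop : Measurable fun z : SpaceTime n => (w z.1 * φ z : ℝ≥0∞) ^ 2).mul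
              ((hum j).enorm.pow_const 2)
          simp_rw [mul_left_comm _ (a _)]
          rw [lintegral_finsetSum _ fun j _ => (hm j).const_mul _]
          exact Finset.sum_congr rfl fun j _ => lintegral_const_mul _ (hm j)
      _ ≤ C := H w hw hw1 φ hφ hφ1 hwφ ι f hf hortho a ha

lemma FT_eq_zero_of_not_integrable {f : Rn n → ℂ} (hf : ¬ Integrable f) : FT f = 0 := by
  ext ξ
  refine integral_undef fun h => hf ?_
  have hm : Measurable fun x : Rn n => Complex.exp (Complex.I * dotC x ξ) := by
    have h0 : Measurable fun x : Rn n => Complex.exp (-(Complex.I * dotC x ξ)) :=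
      measurable_fourier_exp.of_uncurry_right
    convert h0.inv using 1
    ext x
    simp [Complex.exp_neg]
  have := h.bdd_mul (c := 1) hm.aestronglyMeasurable (Filter.Eventually.of_forall fun x => by
    have := norm_fourier_exp x ξ
    rw [Complex.exp_neg, norm_inv, inv_eq_one] at this
    exact this.le)
  simpa [← mul_assoc, ← Complex.exp_add] using this

lemma schrodinger_eq_zero {f : Rn n → ℂ} (hf : ¬ (Integrable f ∧ Integrable (FT f))) :
    schrodinger f = 0 := by
  ext t x
  have h0 := schrodinger_eq f (t, x)
  rw [h0]
  rcases em (Integrable f) with h | h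
  · refine mul_eq_zero_of_right _ (integral_undef fun hi => hf ⟨h, ?_⟩)
    have hm : Measurable fun ξ => phase (t, x) ξ := measurable_phase.of_uncurry_left
    have := hi.bdd_mul (c := 1) hm.aestronglyMeasurable
      (Filter.Eventually.of_forall fun ξ => (norm_phase (t, x) ξ).le)
    refine this.congr (Filter.Eventually.of_forall fun ξ => ?_)
    simp only [← mul_assoc, Complex.mul_conj, Complex.normSq_eq_norm_sq, norm_phase]
    simp
  · simp [FT_eq_zero_of_not_integrable h]

lemma isGood_of_integral {f : Rn n → ℂ} (h1 : ∫ x, f x * conj (f x) ≠ 0)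
    (hf : Integrable f ∧ Integrable (FT f)) : IsGood f where
  integrable := hf.1
  integrable_FT := hf.2
  memLp := by
    have hi : Integrable fun x => f x * conj (f x) := by
      by_contra h
      exact h1 (integral_undef h)
    refine (memLp_two_iff_integrable_sq_norm hf.1.aestronglyMeasurable).2 ?_
    refine hi.norm.congr (Filter.Eventually.of_forall fun x => ?_)
    simp [sq]

/-- Mixed-norm estimate for infinite orthonormal systems. -/
lemma mixed_tsum_le (n : ℕ) (hn : 1 ≤ n) {α β p q : ℝ} (hp : 1 < p) (hq : 1 < q)
    (hβ : (n : ℝ) + 1 < β) (hα : 0 < α) (hαβ : 1 / α + 1 / β = 1)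
    (hpβ : β = 2 * p / (p - 1)) (hqβ : 2 * β / (β - n) = 2 * q / (q - 1)) :
    ∃ C : ℝ≥0∞, C ≠ ∞ ∧ ∀ f : ℕ → Rn n → ℂ, OrthonormalL2 f →
      ∀ a : ℕ → ℝ≥0∞, ∑' j, a j ^ α ≤ 1 →
      ∫⁻ t, (∫⁻ x, (∑' j, a j * ‖schrodinger (f j) t x‖ₑ ^ 2) ^ p) ^ (q / p) ≤ C := by
  obtain ⟨C, hC, H⟩ := mixed_sum_le n hn hp hq hβ hα hαβ hpβ hqβ
  refine ⟨C, hC, fun f hf a ha => ?_⟩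
  classical
  have hgood : ∀ j, Integrable (f j) ∧ Integrable (FT (f j)) → IsGood (f j) := fun j =>
    isGood_of_integral (by rw [hf j j]; simp)
  set s : ℕ → Finset ℕ := fun k =>
    (Finset.range k).filter fun j => Integrable (f j) ∧ Integrable (FT (f j)) with hs
  have hsum : ∀ k t x, ∑ j : s k, a j * ‖schrodinger (f j) t x‖ₑ ^ 2 =
      ∑ j ∈ Finset.range k, a j * ‖schrodinger (f j) t x‖ₑ ^ 2 := fun k t x => by
    rw [Finset.sum_coe_sort (s k) fun j => a j * ‖schrodinger (f j) t x‖ₑ ^ 2, hs]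
    refine Finset.sum_filter_of_ne fun j _ hj => ?_
    by_contra hb
    simp [schrodinger_eq_zero hb] at hj
  have hm : ∀ j, Measurable fun z : SpaceTime n => schrodinger (f j) z.1 z.2 := fun j => by
    by_cases hb : Integrable (f j) ∧ Integrable (FT (f j))
    · exact (hgood j hb).measurable_schrodinger
    · simp [schrodinger_eq_zero hb]
  have h1 := lintegral_lintegral_iSup_rpow_le (p := p) (q := q / p) (by positivity) (by positivity)
    (D := C)
    (F := fun k (z : SpaceTime n) => ∑ j ∈ Finset.range k, a j * ‖schrodinger (f j) z.1 z.2‖ₑ ^ 2)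
    (fun k => Finset.measurable_sum _ fun j _ => ((hm j).enorm.pow_const 2).const_mul _)
    (fun i j hij z => Finset.sum_le_sum_of_subset (Finset.range_mono hij)) fun k => ?_
  · simpa only [ENNReal.tsum_eq_iSup_nat] using h1
  · simp_rw [← hsum]
    refine H (s k) (fun j => f j) (fun j => hgood j (Finset.mem_filter.1 j.2).2) (fun i j => ?_)
      (fun j => a j) ?_
    · have := hf j i
      simp_rw [mul_comm _ (f j _), this, Subtype.ext_iff, eq_comm]
    · rw [Finset.sum_coe_sort (s k) fun j => a j ^ α]
      exact (ENNReal.sum_le_tsum _).trans ha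

/-- The propagator is bounded on `L²`, uniformly in time. -/
lemma lintegral_schrodinger_sq_le {f : Rn n → ℂ} (hf : IsGood f) (t : ℝ) :
    ∫⁻ x, ‖schrodinger f t x‖ₑ ^ 2 ≤
      ENNReal.ofReal ((2 * π) ^ (-(n : ℝ))) ^ 2 * (plConst n * (plConst n * ∫⁻ x, ‖f x‖ₑ ^ 2)) := by
  set G : Rn n → ℂ := fun ξ => conj (phase (t, 0) ξ) * FT f ξ with hG
  have hGi : Integrable G := integrable_conj_phase_mul hf.integrable_FT _
  have hu : ∀ x, ‖schrodinger f t x‖ₑ = ENNReal.ofReal ((2 * π) ^ (-(n : ℝ))) * ‖FT G (-x)‖ₑ :=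
    fun x => by
    have h0 := schrodinger_eq f (t, x)
    simp only at h0
    rw [h0, enorm_mul, ← ofReal_norm, Complex.norm_real, Real.norm_of_nonneg (by positivity)]
    congr 2
    refine integral_congr_ae (Filter.Eventually.of_forall fun ξ => ?_)
    simp only [hG, conj_phase, ← mul_assoc, ← Complex.exp_add]
    congr 2
    simp only [dotC]
    push_cast
    simp [mul_comm]
    ring
  calc _ = ENNReal.ofReal ((2 * π) ^ (-(n : ℝ))) ^ 2 * ∫⁻ x, ‖FT G (-x)‖ₑ ^ 2 := by
        simp_rw [hu, mul_pow]
        exact lintegral_const_mul' _ _ (by finiteness)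
    _ = ENNReal.ofReal ((2 * π) ^ (-(n : ℝ))) ^ 2 * ∫⁻ x, ‖FT G x‖ₑ ^ 2 := by
        rw [lintegral_neg_eq_self fun x => ‖FT G x‖ₑ ^ 2]
    _ ≤ ENNReal.ofReal ((2 * π) ^ (-(n : ℝ))) ^ 2 * (plConst n * ∫⁻ ξ, ‖FT f ξ‖ₑ ^ 2) := by
        gcongr
        refine (lintegral_FT_sq_le hGi).trans_eq ?_
        congr 1
        refine lintegral_congr fun ξ => ?_
        rw [hG]
        simp only
        rw [enorm_mul, enorm_conj, ← ofReal_norm, norm_phase, ENNReal.ofReal_one, one_mul]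
    _ ≤ _ := by
        gcongr
        exact lintegral_FT_sq_le hf.integrable

lemma enorm_density_le (lam : ℕ → ℝ) (f : ℕ → Rn n → ℂ) (t : ℝ) (x : Rn n) :
    ‖density lam f t x‖ₑ ≤ ∑' j, ENNReal.ofReal |lam j| * ‖schrodinger (f j) t x‖ₑ ^ 2 := by
  refine enorm_tsum_le_tsum_enorm.trans_eq (tsum_congr fun j => ?_)
  rw [enorm_mul, enorm_pow, enorm_norm, Real.enorm_eq_ofReal_abs]

lemma mixed_density_le (n : ℕ) (hn : 1 ≤ n) {a b : ℝ} (ha : ((n : ℝ) - 1) / (n + 1) < a)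
    (ha1 : a < 1) (hb : b = n * (1 - a) / 2) :
    ∃ C : ℝ≥0∞, C ≠ ∞ ∧ ∀ (f : ℕ → Rn n → ℂ) (lam : ℕ → ℝ), OrthonormalL2 f →
      seqNormE (ENNReal.ofReal (2 / (1 + a))) lam ≠ ∞ →
      mixedLp (expOf b) (expOf a) (density lam f)
        ≤ C * seqNormE (ENNReal.ofReal (2 / (1 + a))) lam := by
  have hn1 : (1 : ℝ) ≤ n := by exact_mod_cast hn
  have ha0 : 0 < a := lt_of_le_of_lt (div_nonneg (by linarith) (by linarith)) ha
  have h1a : 0 < 1 - a := by linarith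
  have hna : n - 1 < a * (n + 1) := (div_lt_iff₀ (by linarith)).1 ha
  have hb0 : 0 < b := by rw [hb]; positivity
  have hb1 : b < 1 := by rw [hb]; linarith
  have hα0 : 0 < 2 / (1 + a) := by positivity
  have hβ : (n : ℝ) + 1 < 2 / (1 - a) := by
    rw [lt_div_iff₀ h1a]; linarith
  have h1b : 0 < 1 - b := by linarith
  obtain ⟨C, hC, H⟩ := mixed_tsum_le n hn (α := 2 / (1 + a)) (β := 2 / (1 - a)) (p := 1 / a)
    (q := 1 / b) ((one_lt_div ha0).2 ha1) ((one_lt_div hb0).2 hb1) hβ hα0 (by field_simp; ring)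
    (by field_simp) (by
      have e1 : 2 / (1 - a) - n = 2 * (1 - b) / (1 - a) := by rw [hb]; field_simp
      have e2 : 1 / b - 1 = (1 - b) / b := by field_simp
      rw [e1, e2]
      field_simp)
  have hq0 : 0 < 1 / b := by positivity
  have hp0 : 0 < 1 / a := by positivity
  refine ⟨C ^ b, ENNReal.rpow_ne_top_of_nonneg hb0.le hC, fun f lam hf hlam => ?_⟩
  set α : ℝ := 2 / (1 + a) with hα
  set L : ℝ≥0∞ := seqNormE (ENNReal.ofReal α) lam with hL
  have hLeq : L = (∑' j, ENNReal.ofReal |lam j| ^ α) ^ (1 / α) := by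
    rw [hL, seqNormE, if_neg ENNReal.ofReal_ne_top, ENNReal.toReal_ofReal hα0.le]
  have hLα : L ^ α = ∑' j, ENNReal.ofReal |lam j| ^ α := by
    rw [hLeq, ← ENNReal.rpow_mul, one_div_mul_cancel hα0.ne', ENNReal.rpow_one]
  have hle : ∀ j, ENNReal.ofReal |lam j| ≤ L := fun j => by
    rw [← ENNReal.rpow_le_rpow_iff hα0, hLα]
    exact ENNReal.le_tsum j
  set c : ℕ → ℝ≥0∞ := fun j => ENNReal.ofReal |lam j| / L with hc
  have hcL : ∀ j, ENNReal.ofReal |lam j| = L * c j := fun j => by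
    rcases eq_or_ne L 0 with h0 | h0
    · rw [h0, zero_mul]
      exact le_zero_iff.1 ((hle j).trans_eq h0)
    · exact (ENNReal.mul_div_cancel h0 hlam).symm
  have hcsum : ∑' j, c j ^ α ≤ 1 := by
    simp only [hc, ENNReal.div_rpow_of_nonneg _ _ hα0.le]
    simp only [div_eq_mul_inv]
    rw [ENNReal.tsum_mul_right, ← hLα]
    exact ENNReal.mul_inv_le_one _
  have hea : (expOf a) = ENNReal.ofReal (1 / a) := by
    rw [expOf, one_div, ENNReal.ofReal_inv_of_pos ha0]
  have heb : (expOf b) = ENNReal.ofReal (1 / b) := by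
    rw [expOf, one_div, ENNReal.ofReal_inv_of_pos hb0]
  have hin : ∀ t, eLpNorm (density lam f t) (expOf a) volume ≤
      L * (∫⁻ x, (∑' j, c j * ‖schrodinger (f j) t x‖ₑ ^ 2) ^ (1 / a)) ^ a := fun t => by
    rw [eLpNorm_eq_lintegral_rpow_enorm_toReal (by rw [hea]; simpa using ha0)
      (by rw [hea]; exact ENNReal.ofReal_ne_top), hea, ENNReal.toReal_ofReal hp0.le, one_div_one_div]
    calc _ ≤ (∫⁻ x, L ^ (1 / a) *
          (∑' j, c j * ‖schrodinger (f j) t x‖ₑ ^ 2) ^ (1 / a)) ^ a := by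
          gcongr with x
          rw [← ENNReal.mul_rpow_of_nonneg _ _ hp0.le]
          gcongr
          refine (enorm_density_le lam f t x).trans_eq ?_
          simp_rw [hcL, mul_assoc]
          exact ENNReal.tsum_mul_left
      _ = _ := by
          rw [lintegral_const_mul' _ _ (ENNReal.rpow_ne_top_of_nonneg hp0.le hlam),
            ENNReal.mul_rpow_of_nonneg _ _ ha0.le, ← ENNReal.rpow_mul,
            one_div_mul_cancel ha0.ne', ENNReal.rpow_one]
  rw [mixedLp, eLp, heb, if_neg ENNReal.ofReal_ne_top, ENNReal.toReal_ofReal hq0.le,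
    one_div_one_div]
  calc _ ≤ (∫⁻ t, L ^ (1 / b) *
        (∫⁻ x, (∑' j, c j * ‖schrodinger (f j) t x‖ₑ ^ 2) ^ (1 / a)) ^ (1 / b / (1 / a))) ^ b := by
        gcongr with t
        refine (ENNReal.rpow_le_rpow (hin t) hq0.le).trans_eq ?_
        rw [ENNReal.mul_rpow_of_nonneg _ _ hq0.le, ← ENNReal.rpow_mul]
        congr 2
        field_simp
    _ = L * (∫⁻ t, (∫⁻ x, (∑' j, c j * ‖schrodinger (f j) t x‖ₑ ^ 2) ^ (1 / a)) ^
          (1 / b / (1 / a))) ^ b := by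
        rw [lintegral_const_mul' _ _ (ENNReal.rpow_ne_top_of_nonneg hq0.le hlam),
          ENNReal.mul_rpow_of_nonneg _ _ hb0.le, ← ENNReal.rpow_mul,
          one_div_mul_cancel hb0.ne', ENNReal.rpow_one]
    _ ≤ L * C ^ b := by
        gcongr
        exact H f hf c hcsum
    _ = _ := mul_comm _ _

/-- The uniform in time, integrable in space estimate for the density. -/
lemma mixed_density_endpoint (n : ℕ) :
    ∃ C : ℝ≥0∞, C ≠ ∞ ∧ ∀ (f : ℕ → Rn n → ℂ) (lam : ℕ → ℝ), OrthonormalL2 f →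
      mixedLp ∞ 1 (density lam f) ≤ C * seqNormE 1 lam := by
  set C : ℝ≥0∞ := ENNReal.ofReal ((2 * π) ^ (-(n : ℝ))) ^ 2 * (plConst n * plConst n) with hC
  refine ⟨C, ?_, fun f lam hf => ?_⟩
  · have := plConst_ne_top (n := n)
    finiteness
  have hu : ∀ j t, ∫⁻ x, ‖schrodinger (f j) t x‖ₑ ^ 2 ≤ C := fun j t => by
    by_cases hb : Integrable (f j) ∧ Integrable (FT (f j))
    · have hg := isGood_of_integral (by rw [hf j j]; simp) hb
      refine (lintegral_schrodinger_sq_le hg t).trans_eq ?_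
      have h1 : ∫⁻ x, ‖f j x‖ₑ ^ 2 = 1 := by
        have h2 := integral_conj_mul_self (μ := volume) (f j)
        have h3 := hf j j
        simp_rw [mul_comm (f j _)] at h3
        rw [h2] at h3
        simp only [if_true] at h3
        rw [lintegral_enorm_sq_eq hg.memLp, show ∫ x, ‖f j x‖ ^ 2 = 1 by exact_mod_cast h3,
          ENNReal.ofReal_one]
      rw [h1, hC, mul_one]
    · simp [schrodinger_eq_zero hb]
  have hm : ∀ j t, Measurable (schrodinger (f j) t) := fun j t => by
    by_cases hb : Integrable (f j) ∧ Integrable (FT (f j))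
    · have hg := isGood_of_integral (by rw [hf j j]; simp) hb
      have : Measurable ((fun z : SpaceTime n => schrodinger (f j) z.1 z.2) ∘ Prod.mk t) :=
        hg.measurable_schrodinger.comp measurable_prodMk_left
      exact this
    · rw [schrodinger_eq_zero hb]
      exact measurable_const
  rw [mixedLp, eLp, if_pos rfl]
  refine essSup_le_of_ae_le _ (Filter.Eventually.of_forall fun t => ?_)
  simp only [eLpNorm_one_eq_lintegral_enorm]
  calc _ ≤ ∫⁻ x, ∑' j, ENNReal.ofReal |lam j| * ‖schrodinger (f j) t x‖ₑ ^ 2 :=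
        lintegral_mono fun x => enorm_density_le lam f t x
    _ = ∑' j, ENNReal.ofReal |lam j| * ∫⁻ x, ‖schrodinger (f j) t x‖ₑ ^ 2 := by
        rw [lintegral_tsum fun j => (((hm j t).enorm.pow_const 2).const_mul _).aemeasurable]
        exact tsum_congr fun j => lintegral_const_mul _ ((hm j t).enorm.pow_const 2)
    _ ≤ ∑' j, ENNReal.ofReal |lam j| * C := by
        gcongr with j
        exact hu j t
    _ = C * seqNormE 1 lam := by
        rw [ENNReal.tsum_mul_right, mul_comm, seqNormE, if_neg ENNReal.one_ne_top]
        simp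

end OrthonormalStrichartz

/-- Frank–Lewin–Lieb–Seiringer / Frank–Sabin orthonormal Strichartz
estimates on the half-open segment `(A, B]` (so `2/q + n/p = n`,
`(n-1)/(n+1) < 1/p ≤ 1`) with `α = 2p/(p+1)`, for data orthonormal in `L²(ℝⁿ)`.
Here `(a, b) = (1/p, 1/q)` and `2p/(p+1) = 2/(1+a)`. -/
theorem orthonormal_strichartz_AB (n : ℕ) (hn : 1 ≤ n) (a b : ℝ)
    (hab : ∃ t ∈ Ioc (0 : ℝ) 1, (a, b) = (1 - t) • ptA n + t • ptB) :
    ∃ C : ℝ, 0 < C ∧ ∀ (f : ℕ → Rn n → ℂ) (lam : ℕ → ℝ),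
      OrthonormalL2 f → seqNormE (ENNReal.ofReal (2 / (1 + a))) lam ≠ ∞ →
      mixedLp (expOf b) (expOf a) (density lam f)
        ≤ ENNReal.ofReal C * seqNormE (ENNReal.ofReal (2 / (1 + a))) lam := by
  suffices h : ∃ C : ℝ≥0∞, C ≠ ∞ ∧ ∀ (f : ℕ → Rn n → ℂ) (lam : ℕ → ℝ),
      OrthonormalL2 f → seqNormE (ENNReal.ofReal (2 / (1 + a))) lam ≠ ∞ →
      mixedLp (expOf b) (expOf a) (density lam f)
        ≤ C * seqNormE (ENNReal.ofReal (2 / (1 + a))) lam by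
    obtain ⟨C, hC, H⟩ := h
    refine ⟨C.toReal + 1, by positivity, fun f lam hf hl => (H f lam hf hl).trans ?_⟩
    gcongr
    exact (ENNReal.le_ofReal_iff_toReal_le hC (by positivity)).2 (by linarith)
  obtain ⟨t, ⟨ht0, ht1⟩, h⟩ := hab
  simp only [ptA, ptB, Prod.smul_mk, Prod.mk_add_mk, Prod.mk.injEq, smul_eq_mul, mul_one,
    mul_zero, add_zero] at h
  obtain ⟨hA, hB⟩ := h
  have hn1 : (0 : ℝ) < n + 1 := by positivity
  rcases ht1.eq_or_lt with rfl | ht1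
  · obtain ⟨C, hC, H⟩ := mixed_density_endpoint n
    have ha : a = 1 := by rw [hA]; ring
    have hb : b = 0 := by rw [hB]; ring
    subst ha hb
    refine ⟨C, hC, fun f lam hf _ => ?_⟩
    have e : (2 : ℝ) / (1 + 1) = 1 := by norm_num
    simpa [expOf, e] using H f lam hf
  · refine mixed_density_le n hn ?_ ?_ ?_
    · rw [hA, div_lt_iff₀ hn1]
      field_simp
      linarith
    · rw [hA]
      have : ((n : ℝ) - 1) / (n + 1) < 1 := by rw [div_lt_one hn1]; linarith
      nlinarith
    · rw [hA, hB]
      field_simp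
      ring
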